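/- Let k be a perfect field and let A and B be two complete Noetherian local commutative rings containing k such that the completed tensor product A⊗̂_k B is Noetherian. If A and B are normal (their localizations at every prime ideal are integrally closed domains), then A⊗̂_k B is normal. -/

import Mathlib

open TensorProduct

/-- The ideal `r = m ⊗ B + A ⊗ n` of `C = A ⊗[k] B`, where `m` and `n` are the Jacobson
radicals of `A` and `B` (for a local ring, the Jacobson radical is the maximal ideal). -/
noncomputable def tensorRadical (k A B : Type*) [Field k] [CommRing A] [CommRing B]
    [Algebra k A] [Algebra k B] : Ideal (A ⊗[k] B) :=
  Ideal.map (Algebra.TensorProduct.includeLeft (R := k) (S := k) (A := A) (B := B))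
      ((⊥ : Ideal A).jacobson) ⊔
    Ideal.map (Algebra.TensorProduct.includeRight (R := k) (A := A) (B := B))
      ((⊥ : Ideal B).jacobson)

/-- The completed tensor product `A ⊗̂[k] B`: the `r`-adic separated completion of
`C = A ⊗[k] B`, i.e. the inverse limit of the rings `C ⧸ r ^ i`. -/
noncomputable abbrev CompletedTensor (k A B : Type*) [Field k] [CommRing A] [CommRing B]
    [Algebra k A] [Algebra k B] : Type _ :=
  AdicCompletion (tensorRadical k A B) (A ⊗[k] B)

/-- A commutative ring is normal if its localization at every prime ideal is an
integrally closed domain. -/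
def IsNormalRing (R : Type*) [CommRing R] : Prop :=
  ∀ (P : Ideal R) (hP : P.IsPrime),
    haveI : P.IsPrime := hP
    IsDomain (Localization.AtPrime P) ∧ IsIntegrallyClosed (Localization.AtPrime P)

namespace CTN

/-- `u / v` is integral, expressed without denominators. -/
def HomInt {R : Type*} [CommRing R] (u v : R) : Prop :=
  ∃ (n : ℕ) (c : ℕ → R), u ^ n + ∑ i ∈ Finset.range n, c i * u ^ i * v ^ (n - i) = 0

/-- Elementwise normality. -/
def Nice (R : Type*) [CommRing R] : Prop :=
  IsReduced R ∧ ∀ u v : R, v ∈ nonZeroDivisors R → HomInt u v → v ∣ u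

section basic
variable {R S : Type*} [CommRing R] [CommRing S]

lemma HomInt.map {u v : R} (h : HomInt u v) (f : R →+* S) : HomInt (f u) (f v) := by
  obtain ⟨n, c, h⟩ := h
  refine ⟨n, fun i => f (c i), ?_⟩
  simpa using congrArg f h

lemma HomInt.mul_both {u v : R} (h : HomInt u v) (t : R) : HomInt (t * u) (t * v) := by
  obtain ⟨n, c, h⟩ := h
  refine ⟨n, c, ?_⟩
  have : t ^ n * (u ^ n + ∑ i ∈ Finset.range n, c i * u ^ i * v ^ (n - i)) = 0 := by
    rw [h, mul_zero]
  rw [← this, mul_add, Finset.mul_sum, mul_pow]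
  congr 1
  refine Finset.sum_congr rfl fun i hi => ?_
  have hi' : i + (n - i) = n := by have := Finset.mem_range.1 hi; omega
  conv_rhs => rw [← hi']
  simp only [Nat.add_sub_cancel_left]
  rw [mul_pow, mul_pow, pow_add]; ring

lemma HomInt.of_mul_right {u v t : R} (h : HomInt u (t * v)) : HomInt u v := by
  obtain ⟨n, c, h⟩ := h
  refine ⟨n, fun i => c i * t ^ (n - i), ?_⟩
  rw [← h]
  congr 1
  refine Finset.sum_congr rfl fun i hi => ?_
  rw [mul_pow]; ring

lemma HomInt.mul_left {u v : R} (h : HomInt u v) (t : R) : HomInt (t * u) v :=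
  (h.mul_both t).of_mul_right

lemma HomInt.pow {u v : R} (h : HomInt u v) : ∃ n : ℕ, ∀ m, v ^ m ∣ v ^ n * u ^ m := by
  obtain ⟨n, c, h⟩ := h
  refine ⟨n, fun m => ?_⟩
  induction m using Nat.strong_induction_on with
  | _ m ih =>
    by_cases hm : m ≤ n
    · exact Dvd.dvd.mul_right (pow_dvd_pow _ hm) _
    · have h1 : u ^ m = - ∑ i ∈ Finset.range n, c i * u ^ (i + (m - n)) * v ^ (n - i) := by
        have : u ^ m = u ^ n * u ^ (m - n) := by rw [← pow_add]; congr 1; omega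
        rw [this, eq_neg_of_add_eq_zero_left h, neg_mul, Finset.sum_mul]
        congr 1
        refine Finset.sum_congr rfl fun i hi => ?_
        rw [pow_add]; ring
      rw [h1, mul_neg, dvd_neg, Finset.mul_sum]
      refine Finset.dvd_sum fun i hi => ?_
      have hi := Finset.mem_range.1 hi
      have h2 := ih (i + (m - n)) (by omega)
      have : v ^ m = v ^ (i + (m - n)) * v ^ (n - i) := by rw [← pow_add]; congr 1; omega
      rw [this]
      obtain ⟨w, hw⟩ := h2
      refine ⟨c i * w, ?_⟩
      calc _ = c i * (v ^ n * u ^ (i + (m - n))) * v ^ (n - i) := by ring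
        _ = _ := by rw [hw]; ring

lemma homInt_of_isIntegral [Algebra R S] (hf : Function.Injective (algebraMap R S)) {u v : R}
    {z : S} (hz : IsIntegral R z) (h : algebraMap R S u = algebraMap R S v * z) : HomInt u v := by
  obtain ⟨p, hp, hpz⟩ := hz
  refine ⟨p.natDegree, p.coeff, hf ?_⟩
  rw [hp.as_sum] at hpz
  simp only [Polynomial.eval₂_add, Polynomial.eval₂_finsetSum, Polynomial.eval₂_mul,
    Polynomial.eval₂_C, Polynomial.eval₂_X_pow] at hpz
  have : algebraMap R S v ^ p.natDegree *
    (z ^ p.natDegree + ∑ i ∈ Finset.range p.natDegree, algebraMap R S (p.coeff i) * z ^ i) = 0 := by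
    rw [hpz, mul_zero]
  rw [map_zero, ← this]
  simp only [map_add, map_sum, map_mul, map_pow, h, mul_add, Finset.mul_sum, mul_pow]
  congr 1
  refine Finset.sum_congr rfl fun i hi => ?_
  have hi' : i + (p.natDegree - i) = p.natDegree := by have := Finset.mem_range.1 hi; omega
  have e : algebraMap R S v ^ p.natDegree =
      algebraMap R S v ^ i * algebraMap R S v ^ (p.natDegree - i) := by rw [← pow_add, hi']
  rw [e]; ring

lemma isIntegral_of_homInt [Algebra R S] {u v : R} {z : S}
    (hv : algebraMap R S v ∈ nonZeroDivisors S) (h : algebraMap R S u = algebraMap R S v * z)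
    (hh : HomInt u v) : IsIntegral R z := by
  obtain ⟨n, c, hh⟩ := hh
  have key : z ^ n + ∑ i ∈ Finset.range n, algebraMap R S (c i) * z ^ i = 0 := by
    have h1 : algebraMap R S v ^ n ∈ nonZeroDivisors S := pow_mem hv n
    apply (mem_nonZeroDivisors_iff.1 h1).1
    have := congrArg (algebraMap R S) hh
    rw [map_zero] at this
    rw [← this]
    simp only [map_add, map_sum, map_mul, map_pow, h, mul_add, Finset.mul_sum, mul_pow]
    congr 1
    refine Finset.sum_congr rfl fun i hi => ?_
    have hi' : i + (n - i) = n := by have := Finset.mem_range.1 hi; omega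
    have e : algebraMap R S v ^ n =
      algebraMap R S v ^ i * algebraMap R S v ^ (n - i) := by rw [← pow_add, hi']
    rw [e]; ring
  refine ⟨Polynomial.X ^ n + ∑ i ∈ Finset.range n, Polynomial.C (c i) * Polynomial.X ^ i,
    ?_, ?_⟩
  · apply Polynomial.monic_X_pow_add
    refine (Polynomial.degree_sum_le _ _).trans_lt ?_
    rw [Finset.sup_lt_iff (by exact WithBot.bot_lt_coe n)]
    intro i hi
    exact (Polynomial.degree_C_mul_X_pow_le _ _).trans_lt (by exact_mod_cast Finset.mem_range.1 hi)
  · simpa [Polynomial.eval₂_finsetSum] using key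

lemma dvd_of_homInt [IsDomain R] [IsIntegrallyClosed R] {u v : R} (hv : v ≠ 0)
    (h : HomInt u v) : v ∣ u := by
  let K := FractionRing R
  have hv' : algebraMap R K v ≠ 0 := by simpa using hv
  have h1 : IsIntegral R (algebraMap R K u / algebraMap R K v) :=
    isIntegral_of_homInt (v := v) (mem_nonZeroDivisors_of_ne_zero hv')
      (mul_div_cancel₀ _ hv').symm h
  obtain ⟨y, hy⟩ := IsIntegrallyClosed.algebraMap_eq_of_integral h1
  refine ⟨y, IsFractionRing.injective R K ?_⟩
  rw [map_mul, hy, mul_div_cancel₀ _ hv']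

lemma isIntegrallyClosed_of_homInt [IsDomain R]
    (H : ∀ u v : R, v ≠ 0 → HomInt u v → v ∣ u) : IsIntegrallyClosed R := by
  rw [isIntegrallyClosed_iff (FractionRing R)]
  intro x hx
  obtain ⟨u, v, hv, rfl⟩ := IsFractionRing.div_surjective (A := R) x
  have hv0 := nonZeroDivisors.ne_zero hv
  have hv' : algebraMap R (FractionRing R) v ≠ 0 := by simpa using hv0
  obtain ⟨w, rfl⟩ := H u v hv0 (homInt_of_isIntegral (IsFractionRing.injective R _) hx
    (mul_div_cancel₀ _ hv').symm)
  exact ⟨w, by rw [map_mul, mul_div_cancel_left₀ _ hv']⟩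

lemma HomInt.of_localization (M : Submonoid R) [Algebra R S] [IsLocalization M S] {u v : R}
    (h : HomInt (algebraMap R S u) (algebraMap R S v)) : ∃ s ∈ M, HomInt (s * u) v := by
  obtain ⟨n, c, h⟩ := h
  obtain ⟨s, hs⟩ := IsLocalization.exist_integer_multiples M (Finset.range n) c
  choose! d hd using hs
  have e1 : algebraMap R S ((s * u) ^ n +
      ∑ i ∈ Finset.range n, (d i * s ^ (n - 1 - i)) * (s * u) ^ i * v ^ (n - i)) = 0 := by
    have h' : algebraMap R S (s:R) ^ n * ((algebraMap R S u) ^ n +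
      ∑ i ∈ Finset.range n, c i * (algebraMap R S u) ^ i * (algebraMap R S v) ^ (n - i)) = 0 := by
      rw [h, mul_zero]
    rw [← h']
    simp only [map_add, map_sum, map_mul, map_pow, mul_add, Finset.mul_sum, mul_pow]
    congr 1
    refine Finset.sum_congr rfl fun i hi => ?_
    rw [hd i hi, Algebra.smul_def]
    have hi' : i + (n - 1 - i) + 1 = n := by have := Finset.mem_range.1 hi; omega
    have : algebraMap R S (s:R) ^ n = algebraMap R S s ^ i * algebraMap R S s ^ (n - 1 - i)
      * algebraMap R S s := by rw [← pow_add, ← pow_succ, hi']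
    rw [this]; ring
  obtain ⟨w, hw⟩ := (IsLocalization.map_eq_zero_iff M S _).1 e1
  by_cases hn : 1 ≤ n
  swap
  · obtain rfl : n = 0 := by omega
    exact ⟨w, w.2, 1, fun _ => 0, by
      have h0 : (w : R) = 0 := by simpa using hw
      simp [h0]⟩
  have : HomInt ((w : R) * (s * u)) v := by
    refine ⟨n, fun i => (d i * s ^ (n - 1 - i)) * w ^ (n - i), ?_⟩
    have h2 : (w:R) ^ n * ((s * u) ^ n +
      ∑ i ∈ Finset.range n, (d i * s ^ (n - 1 - i)) * (s * u) ^ i * v ^ (n - i)) = 0 := by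
      rw [← Nat.sub_add_cancel hn, pow_succ, Nat.sub_add_cancel hn, mul_assoc, hw, mul_zero]
    rw [← h2, mul_add, Finset.mul_sum, mul_pow]
    congr 1
    refine Finset.sum_congr rfl fun i hi => ?_
    have hi' : i + (n - i) = n := by have := Finset.mem_range.1 hi; omega
    have e : (w:R) ^ n = (w:R) ^ i * (w:R) ^ (n - i) := by rw [← pow_add, hi']
    rw [e, mul_pow]; ring
  exact ⟨w * s, (w * s).2, by rwa [mul_assoc]⟩

end basic
end CTN

namespace CTN
section normal
variable {R S : Type*} [CommRing R] [CommRing S]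

lemma mem_nzd_of_minimalPrimes [IsReduced R] (y : R) (hy : ∀ P ∈ minimalPrimes R, y ∉ P) :
    y ∈ nonZeroDivisors R := by
  rw [mem_nonZeroDivisors_iff_left]
  intro z hz
  have h0 : z ∈ sInf (Ideal.minimalPrimes (⊥ : Ideal R)) := by
    rw [Submodule.mem_sInf]
    intro P hP
    have hP' : Ideal.IsPrime P := hP.1.1
    exact (hP'.mem_or_mem (show y * z ∈ P by rw [hz]; exact zero_mem P)).resolve_left (hy P hP)
  rw [Ideal.sInf_minimalPrimes] at h0
  obtain ⟨n, hn⟩ := h0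
  exact IsReduced.eq_zero z ⟨n, by simpa using hn⟩

lemma exists_mul_eq_zero_of_minimal [IsReduced R] {P : Ideal R} (hP : P ∈ minimalPrimes R) {x : R}
    (hx : x ∈ P) : ∃ s ∉ P, s * x = 0 := by
  have hP' : P.IsPrime := hP.1.1
  by_contra! hc
  obtain ⟨Q, hQ, -, hd⟩ := Ideal.exists_le_prime_disjoint (⊥ : Ideal R)
    (P.primeCompl ⊔ Submonoid.powers x) (by
      rw [Set.disjoint_left]
      rintro y hy hy'
      obtain rfl : y = 0 := hy
      obtain ⟨s, hs, t, ⟨n, rfl⟩, hst⟩ := Submonoid.mem_sup.1 hy'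
      refine hc s hs (IsReduced.eq_zero _ ⟨n + 1, ?_⟩)
      calc (s * x) ^ (n+1) = s ^ n * x * (s * x ^ n) := by ring
        _ = 0 := by
          have : s * x ^ n = 0 := hst
          rw [this, mul_zero])
  rw [Set.disjoint_left] at hd
  have hQP : Q ≤ P := by
    intro y hy
    by_contra h
    exact hd hy (Submonoid.mem_sup_left h)
  exact hd (hP.2 ⟨hQ, bot_le⟩ hQP hx) (Submonoid.mem_sup_right (Submonoid.mem_powers x))

lemma exists_nzd [IsNoetherianRing R] [IsReduced R] (x : R) :
    ∃ b, x * b = 0 ∧ x + b ∈ nonZeroDivisors R := by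
  classical
  have hfin := minimalPrimes.finite_of_isNoetherianRing R
  let s := hfin.toFinset.filter (fun P => x ∈ P)
  let I : Ideal R := Ideal.span {x} |>.annihilator
  have hI : ∀ b, b ∈ I ↔ x * b = 0 := by
    intro b
    rw [Submodule.mem_annihilator_span_singleton, smul_eq_mul, mul_comm]
  have h1 : ¬ ((I : Set R) ⊆ ⋃ i ∈ (↑s : Set (Ideal R)), ((id i : Ideal R) : Set R)) := by
    rw [Ideal.subset_union_prime (f := id) ⊥ ⊥]
    · rintro ⟨P, hP, hle⟩
      simp only [s, Finset.mem_filter, Set.Finite.mem_toFinset] at hP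
      obtain ⟨y, hy, hyx⟩ := exists_mul_eq_zero_of_minimal hP.1 hP.2
      exact hy (hle ((hI y).2 (by rw [mul_comm, hyx])))
    · intro P hP _ _
      simp only [s, Finset.mem_filter, Set.Finite.mem_toFinset] at hP
      exact hP.1.1.1
  rw [Set.not_subset] at h1
  obtain ⟨b, hb, hb'⟩ := h1
  have hxb := (hI b).1 hb
  refine ⟨b, hxb, mem_nzd_of_minimalPrimes _ fun P hP hmem => ?_⟩
  have hP' : P.IsPrime := hP.1.1
  by_cases hx : x ∈ P
  · have : b ∈ P := (Ideal.add_mem_iff_right P hx).1 hmem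
    apply hb'
    simp only [Set.mem_iUnion]
    exact ⟨P, by
      simp only [s, Finset.coe_filter, Set.Finite.mem_toFinset, Set.mem_ofPred_eq]
      exact ⟨hP, hx⟩, this⟩
  · have : b ∈ P := (hP'.mem_or_mem (show x * b ∈ P by rw [hxb]; exact P.zero_mem)).resolve_left hx
    exact hx ((Ideal.add_mem_iff_left P this).1 hmem)

lemma Nice.exists_idem [IsNoetherianRing R] (h : Nice R) (x : R) :
    ∃ b c : R, x + b ∈ nonZeroDivisors R ∧ x = (x + b) * c ∧ x * (1 - c) = 0 ∧ b * c = 0 := by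
  have := h.1
  obtain ⟨b, hb, hnz⟩ := exists_nzd x
  obtain ⟨c, hc⟩ := h.2 x (x + b) hnz ⟨2, fun i => if i = 1 then -1 else 0, by
    simp; linear_combination - hb⟩
  have hc1 : c * (1 - c) = 0 := by
    rw [mem_nonZeroDivisors_iff_left] at hnz
    apply hnz; apply hnz
    have : b = (x + b) * (1 - c) := by linear_combination -hc
    calc _ = ((x+b) * c) * ((x+b) * (1 - c)) := by ring
      _ = 0 := by rw [← hc, ← this, hb]
  have hx : x * (1 - c) = 0 := by rw [hc, mul_assoc, hc1, mul_zero]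
  refine ⟨b, c, hnz, hc, hx, ?_⟩
  linear_combination hx - hc

lemma Nice.isNormalRing [IsNoetherianRing R] (h : Nice R) : IsNormalRing R := by
  intro P hP
  have := hP
  have dich : ∀ c : R, c ∉ P ∨ 1 - c ∉ P := by
    intro c
    by_contra! hh
    exact hP.ne_top ((Ideal.eq_top_iff_one P).2 (by simpa using P.add_mem hh.1 hh.2))
  have zero_iff : ∀ x : R, algebraMap R (Localization.AtPrime P) x = 0 ↔ ∃ s, s ∉ P ∧ s * x = 0 := by
    intro x
    rw [IsLocalization.map_eq_zero_iff P.primeCompl]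
    exact ⟨fun ⟨s, hs⟩ => ⟨s, s.2, hs⟩, fun ⟨s, hs, h⟩ => ⟨⟨s, hs⟩, h⟩⟩
  have unit : ∀ s : R, s ∉ P → IsUnit (algebraMap R (Localization.AtPrime P) s) :=
    fun s hs => IsLocalization.map_units (M := P.primeCompl) (Localization.AtPrime P) ⟨s, hs⟩
  have hdom : IsDomain (Localization.AtPrime P) := by
    have : NoZeroDivisors (Localization.AtPrime P) := by
      constructor
      intro a b hab
      obtain ⟨x, s, rfl⟩ := IsLocalization.exists_mk'_eq P.primeCompl a
      obtain ⟨y, t, rfl⟩ := IsLocalization.exists_mk'_eq P.primeCompl b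
      rw [← IsLocalization.mk'_mul, IsLocalization.mk'_eq_zero_iff] at hab
      obtain ⟨w, hw⟩ := hab
      obtain ⟨b, c, hnz, hc, hx, hb⟩ := h.exists_idem (w * x)
      rw [IsLocalization.mk'_eq_zero_iff, IsLocalization.mk'_eq_zero_iff]
      rcases dich c with h1 | h1
      · right
        refine ⟨⟨c, h1⟩, ?_⟩
        refine (mem_nonZeroDivisors_iff_left.1 hnz) _ ?_
        calc _ = ((w * x + b) * c) * y := by ring
          _ = 0 := by rw [← hc, mul_assoc, hw]
      · left
        refine ⟨⟨1 - c, h1⟩ * w, ?_⟩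
        simp only [Submonoid.coe_mul]
        linear_combination hx
    exact NoZeroDivisors.to_isDomain _
  refine ⟨hdom, isIntegrallyClosed_of_homInt fun a b hb hab => ?_⟩
  obtain ⟨u, s, rfl⟩ := IsLocalization.exists_mk'_eq P.primeCompl a
  obtain ⟨v, t, rfl⟩ := IsLocalization.exists_mk'_eq P.primeCompl b
  set f := algebraMap R (Localization.AtPrime P) with hf
  have hu : f u = f s * IsLocalization.mk' _ u s := by rw [mul_comm, IsLocalization.mk'_spec]
  have hv : f v = f t * IsLocalization.mk' _ v t := by rw [mul_comm, IsLocalization.mk'_spec]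
  have hab' : HomInt (f u) (f v) := by
    have h1 := (hab.mul_both (f t)).mul_left (f s)
    rw [← hv, mul_left_comm, ← hu] at h1
    have h2 : HomInt (f t * f u) (f v) := h1
    obtain ⟨ti, hti⟩ := unit t t.2
    have := h2.mul_left (↑ti⁻¹)
    rwa [← hti, ← mul_assoc, Units.inv_mul, one_mul] at this
  obtain ⟨w, hw, hwuv⟩ := hab'.of_localization P.primeCompl
  have hv0 : f v ≠ 0 := by
    rw [hv]; exact mul_ne_zero (unit t t.2).ne_zero hb
  obtain ⟨b, c, hnz, hc, hx, hb⟩ := h.exists_idem v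
  have hcP : c ∉ P := by
    rcases dich c with h1 | h1
    · exact h1
    · exact absurd ((zero_iff v).2 ⟨_, h1, by rw [mul_comm, hx]⟩) hv0
  have h3 : HomInt (c * (w * u)) (v + b) := by
    have h4 := hwuv.mul_both c
    have : c * v = c * (v + b) := by linear_combination -hb
    rw [this] at h4
    exact h4.of_mul_right
  obtain ⟨g, hg⟩ := h.2 _ _ hnz h3
  have h5 : f v ∣ f u := by
    have : c * c * w * u = v * g := by linear_combination c * hg + g * hb - g * hx
    rw [← (((unit c hcP).mul (unit c hcP)).mul (unit w hw)).dvd_mul_left, ← map_mul, ← map_mul,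
      ← map_mul, this, map_mul]
    exact dvd_mul_right _ _
  rw [hu, hv, (unit s s.2).dvd_mul_left, (unit t t.2).mul_left_dvd] at h5
  exact h5

lemma nice_of_maximal
    (h : ∀ (P : Ideal R) [P.IsMaximal],
      IsDomain (Localization.AtPrime P) ∧ IsIntegrallyClosed (Localization.AtPrime P)) :
    Nice R := by
  refine ⟨⟨fun x hx => ?_⟩, fun u v hv huv => ?_⟩
  · by_contra hne
    obtain ⟨P, hP, hle⟩ := Ideal.exists_le_maximal (Ideal.span {x}).annihilator (by
      rw [Ne, Ideal.eq_top_iff_one, Submodule.mem_annihilator_span_singleton, one_smul]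
      exact hne)
    have := (h P).1
    have h0 : algebraMap R (Localization.AtPrime P) x = 0 := (hx.map _).eq_zero
    rw [IsLocalization.map_eq_zero_iff P.primeCompl] at h0
    obtain ⟨s, hs⟩ := h0
    exact s.2 (hle (by rw [Submodule.mem_annihilator_span_singleton]; exact hs))
  · by_contra hne
    let I : Ideal R := (Ideal.span {v}).colon {u}
    have hI : ∀ r, r ∈ I ↔ v ∣ r * u := by
      intro r
      simp only [I]
      rw [Submodule.mem_colon_singleton, smul_eq_mul, Ideal.mem_span_singleton]
    obtain ⟨P, hP, hle⟩ := Ideal.exists_le_maximal I (by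
      rw [Ne, Ideal.eq_top_iff_one, hI, one_mul]
      exact hne)
    have h1 := (h P).1
    have h2 := (h P).2
    have hv0 : algebraMap R (Localization.AtPrime P) v ≠ 0 := by
      intro h0
      rw [IsLocalization.map_eq_zero_iff P.primeCompl] at h0
      obtain ⟨s, hs⟩ := h0
      have := (mem_nonZeroDivisors_iff.1 hv).2 _ hs
      exact s.2 (by rw [this]; exact P.zero_mem)
    obtain ⟨z, hz⟩ := dvd_of_homInt hv0 (huv.map (algebraMap R (Localization.AtPrime P)))
    obtain ⟨a, s, rfl⟩ := IsLocalization.exists_mk'_eq P.primeCompl z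
    rw [IsLocalization.mul_mk'_eq_mk'_of_mul, IsLocalization.eq_mk'_iff_mul_eq, ← map_mul,
      IsLocalization.eq_iff_exists P.primeCompl] at hz
    obtain ⟨w, hw⟩ := hz
    refine (w * s).2 (hle ?_)
    rw [hI]
    refine ⟨w * a, ?_⟩
    simp only [Submonoid.coe_mul]
    linear_combination hw

lemma nice_of_isNormalRing (h : IsNormalRing R) : Nice R :=
  nice_of_maximal fun P _ => h P inferInstance

lemma Nice.of_equiv (h : Nice R) (e : R ≃+* S) : Nice S := by
  refine ⟨?_, fun u v hv huv => ?_⟩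
  · have := h.1
    exact isReduced_of_injective e.symm e.symm.injective
  · have := h.2 (e.symm u) (e.symm v) ?_ (huv.map e.symm.toRingHom)
    · simpa using map_dvd e this
    · rw [mem_nonZeroDivisors_iff_left] at hv ⊢
      intro x hx
      have := hv (e x) (by simpa using congrArg e hx)
      simpa using this
end normal
end CTN

namespace CTN
section lemmaN
variable {S : Type*} [CommRing S]

/-- almost integrality, elementwise -/
def AI (u v : S) : Prop := ∃ c : S, c ≠ 0 ∧ ∀ n, v ^ n ∣ c * u ^ n

lemma AI.dvd [IsDomain S] [IsNoetherianRing S] [IsIntegrallyClosed S] {u v : S} (hv : v ≠ 0)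
    (h : AI u v) : v ∣ u := by
  obtain ⟨c, hc, h⟩ := h
  have hv' : algebraMap S (FractionRing S) v ≠ 0 := by simpa using hv
  have : IsAlmostIntegral S (algebraMap S (FractionRing S) u / algebraMap S (FractionRing S) v) := by
    refine ⟨c, mem_nonZeroDivisors_of_ne_zero hc, fun n => ?_⟩
    obtain ⟨w, hw⟩ := h n
    refine ⟨w, ?_⟩
    rw [Algebra.smul_def, div_pow, mul_div_assoc', eq_div_iff (pow_ne_zero _ hv'), ← map_pow,
      ← map_pow, ← map_mul, ← map_mul, hw, mul_comm]
  obtain ⟨y, hy⟩ := IsIntegrallyClosed.algebraMap_eq_of_integral this.isIntegral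
  refine ⟨y, IsFractionRing.injective S (FractionRing S) ?_⟩
  rw [map_mul, hy, mul_div_cancel₀ _ hv']

lemma exists_eq_pow_mul [IsLocalRing S] [IsNoetherianRing S] {x : S}
    (hx : x ∈ IsLocalRing.maximalIdeal S) {a : S} (ha : a ≠ 0) :
    ∃ (n : ℕ) (b : S), ¬ x ∣ b ∧ a = x ^ n * b := by
  have h : ∃ n, ¬ x ^ n ∣ a := by
    by_contra! hc
    have h1 := Ideal.iInf_pow_eq_bot_of_isLocalRing (Ideal.span {x}) (by
      intro h
      rw [Ideal.span_singleton_eq_top] at h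
      exact (IsLocalRing.mem_maximalIdeal x).1 hx h)
    apply ha
    rw [← Ideal.mem_bot, ← h1, Ideal.mem_iInf]
    intro n
    rw [Ideal.span_singleton_pow, Ideal.mem_span_singleton]
    exact hc n
  classical
  have h0 : Nat.find h ≠ 0 := by
    intro h0
    have := Nat.find_spec h
    rw [h0] at this
    simp at this
  obtain ⟨n, hn⟩ := Nat.exists_eq_succ_of_ne_zero h0
  have h2 := Nat.find_min h (m := n) (by omega)
  rw [not_not] at h2
  obtain ⟨b, hb⟩ := h2
  refine ⟨n, b, fun ⟨c, hc⟩ => Nat.find_spec h ?_, hb⟩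
  rw [hn, hb, hc]
  exact ⟨c, by rw [pow_succ]; ring⟩

lemma local_case [IsLocalRing S] [IsNoetherianRing S] {x : S}
    (hx : x ∈ IsLocalRing.maximalIdeal S) (hnz : x ∈ nonZeroDivisors S)
    [IsDomain (S ⧸ Ideal.span {x})] [IsIntegrallyClosed (S ⧸ Ideal.span {x})] :
    IsDomain S ∧ IsIntegrallyClosed S := by
  have hx0 : x ≠ 0 := nonZeroDivisors.ne_zero hnz
  have hsp : (Ideal.span {x}).IsPrime := (Ideal.Quotient.isDomain_iff_prime _).1 inferInstance
  have hxp : Prime x := (Ideal.span_singleton_prime hx0).1 hsp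
  have hxu : ∀ n, x ^ n ∈ nonZeroDivisors S := fun n => pow_mem hnz n
  have hdom : IsDomain S := by
    have : NoZeroDivisors S := by
      constructor
      intro a b hab
      by_contra! hc
      obtain ⟨n, a', ha', rfl⟩ := exists_eq_pow_mul hx hc.1
      obtain ⟨m, b', hb', rfl⟩ := exists_eq_pow_mul hx hc.2
      have : x ^ (n + m) * (a' * b') = 0 := by rw [← hab]; ring
      have := (mem_nonZeroDivisors_iff_left.1 (hxu _)) _ this
      have h2 : x ∣ a' * b' := by rw [this]; exact dvd_zero x
      rcases hxp.dvd_or_dvd h2 with h | h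
      · exact ha' h
      · exact hb' h
    exact NoZeroDivisors.to_isDomain _
  refine ⟨hdom, isIntegrallyClosed_of_homInt ?_⟩
  -- reduce: step
  have hcop : ∀ (v w y : S) (n : ℕ), ¬ x ∣ v → x ^ n * y = v * w → ∃ w', w = x ^ n * w' := by
    intro v w y n hv h
    have h1 : x ^ n ∣ v * w := ⟨y, h.symm⟩
    exact hxp.pow_dvd_of_dvd_mul_left n hv h1
  have hpow : ∀ (v : S) (n : ℕ), ¬ x ∣ v → ¬ x ∣ v ^ n := fun v n h h' => h (hxp.dvd_of_dvd_pow h')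
  have step : ∀ (v : S), ¬ x ∣ v → ∀ u, AI u v → ∃ a u1, u = v * a + x * u1 ∧ AI u1 v := by
    rintro v hv u ⟨c, hc, h⟩
    obtain ⟨l, c', hc', rfl⟩ := exists_eq_pow_mul hx hc
    have hv0 : v ≠ 0 := by rintro rfl; exact hv (dvd_zero _)
    have hc'0 : c' ≠ 0 := by rintro rfl; exact hc' (dvd_zero _)
    have h1 : ∀ n, v ^ n ∣ c' * u ^ n := by
      intro n
      obtain ⟨w, hw⟩ := h n
      rw [mul_assoc] at hw
      obtain ⟨w', rfl⟩ := hcop _ _ _ _ (hpow v n hv) hw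
      refine ⟨w', mul_left_cancel₀ (pow_ne_zero l hx0) ?_⟩
      rw [hw]; ring
    let π := Ideal.Quotient.mk (Ideal.span {x})
    have hπ : ∀ a, π a = 0 ↔ x ∣ a := fun a => by
      rw [Ideal.Quotient.eq_zero_iff_mem, Ideal.mem_span_singleton]
    have h2 : AI (π u) (π v) := ⟨π c', by rwa [Ne, hπ], fun n => by
      simpa using map_dvd π (h1 n)⟩
    obtain ⟨a, ha⟩ := h2.dvd (by rwa [Ne, hπ])
    obtain ⟨a, rfl⟩ := Ideal.Quotient.mk_surjective a
    have h3 : x ∣ u - v * a := by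
      rw [← hπ, map_sub, map_mul, ha, sub_self]
    obtain ⟨u1, hu1⟩ := h3
    refine ⟨a, u1, by linear_combination hu1, c', hc'0, fun n => ?_⟩
    have h4 : v ^ n ∣ c' * (u - v * a) ^ n := by
      rw [sub_pow, Finset.mul_sum]
      refine Finset.dvd_sum fun m hm => ?_
      have hm := Finset.mem_range.1 hm
      obtain ⟨w, hw⟩ := h1 m
      have e : v ^ n = v ^ m * v ^ (n - m) := by rw [← pow_add]; congr 1; omega
      refine ⟨(-1) ^ (m + n) * w * a ^ (n - m) * (n.choose m), ?_⟩
      rw [e, mul_pow]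
      linear_combination ((-1) ^ (m + n) * (v ^ (n - m) * a ^ (n - m)) * (n.choose m)) * hw
    rw [hu1] at h4
    obtain ⟨w, hw⟩ := h4
    have hw2 : x ^ n * (c' * u1 ^ n) = v ^ n * w := by rw [← hw]; ring
    obtain ⟨w', rfl⟩ := hcop _ _ _ _ (hpow v n hv) hw2
    refine ⟨w', mul_left_cancel₀ (pow_ne_zero n hx0) ?_⟩
    rw [hw2]; ring
  have main1 : ∀ v u : S, ¬ x ∣ v → AI u v → v ∣ u := by
    intro v u hv hu
    have : ∀ N : ℕ, ∃ a u1, u = v * a + x ^ N * u1 ∧ AI u1 v := by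
      intro N
      induction N with
      | zero => exact ⟨0, u, by simp, hu⟩
      | succ N ih =>
        obtain ⟨a, u1, h1, h2⟩ := ih
        obtain ⟨b, u2, h3, h4⟩ := step v hv u1 h2
        exact ⟨a + x ^ N * b, u2, by rw [h1, h3, pow_succ]; ring, h4⟩
    by_cases hvu : IsUnit v
    · exact hvu.dvd
    let π := Ideal.Quotient.mk (Ideal.span {v})
    have hloc : IsLocalRing (S ⧸ Ideal.span {v}) :=
      have : Nontrivial (S ⧸ Ideal.span {v}) := Ideal.Quotient.nontrivial_iff.2 (by
        rwa [Ne, Ideal.span_singleton_eq_top])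
      IsLocalRing.of_surjective' π Ideal.Quotient.mk_surjective
    rw [← Ideal.mem_span_singleton, ← Ideal.Quotient.eq_zero_iff_mem]
    have h1 := Ideal.iInf_pow_eq_bot_of_isLocalRing (Ideal.span {π x}) (by
      intro h
      rw [Ideal.span_singleton_eq_top] at h
      have hs : IsLocalHom π := Function.Surjective.isLocalHom π Ideal.Quotient.mk_surjective
      exact (IsLocalRing.mem_maximalIdeal x).1 hx (isUnit_of_map_unit π x h))
    rw [← Ideal.mem_bot, ← h1, Ideal.mem_iInf]
    intro n
    rw [Ideal.span_singleton_pow, Ideal.mem_span_singleton]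
    obtain ⟨a, u1, h1, -⟩ := this n
    refine ⟨π u1, ?_⟩
    rw [← map_pow, ← map_mul, ← sub_eq_zero, ← map_sub]
    change π _ = 0
    rw [Ideal.Quotient.eq_zero_iff_mem, Ideal.mem_span_singleton]
    exact ⟨a, by rw [h1]; ring⟩
  -- division by x
  have main2 : ∀ (j : ℕ) (v u : S), ¬ x ∣ v → AI u (x ^ j * v) → (x ^ j * v) ∣ u := by
    intro j v u hv
    rintro ⟨c, hc, h⟩
    by_cases hu : u = 0
    · rw [hu]; exact dvd_zero _
    obtain ⟨i, u', hu', rfl⟩ := exists_eq_pow_mul hx hu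
    obtain ⟨l, c', hc', rfl⟩ := exists_eq_pow_mul hx hc
    have hij : j ≤ i := by
      by_contra hij
      obtain ⟨w, hw⟩ := h (l + 1)
      have hle : (l + i * (l + 1)) + 1 ≤ j * (l + 1) := by nlinarith
      have e : x ^ (l + i * (l+1)) * (c' * u' ^ (l + 1)) =
        x ^ (l + i * (l+1)) * (x * (x ^ (j * (l+1) - (l + i * (l+1)) - 1) * (v ^ (l+1) * w))) := by
        have e2 : x ^ (l + i * (l+1)) * (x * (x ^ (j * (l+1) - (l + i * (l+1)) - 1) * (v ^ (l+1) * w)))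
          = x ^ ((l + i * (l+1)) + 1 + (j * (l+1) - (l + i * (l+1)) - 1)) * (v ^ (l+1) * w) := by
          rw [pow_add, pow_add _ _ 1]; ring
        rw [e2]
        have : (l + i * (l+1)) + 1 + (j * (l+1) - (l + i * (l+1)) - 1) = j * (l + 1) := by omega
        rw [this, pow_add, pow_mul, pow_mul]
        linear_combination hw
      have := mul_left_cancel₀ (pow_ne_zero _ hx0) e
      rcases hxp.dvd_or_dvd ⟨_, this⟩ with h | h
      · exact hc' h
      · exact hpow _ _ hu' h
    obtain ⟨t, rfl⟩ := Nat.exists_eq_add_of_le hij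
    have : AI (x ^ t * u') v := ⟨_, hc, fun n => by
      obtain ⟨w, hw⟩ := h n
      refine ⟨w, mul_left_cancel₀ (pow_ne_zero n (pow_ne_zero j hx0)) ?_⟩
      rw [pow_add] at hw
      linear_combination hw⟩
    obtain ⟨w, hw⟩ := main1 _ _ hv this
    exact ⟨w, by rw [pow_add, mul_assoc, hw]; ring⟩
  intro u v hv huv
  obtain ⟨n, hn⟩ := huv.pow
  obtain ⟨j, v', hv', e⟩ := exists_eq_pow_mul hx hv
  have := main2 j v' u hv' (by rw [← e]; exact ⟨v ^ n, pow_ne_zero _ hv, hn⟩)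
  rwa [← e] at this

lemma nice_of_quotient {R : Type*} [CommRing R] [IsNoetherianRing R] {x : R}
    (hx : x ∈ (⊥ : Ideal R).jacobson) (hnz : x ∈ nonZeroDivisors R)
    (h : IsNormalRing (R ⧸ Ideal.span {x})) : Nice R := by
  refine nice_of_maximal fun M hM => ?_
  have hxM : x ∈ M := by
    rw [Ideal.jacobson, Ideal.mem_sInf] at hx
    exact hx ⟨bot_le, hM⟩
  let f := algebraMap R (Localization.AtPrime M)
  have hspan : (Ideal.span {x}).map f = Ideal.span {f x} := by
    rw [Ideal.map_span, Set.image_singleton]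
  let M' : Ideal (R ⧸ Ideal.span {x}) := M.map (Ideal.Quotient.mk _)
  have hle : Ideal.span {x} ≤ M := by rwa [Ideal.span_singleton_le_iff_mem]
  have hM' : M'.IsPrime := Ideal.map_isPrime_of_surjective Ideal.Quotient.mk_surjective
    (by rwa [Ideal.mk_ker])
  have hcompl : Algebra.algebraMapSubmonoid (R ⧸ Ideal.span {x}) M.primeCompl = M'.primeCompl := by
    ext y
    obtain ⟨y, rfl⟩ := Ideal.Quotient.mk_surjective y
    have : ∀ y, Ideal.Quotient.mk (Ideal.span {x}) y ∈ M' ↔ y ∈ M := by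
      intro y
      rw [← Ideal.mem_comap, Ideal.comap_map_of_surjective _ Ideal.Quotient.mk_surjective,
        ← RingHom.ker_eq_comap_bot, Ideal.mk_ker, sup_eq_left.2 hle]
    constructor
    · rintro ⟨z, hz, hzy⟩
      intro hh
      rw [← hzy] at hh
      exact hz ((this z).1 hh)
    · intro hh
      exact ⟨y, fun hy => hh ((this y).2 hy), rfl⟩
  have hloc : IsLocalization M'.primeCompl (Localization.AtPrime M ⧸ (Ideal.span {x}).map f) := by
    rw [← hcompl]; infer_instance
  let e : Localization.AtPrime M' ≃ₐ[R ⧸ Ideal.span {x}] (Localization.AtPrime M ⧸ (Ideal.span {x}).map f) :=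
    IsLocalization.algEquiv M'.primeCompl _ _
  have h1 := (h M' hM').1
  have h2 := (h M' hM').2
  have h3 : IsDomain (Localization.AtPrime M ⧸ (Ideal.span {x}).map f) := e.symm.toMulEquiv.isDomain _
  have h4 : IsIntegrallyClosed (Localization.AtPrime M ⧸ (Ideal.span {x}).map f) :=
    IsIntegrallyClosed.of_equiv e.toRingEquiv
  rw [hspan] at h3 h4
  have : IsNoetherianRing (Localization.AtPrime M) := IsLocalization.isNoetherianRing M.primeCompl _ inferInstance
  refine local_case (x := f x) ?_ ?_
  · rw [← Localization.AtPrime.map_eq_maximalIdeal]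
    exact Ideal.mem_map_of_mem _ hxM
  · exact IsLocalization.map_nonZeroDivisors_le M.primeCompl _ (Submonoid.mem_map_of_mem _ hnz)
end lemmaN
end CTN

namespace CTN
section power

lemma nice_powerSeries {R : Type*} [CommRing R] [IsNoetherianRing R] (h : Nice R) :
    Nice (PowerSeries R) := by
  refine nice_of_quotient (x := PowerSeries.X) ?_ ?_ ?_
  · exact IsAdicComplete.le_jacobson_bot _ (Ideal.mem_span_singleton_self _)
  · rw [mem_nonZeroDivisors_iff_left]
    intro x hx
    exact PowerSeries.X_mul_inj.1 (by rw [hx, mul_zero])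
  · apply Nice.isNormalRing
    have hk : RingHom.ker (PowerSeries.constantCoeff (R := R)) = Ideal.span {PowerSeries.X} := by
      ext f
      rw [RingHom.mem_ker, Ideal.mem_span_singleton, PowerSeries.X_dvd_iff]
    have e := (Ideal.quotEquivOfEq hk).symm.trans
      (RingHom.quotientKerEquivOfSurjective (PowerSeries.constantCoeff_surj (R := R)))
    exact h.of_equiv e.symm

lemma nice_mvPowerSeries {R : Type*} [CommRing R] [IsNoetherianRing R] (h : Nice R) (d : ℕ) :
    Nice (MvPowerSeries (Fin d) R) := by
  induction d with
  | zero => exact h.of_equiv (MvPowerSeries.isEmptyEquiv (Fin 0) R).toRingEquiv.symm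
  | succ d ih => exact (nice_powerSeries ih).of_equiv (MvPowerSeries.finSuccEquiv R d).toRingEquiv.symm

end power
end CTN

namespace CTN
section field

/-- integrally closed along a ring hom -/
def ICl {R Q : Type*} [CommRing R] [CommRing Q] (f : R →+* Q) : Prop :=
  ∀ x, f.IsIntegralElem x → x ∈ f.range

lemma isIntegralElem_map {R Q T : Type*} [CommRing R] [CommRing Q] [CommRing T] {f : R →+* Q} {x : Q}
    (h : f.IsIntegralElem x) (g : Q →+* T) : (g.comp f).IsIntegralElem (g x) := by
  obtain ⟨p, hp, hx⟩ := h
  exact ⟨p, hp, by rw [← Polynomial.hom_eval₂, hx, map_zero]⟩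

lemma isIntegralElem_of_map {R Q T : Type*} [CommRing R] [CommRing Q] [CommRing T] {f : R →+* Q}
    {x : Q} (g : Q →+* T) (hg : Function.Injective g) (h : (g.comp f).IsIntegralElem (g x)) :
    f.IsIntegralElem x := by
  obtain ⟨p, hp, hx⟩ := h
  exact ⟨p, hp, hg (by rw [Polynomial.hom_eval₂, hx, map_zero])⟩

lemma isIntegralElem_trans {R Q T : Type*} [CommRing R] [CommRing Q] [CommRing T] {f : R →+* Q}
    (hf : f.IsIntegral) {g : Q →+* T} {x : T} (h : g.IsIntegralElem x) :
    (g.comp f).IsIntegralElem x := by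
  algebraize [f, g, g.comp f]
  have : Algebra.IsIntegral R Q := ⟨hf⟩
  exact isIntegral_trans (A := Q) x h

lemma includeRight_isIntegral (F0 P R : Type*) [Field F0] [Field P] [CommRing R] [Algebra F0 P]
    [Algebra F0 R] [Algebra.IsAlgebraic F0 P] :
    (Algebra.TensorProduct.includeRight : R →ₐ[F0] P ⊗[F0] R).toRingHom.IsIntegral := by
  intro x
  algebraize [(Algebra.TensorProduct.includeRight : R →ₐ[F0] P ⊗[F0] R).toRingHom]
  change IsIntegral R x
  induction x with
  | zero => exact isIntegral_zero
  | add x y hx hy => exact hx.add hy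
  | tmul y r =>
    have : y ⊗ₜ[F0] r = (y ⊗ₜ 1) * algebraMap R (P ⊗[F0] R) r := by
      change y ⊗ₜ[F0] r = (y ⊗ₜ 1) * (1 ⊗ₜ r); simp
    rw [this]
    refine IsIntegral.mul ?_ isIntegral_algebraMap
    have h1 : IsIntegral F0 y := Algebra.IsIntegral.isIntegral y
    have : IsScalarTower F0 R (P ⊗[F0] R) := IsScalarTower.of_algebraMap_eq' (by
      ext c
      change algebraMap F0 P c ⊗ₜ 1 = 1 ⊗ₜ algebraMap F0 R c
      rw [Algebra.algebraMap_eq_smul_one, Algebra.algebraMap_eq_smul_one, smul_tmul])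
    exact (h1.map (Algebra.TensorProduct.includeLeft : P →ₐ[F0] P ⊗[F0] R)).tower_top

lemma sepStep {P N R Q : Type*} [Field P] [Field N] [CommRing R] [CommRing Q] [Algebra P N]
    [Algebra P R] [Algebra P Q] [FiniteDimensional P N] [Algebra.IsSeparable P N]
    (f : R →ₐ[P] Q) (h : ICl f.toRingHom) :
    ICl (Algebra.TensorProduct.map (AlgHom.id P N) f).toRingHom := by
  intro x hx
  let _ : Algebra R Q := f.toRingHom.toAlgebra
  have : IsScalarTower P R Q := IsScalarTower.of_algebraMap_eq' f.comp_algebraMap.symm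
  have : Algebra.Etale P N := (Algebra.FormallyEtale.iff_isSeparable P N).2 inferInstance |> fun h =>
    { formallyEtale := h, finitePresentation := (Algebra.FinitePresentation.of_finiteType (R := P) (A := N)).1 inferInstance }
  let S := R ⊗[P] N
  have : Algebra.Etale R S := inferInstance
  let θ : N ⊗[P] Q ≃+* S ⊗[R] Q :=
    ((Algebra.TensorProduct.comm P N Q).toRingEquiv.trans
      (Algebra.TensorProduct.cancelBaseChange P R R Q N).symm.toRingEquiv).trans
      (Algebra.TensorProduct.comm R Q S).toRingEquiv
  have hθ : ∀ n q, θ (n ⊗ₜ q) = (1 ⊗ₜ n) ⊗ₜ q := by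
    intro n q
    simp [θ]
  have hcomp : θ.toRingHom.comp (Algebra.TensorProduct.map (AlgHom.id P N) f).toRingHom =
      (algebraMap S (S ⊗[R] Q)).comp (Algebra.TensorProduct.comm P N R).toRingEquiv.toRingHom := by
    refine RingHom.ext fun t => ?_
    induction t with
    | zero => simp
    | add x y hx hy => rw [map_add, map_add, hx, hy]
    | tmul n r =>
      change θ (n ⊗ₜ f r) = (r ⊗ₜ n) ⊗ₜ 1
      rw [hθ]
      have : f r = r • (1 : Q) := by rw [Algebra.smul_def, mul_one]; rfl
      rw [this, ← smul_tmul, smul_tmul', smul_eq_mul, mul_one]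
  have hx2 : (algebraMap S (S ⊗[R] Q)).IsIntegralElem (θ x) := by
    have h1 := isIntegralElem_map hx θ.toRingHom
    rw [hcomp] at h1
    obtain ⟨p, hp, hpx⟩ := h1
    exact ⟨p.map (Algebra.TensorProduct.comm P N R).toRingEquiv.toRingHom, hp.map _, by
      rw [Polynomial.eval₂_map]; exact hpx⟩
  obtain ⟨t, ht⟩ := (TensorProduct.toIntegralClosure_bijective_of_smooth (R := R) (S := S) (B := Q)).2
    ⟨θ x, hx2⟩
  have ht' : Algebra.TensorProduct.map (.id S S) (integralClosure R Q).val t = θ x :=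
    congrArg Subtype.val ht
  have key : ∀ t : S ⊗[R] integralClosure R Q, ∃ s : S,
      Algebra.TensorProduct.map (.id S S) (integralClosure R Q).val t = algebraMap S (S ⊗[R] Q) s := by
    intro t
    induction t with
    | zero => exact ⟨0, by simp⟩
    | add a b ha hb =>
      obtain ⟨s, hs⟩ := ha
      obtain ⟨s', hs'⟩ := hb
      exact ⟨s + s', by rw [map_add, hs, hs', map_add]⟩
    | tmul s q =>
      obtain ⟨r, hr⟩ := h q.1 q.2
      refine ⟨r • s, ?_⟩
      have hr' : q.1 = r • (1 : Q) := by rw [Algebra.smul_def, mul_one]; exact hr.symm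
      change s ⊗ₜ q.1 = (r • s) ⊗ₜ 1
      rw [hr', smul_tmul]
  obtain ⟨s, hs⟩ := key t
  refine ⟨(Algebra.TensorProduct.comm P N R).symm s, θ.injective ?_⟩
  rw [← ht', hs]
  have := congrArg (fun g => g ((Algebra.TensorProduct.comm P N R).symm s)) hcomp
  simpa using this

lemma sepRed {P N Q : Type*} [Field P] [Field N] [CommRing Q] [Algebra P N]
    [Algebra P Q] [FiniteDimensional P N] [Algebra.IsSeparable P N] [IsReduced Q] :
    IsReduced (N ⊗[P] Q) := by
  suffices h : IsReduced (Q ⊗[P] N) from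
    isReduced_of_injective (Algebra.TensorProduct.comm P N Q) (Algebra.TensorProduct.comm P N Q).injective
  constructor
  intro x hx
  let b := Module.finBasis P N
  let B := Algebra.TensorProduct.basis Q b
  apply B.ext_elem
  intro i
  rw [map_zero, Finsupp.zero_apply]
  have hz : B.repr x i ∈ nilradical Q := by
    rw [nilradical_eq_sInf, Ideal.mem_sInf]
    intro p hp
    have hp' : p.IsPrime := hp
    let κ := p.ResidueField
    let g : Q ⊗[P] N →ₐ[P] κ ⊗[P] N :=
      Algebra.TensorProduct.map (IsScalarTower.toAlgHom P Q κ) (AlgHom.id P N)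
    have : Algebra.Etale P N := (Algebra.FormallyEtale.iff_isSeparable P N).2 inferInstance |> fun h =>
      { formallyEtale := h, finitePresentation := (Algebra.FinitePresentation.of_finiteType (R := P) (A := N)).1 inferInstance }
    have : Algebra.Etale κ (κ ⊗[P] N) := inferInstance
    have : IsReduced (κ ⊗[P] N) := Algebra.FormallyUnramified.isReduced_of_field κ _
    have h0 : g x = 0 := (hx.map g).eq_zero
    have hg : ∀ x, (Algebra.TensorProduct.basis κ b).repr (g x) i = algebraMap Q κ (B.repr x i) := by
      intro x
      induction x with
      | zero => simp
      | add x y hx hy => simp only [map_add, Finsupp.add_apply, hx, hy]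
      | tmul q n =>
        simp [g, B, Algebra.TensorProduct.basis_repr_tmul, Algebra.smul_def, ← IsScalarTower.algebraMap_apply P Q κ]
    have := hg x
    rw [h0, map_zero, Finsupp.zero_apply, eq_comm, Ideal.algebraMap_residueField_eq_zero] at this
    exact this
  rwa [nilradical_eq_zero] at hz

end field
end CTN

namespace CTN
section field2

/-- The `q`-th power independence property along `f`. -/
def HQ {F0 R Q : Type*} [Field F0] [CommRing R] [CommRing Q] [Algebra F0 Q]
    (q : ℕ) (f : R →+* Q) : Prop :=
  ∀ (m : ℕ) (h : Fin m → F0), (∀ a : Fin m → F0, ∑ i, a i ^ q * h i = 0 → a = 0) →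
    ∀ r : Fin m → Q, (∑ i, r i ^ q * algebraMap F0 Q (h i) ∈ f.range → ∀ i, r i ∈ f.range) ∧
      (∑ i, r i ^ q * algebraMap F0 Q (h i) = 0 → r = 0)

lemma exists_sum_basis {F0 P Q : Type*} [Field F0] [Field P] [CommRing Q] [Algebra F0 P]
    [Algebra F0 Q] {n : ℕ} (b : Module.Basis (Fin n) F0 P) (z : P ⊗[F0] Q) :
    ∃ r : Fin n → Q, z = ∑ i, b i ⊗ₜ r i := by
  obtain ⟨r, hr⟩ := TensorProduct.eq_repr_basis_left b z
  refine ⟨r, ?_⟩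
  rw [← hr, Finsupp.sum_fintype]
  simp

lemma pi_pow {F0 P Q : Type*} [Field F0] [Field P] [CommRing Q] [Nontrivial Q] [Algebra F0 P]
    [Algebra F0 Q] (p : ℕ) [ExpChar F0 p] (e : ℕ) {n : ℕ} (b : Fin n → P)
    (h : Fin n → F0) (hb : ∀ i, b i ^ p ^ e = algebraMap F0 P (h i)) (r : Fin n → Q) :
    (∑ i, b i ⊗ₜ[F0] r i) ^ p ^ e = 1 ⊗ₜ (∑ i, r i ^ p ^ e * algebraMap F0 Q (h i)) := by
  have : ExpChar (P ⊗[F0] Q) p :=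
    expChar_of_injective_algebraMap (algebraMap F0 (P ⊗[F0] Q)).injective p
  rw [sum_pow_char_pow, TensorProduct.tmul_sum]
  refine Finset.sum_congr rfl fun i _ => ?_
  rw [Algebra.TensorProduct.tmul_pow, hb, Algebra.algebraMap_eq_smul_one, smul_tmul,
    mul_comm, ← Algebra.smul_def]

lemma pi_indep {F0 P : Type*} [Field F0] [Field P] [Algebra F0 P] (p : ℕ) [ExpChar F0 p] (e : ℕ)
    {n : ℕ} (b : Module.Basis (Fin n) F0 P)
    (h : Fin n → F0) (hb : ∀ i, b i ^ p ^ e = algebraMap F0 P (h i)) (a : Fin n → F0)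
    (ha : ∑ i, a i ^ p ^ e * h i = 0) : a = 0 := by
  have : ExpChar P p := expChar_of_injective_algebraMap (algebraMap F0 P).injective p
  have h1 : (∑ i, a i • b i) ^ p ^ e = 0 := by
    rw [sum_pow_char_pow, ← map_zero (algebraMap F0 P), ← ha, map_sum]
    refine Finset.sum_congr rfl fun i _ => ?_
    rw [Algebra.smul_def, mul_pow, hb, map_mul, map_pow]
  have h2 := eq_zero_of_pow_eq_zero h1
  funext i
  exact Fintype.linearIndependent_iff.1 b.linearIndependent a h2 i

lemma piStep {F0 P R Q : Type*} [Field F0] [Field P] [CommRing R] [CommRing Q] [Nontrivial Q]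
    [IsReduced Q]
    [Algebra F0 P] [Algebra F0 R] [Algebra F0 Q] [FiniteDimensional F0 P]
    (p : ℕ) [ExpChar F0 p] (e : ℕ) (hP : ∀ y : P, y ^ p ^ e ∈ (algebraMap F0 P).range)
    (f : R →ₐ[F0] Q) (hf : ICl f.toRingHom) (hq : HQ (F0 := F0) (p ^ e) f.toRingHom) :
    ICl (Algebra.TensorProduct.map (AlgHom.id F0 P) f).toRingHom ∧ IsReduced (P ⊗[F0] Q) := by
  let b := Module.finBasis F0 P
  choose h hb using fun i => hP (b i)
  have hind := pi_indep p e b h (fun i => (hb i).symm)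
  have hinj : Function.Injective (Algebra.TensorProduct.includeRight : Q →ₐ[F0] P ⊗[F0] Q) :=
    Algebra.TensorProduct.includeRight_injective (algebraMap F0 P).injective
  constructor
  · intro z hz
    obtain ⟨r, rfl⟩ := exists_sum_basis b z
    have h1 : (Algebra.TensorProduct.map (AlgHom.id F0 P) f).toRingHom.IsIntegralElem
        ((Algebra.TensorProduct.includeRight : Q →ₐ[F0] P ⊗[F0] Q)
          (∑ i, r i ^ p ^ e * algebraMap F0 Q (h i))) := by
      have hpow : ∀ n, (Algebra.TensorProduct.map (AlgHom.id F0 P) f).toRingHom.IsIntegralElem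
          ((∑ i, b i ⊗ₜ[F0] r i) ^ n) := by
        intro n
        induction n with
        | zero => rw [pow_zero]; exact RingHom.isIntegralElem_one _
        | succ n ih => rw [pow_succ]; exact RingHom.IsIntegralElem.mul _ ih hz
      have := hpow (p ^ e)
      rw [pi_pow p e b h (fun i => (hb i).symm) r] at this
      exact this
    have h2 := isIntegralElem_trans (includeRight_isIntegral F0 P R) h1
    have h3 : (Algebra.TensorProduct.map (AlgHom.id F0 P) f).toRingHom.comp
        (Algebra.TensorProduct.includeRight : R →ₐ[F0] P ⊗[F0] R).toRingHom =
        (Algebra.TensorProduct.includeRight : Q →ₐ[F0] P ⊗[F0] Q).toRingHom.comp f.toRingHom := by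
      refine RingHom.ext fun x => ?_
      simp
    rw [h3] at h2
    have h4 := hf _ (isIntegralElem_of_map _ hinj h2)
    have h5 := (hq _ h hind r).1 h4
    choose s hs using h5
    refine ⟨∑ i, b i ⊗ₜ s i, ?_⟩
    rw [map_sum]
    refine Finset.sum_congr rfl fun i _ => ?_
    rw [← hs]; rfl
  · constructor
    intro z hz
    obtain ⟨r, rfl⟩ := exists_sum_basis b z
    have h1 := hz.pow_of_pos (expChar_pow_pos F0 p e).ne'
    rw [pi_pow p e b h (fun i => (hb i).symm) r] at h1
    have h2 : IsNilpotent (∑ i, r i ^ p ^ e * algebraMap F0 Q (h i)) :=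
      (IsNilpotent.map_iff hinj).1 h1
    rw [(hq _ h hind r).2 h2.eq_zero]
    simp

/-- the fixed field of all automorphisms of a normal extension is purely inseparable -/
lemma fixed_pi (F0 N : Type*) [Field F0] [Field N] [Algebra F0 N] [FiniteDimensional F0 N]
    [Normal F0 N] : IsPurelyInseparable F0
      (IntermediateField.fixedField (⊤ : Subgroup (N ≃ₐ[F0] N))) := by
  rw [isPurelyInseparable_iff_natSepDegree_eq_one]
  intro y
  have hm : minpoly F0 y = minpoly F0 (y : N) := by
    rw [IntermediateField.minpoly_eq]
  classical
  have hi : IsIntegral F0 (y : N) := Algebra.IsIntegral.isIntegral _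
  rw [hm, Polynomial.natSepDegree_eq_of_splits (E := N) _ (Normal.splits inferInstance _),
    Finset.card_eq_one]
  refine ⟨(y : N), ?_⟩
  ext z
  rw [Multiset.mem_toFinset, Finset.mem_singleton, Polynomial.mem_aroots]
  constructor
  · rintro ⟨-, hz⟩
    obtain ⟨σ, hσ⟩ := minpoly.exists_algEquiv_of_root' (K := F0) (L := N) (y := (y : N)) (x := z)
      hi.isAlgebraic hz
    rw [← hσ]
    exact (y.2 ⟨σ, trivial⟩)
  · rintro rfl
    exact ⟨minpoly.ne_zero hi, minpoly.aeval _ _⟩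

lemma towerStep {F0 P N R Q : Type*} [Field F0] [Field P] [Field N] [CommRing R] [CommRing Q]
    [Nontrivial Q] [IsReduced Q]
    [Algebra F0 N] [Algebra F0 P] [Algebra P N] [IsScalarTower F0 P N]
    [Algebra F0 R] [Algebra F0 Q] [FiniteDimensional F0 P] [FiniteDimensional P N]
    [IsPurelyInseparable F0 P] [Algebra.IsSeparable P N]
    (p : ℕ) [ExpChar F0 p]
    (f : R →ₐ[F0] Q) (hf : ICl f.toRingHom) (hq : ∀ e, HQ (F0 := F0) (p ^ e) f.toRingHom) :
    ICl (Algebra.TensorProduct.map (AlgHom.id F0 N) f).toRingHom ∧ IsReduced (N ⊗[F0] Q) := by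
  obtain ⟨h1, h2⟩ := piStep (P := P) p (IsPurelyInseparable.exponent F0 P)
    (IsPurelyInseparable.exponent_def' F0 p) f hf (hq _)
  let g : P ⊗[F0] R →ₐ[P] P ⊗[F0] Q := Algebra.TensorProduct.map (AlgHom.id P P) f
  have h3 := sepStep (P := P) (N := N) (R := P ⊗[F0] R) (Q := P ⊗[F0] Q) g h1
  have h4 := sepRed (P := P) (N := N) (Q := P ⊗[F0] Q)
  let θR := Algebra.TensorProduct.cancelBaseChange F0 P P N R
  let θQ := Algebra.TensorProduct.cancelBaseChange F0 P P N Q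
  refine ⟨?_, isReduced_of_injective θQ.symm θQ.symm.injective⟩
  intro z hz
  have hcomp : θQ.symm.toRingEquiv.toRingHom.comp
      (Algebra.TensorProduct.map (AlgHom.id F0 N) f).toRingHom =
      (Algebra.TensorProduct.map (AlgHom.id P N) g).toRingHom.comp
        θR.symm.toRingEquiv.toRingHom := by
    refine RingHom.ext fun t => ?_
    induction t with
    | zero => simp
    | add x y hx hy => rw [map_add, map_add, hx, hy]
    | tmul n r => simp [θR, θQ, g]
  have hz1 := isIntegralElem_map hz θQ.symm.toRingEquiv.toRingHom
  rw [hcomp] at hz1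
  obtain ⟨pp, hp, hpx⟩ := hz1
  obtain ⟨w, hw⟩ := h3 (θQ.symm z) ⟨pp.map θR.symm.toRingEquiv.toRingHom, hp.map _, by
      rw [Polynomial.eval₂_map]; exact hpx⟩
  refine ⟨θR w, θQ.symm.injective ?_⟩
  rw [← hw]
  have := congrArg (fun g => g (θR w)) hcomp
  simpa using this

lemma descStep {F0 N F R Q : Type*} [Field F0] [Field F] [CommRing R] [CommRing Q] [Nontrivial Q]
    [IsReduced Q]
    [Algebra F0 F] [Algebra F0 R] [Algebra F0 Q] [Field N] [Algebra F0 N] [Algebra F N] [IsScalarTower F0 F N]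
    (f : R →ₐ[F0] Q)
    (h1 : ICl (Algebra.TensorProduct.map (AlgHom.id F0 N) f).toRingHom) (h2 : IsReduced (N ⊗[F0] Q)) :
    ICl (Algebra.TensorProduct.map (AlgHom.id F0 F) f).toRingHom ∧ IsReduced (F ⊗[F0] Q) := by
  let ι : F →ₐ[F0] N := IsScalarTower.toAlgHom F0 F N
  have hι : Function.Injective ι := ι.toRingHom.injective
  obtain ⟨π, hπ⟩ := ι.toLinearMap.exists_leftInverse_of_injective
    (LinearMap.ker_eq_bot.2 hι)
  let jQ : F ⊗[F0] Q →ₐ[F0] N ⊗[F0] Q := Algebra.TensorProduct.map ι (AlgHom.id F0 Q)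
  let jR : F ⊗[F0] R →ₐ[F0] N ⊗[F0] R := Algebra.TensorProduct.map ι (AlgHom.id F0 R)
  have hπj : ∀ z, (π.rTensor Q) (jQ z) = z := by
    intro z
    induction z with
    | zero => simp
    | add x y hx hy => rw [map_add, map_add, hx, hy]
    | tmul a q =>
      have := LinearMap.congr_fun hπ a
      simp only [LinearMap.comp_apply, LinearMap.id_apply] at this
      simp only [jQ, Algebra.TensorProduct.map_tmul, LinearMap.rTensor_tmul]
      exact congrArg (· ⊗ₜ q) this
  refine ⟨?_, isReduced_of_injective jQ (Function.LeftInverse.injective hπj)⟩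
  intro z hz
  have hz1 := isIntegralElem_map hz jQ.toRingHom
  have hcomp : jQ.toRingHom.comp (Algebra.TensorProduct.map (AlgHom.id F0 F) f).toRingHom =
      (Algebra.TensorProduct.map (AlgHom.id F0 N) f).toRingHom.comp jR.toRingHom := by
    refine RingHom.ext fun t => ?_
    induction t with
    | zero => simp
    | add x y hx hy => rw [map_add, map_add, hx, hy]
    | tmul n r => simp [jQ, jR]
  rw [hcomp] at hz1
  obtain ⟨pp, hp, hpx⟩ := hz1
  obtain ⟨w, hw⟩ := h1 (jQ z) ⟨pp.map jR.toRingHom, hp.map _, by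
      rw [Polynomial.eval₂_map]; exact hpx⟩
  refine ⟨(π.rTensor R) w, ?_⟩
  rw [← hπj z, ← hw]
  clear hw
  induction w with
  | zero => simp
  | add x y hx hy => 
    rw [map_add, map_add, map_add, map_add, hx, hy]
  | tmul n r => simp

lemma finStep {F0 F R Q : Type*} [Field F0] [Field F] [CommRing R] [CommRing Q] [Nontrivial Q]
    [IsReduced Q]
    [Algebra F0 F] [Algebra F0 R] [Algebra F0 Q] [FiniteDimensional F0 F]
    (p : ℕ) [ExpChar F0 p]
    (f : R →ₐ[F0] Q) (hf : ICl f.toRingHom) (hq : ∀ e, HQ (F0 := F0) (p ^ e) f.toRingHom) :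
    ICl (Algebra.TensorProduct.map (AlgHom.id F0 F) f).toRingHom ∧ IsReduced (F ⊗[F0] Q) := by
  let N := IntermediateField.normalClosure F0 F (AlgebraicClosure F)
  let P := IntermediateField.fixedField (⊤ : Subgroup (N ≃ₐ[F0] N))
  have hpi : IsPurelyInseparable F0 P := fixed_pi F0 N
  have : IsGalois P N := IsGalois.of_fixed_field N (⊤ : Subgroup (N ≃ₐ[F0] N))
  obtain ⟨h1, h2⟩ := towerStep (P := P) (N := N) p f hf hq
  exact descStep (N := N) f h1 h2

end field2
end CTN

namespace CTN
section field3

lemma isReduced_loc {R : Type*} [CommRing R] (M : Submonoid R) (S : Type*) [CommRing S]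
    [Algebra R S] [IsLocalization M S] [IsReduced R] : IsReduced S := by
  constructor
  intro x hx
  obtain ⟨n, hn⟩ := hx
  obtain ⟨u, v, rfl⟩ := IsLocalization.exists_mk'_eq M x
  rw [← IsLocalization.mk'_pow, IsLocalization.mk'_eq_zero_iff] at hn
  obtain ⟨m, hm⟩ := hn
  rw [IsLocalization.mk'_eq_zero_iff]
  refine ⟨m, eq_zero_of_pow_eq_zero (n := n + 1) ?_⟩
  calc (m.1 * u) ^ (n + 1) = (m.1 * u ^ n) * (m.1 ^ n * u) := by ring
    _ = 0 := by rw [hm, zero_mul]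

lemma Nice.localization {R : Type*} [CommRing R] (h : Nice R) (M : Submonoid R)
    (hM : M ≤ nonZeroDivisors R) (S : Type*) [CommRing S]
    [Algebra R S] [IsLocalization M S] : Nice S := by
  have := h.1
  refine ⟨isReduced_loc M S, fun x y hy hxy => ?_⟩
  obtain ⟨u, s, rfl⟩ := IsLocalization.exists_mk'_eq M x
  obtain ⟨v, t, rfl⟩ := IsLocalization.exists_mk'_eq M y
  have hinj := IsLocalization.injective S hM
  have hs := IsLocalization.map_units S s
  have ht := IsLocalization.map_units S t
  have e1 : algebraMap R S s.1 * IsLocalization.mk' S u s = algebraMap R S u :=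
    IsLocalization.mk'_spec' ..
  have e2 : algebraMap R S t.1 * IsLocalization.mk' S v t = algebraMap R S v :=
    IsLocalization.mk'_spec' ..
  have h1 : HomInt (algebraMap R S (t * u)) (algebraMap R S v) := by
    have := (hxy.mul_both (algebraMap R S t.1)).mul_left (algebraMap R S s.1)
    rw [e2] at this
    rw [map_mul, ← e1]
    convert this using 1; ring
  have hv : algebraMap R S v ∈ nonZeroDivisors S := by
    rw [← e2]; exact mul_mem ht.mem_nonZeroDivisors hy
  have hv' : v ∈ nonZeroDivisors R := by
    rw [mem_nonZeroDivisors_iff_right] at hv ⊢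
    intro z hz
    exact hinj (by rw [map_zero]; exact hv _ (by rw [← map_mul, hz, map_zero]))
  obtain ⟨r, hr, h2⟩ := HomInt.of_localization M h1
  obtain ⟨w, hw⟩ := h.2 _ _ hv' h2
  have hr' := IsLocalization.map_units S ⟨r, hr⟩
  rw [← (hr'.mul (ht.mul hs)).dvd_mul_left]
  refine ⟨algebraMap R S (t * w), ?_⟩
  have := congrArg (algebraMap R S) hw
  simp only [map_mul] at this ⊢
  rw [← e1, ← e2] at this
  linear_combination this

lemma exists_nzd_dvd {R S : Type*} [CommRing R] [CommRing S] [Algebra R S] [IsNoetherianRing R]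
    [IsReduced R] [Algebra.IsIntegral R S] {v : S} (hv : v ∈ nonZeroDivisors S) :
    ∃ a ∈ nonZeroDivisors R, v ∣ algebraMap R S a := by
  by_contra hcon
  push Not at hcon
  let J : Ideal R := (Ideal.span {v}).comap (algebraMap R S)
  have hfin : (minimalPrimes R).Finite := minimalPrimes.finite_of_isNoetherianRing R
  have hJ : ((J : Ideal R) : Set R) ⊆ ⋃ i ∈ (hfin.toFinset : Set (Ideal R)), (i : Set R) := by
    intro a ha
    by_contra h
    refine hcon a (mem_nzd_of_minimalPrimes a fun P hP haP => h ?_) (Ideal.mem_span_singleton.1 ha)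
    exact Set.mem_biUnion (by simpa using hP) haP
  obtain ⟨P, hP, hJP⟩ := (Ideal.subset_union_prime (s := hfin.toFinset) (f := id) ⊤ ⊤ (by
    intro i hi _ _
    have : i ∈ minimalPrimes R := by simpa using hi
    exact this.1.1)).1 hJ
  have hP' : P ∈ minimalPrimes R := by simpa using hP
  have hPp : P.IsPrime := hP'.1.1
  obtain ⟨Q, hQ, hQp, hQP⟩ := Ideal.exists_ideal_over_prime_of_isIntegral P (Ideal.span {v}) hJP
  obtain ⟨Q', hQ', hle⟩ := Ideal.exists_minimalPrimes_le (bot_le : (⊥ : Ideal S) ≤ Q)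
  have hQ'p : Q'.IsPrime := hQ'.1.1
  have hEq : Q' = Q := by
    by_contra hne
    have hlt := Ideal.IsIntegral.comap_lt_comap (R := R) (lt_of_le_of_ne hle hne)
    rw [hQP] at hlt
    exact absurd (hP'.2 ⟨Ideal.IsPrime.comap _, bot_le⟩ hlt.le) (not_le_of_gt hlt)
  have hvQ : v ∈ Q' := hEq ▸ hQ (Ideal.mem_span_singleton_self v)
  exact Set.disjoint_left.1 (Ideal.disjoint_nonZeroDivisors_of_mem_minimalPrimes hQ') hvQ hv

lemma icl_of_nice {R Q : Type*} [CommRing R] [CommRing Q] [Algebra R Q] [IsFractionRing R Q]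
    (h : Nice R) : ICl (algebraMap R Q) := by
  intro x hx
  obtain ⟨u, v, rfl⟩ := IsLocalization.exists_mk'_eq (nonZeroDivisors R) x
  have h1 : HomInt u v.1 := homInt_of_isIntegral (IsFractionRing.injective R Q) (v := v.1)
    (z := IsLocalization.mk' Q u v) hx (by rw [IsLocalization.mk'_spec'])
  obtain ⟨w, hw⟩ := h.2 u v.1 v.2 h1
  exact ⟨w, by rw [IsLocalization.eq_mk'_iff_mul_eq, hw, map_mul, mul_comm]⟩

lemma nice_of_ICl {F0 F R Q : Type*} [Field F0] [Field F] [CommRing R] [CommRing Q]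
    [Algebra F0 F] [Algebra F0 R] [Algebra F0 Q] [Algebra R Q] [IsScalarTower F0 R Q]
    [IsFractionRing R Q] [IsNoetherianRing R] [IsReduced R] [Algebra.IsAlgebraic F0 F]
    (h : ICl (Algebra.TensorProduct.map (AlgHom.id F0 F) (IsScalarTower.toAlgHom F0 R Q)).toRingHom)
    (hred : IsReduced (F ⊗[F0] Q)) : Nice (F ⊗[F0] R) := by
  set φ := Algebra.TensorProduct.map (AlgHom.id F0 F) (IsScalarTower.toAlgHom F0 R Q) with hφ
  have hinj : Function.Injective φ := by
    have : Function.Injective (LinearMap.lTensor F (IsScalarTower.toAlgHom F0 R Q).toLinearMap) :=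
      Module.Flat.lTensor_preserves_injective_linearMap _ (IsFractionRing.injective R Q)
    exact this
  refine ⟨isReduced_of_injective φ hinj, fun u v hv huv => ?_⟩
  let _ : Algebra R (F ⊗[F0] R) :=
    (Algebra.TensorProduct.includeRight : R →ₐ[F0] F ⊗[F0] R).toRingHom.toAlgebra
  have : Algebra.IsIntegral R (F ⊗[F0] R) := ⟨includeRight_isIntegral F0 F R⟩
  obtain ⟨a, ha, w, hw⟩ := exists_nzd_dvd (R := R) hv
  -- inverse of a
  obtain ⟨a', ha'⟩ : ∃ a' : Q, algebraMap R Q a * a' = 1 :=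
    (IsLocalization.map_units Q ⟨a, ha⟩).exists_right_inv
  have hinv : φ (v * w) * (1 ⊗ₜ a') = 1 := by
    rw [← hw]
    change φ (1 ⊗ₜ a) * (1 ⊗ₜ a') = 1
    rw [hφ, Algebra.TensorProduct.map_tmul, Algebra.TensorProduct.tmul_mul_tmul]
    simp [ha', Algebra.TensorProduct.one_def]
  let z := φ (u * w) * (1 ⊗ₜ a')
  have hz : φ u = φ v * z := by
    calc φ u = φ u * (φ (v * w) * (1 ⊗ₜ a')) := by rw [hinv, mul_one]
      _ = _ := by simp only [z, map_mul]; ring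
  have hzint : φ.toRingHom.IsIntegralElem z := by
    algebraize [φ.toRingHom]
    refine isIntegral_of_homInt (R := F ⊗[F0] R) (u := u) (v := v) ?_ hz huv
    rw [mem_nonZeroDivisors_iff_right]
    intro y hy
    have hy' : y * φ v = 0 := hy
    calc y = y * (φ (v * w) * (1 ⊗ₜ a')) := by rw [hinv, mul_one]
      _ = (y * φ v) * (φ w * (1 ⊗ₜ a')) := by rw [map_mul]; ring
      _ = 0 := by rw [hy', zero_mul]
  obtain ⟨s, hs⟩ := h z hzint
  refine ⟨s, hinj ?_⟩
  rw [hz, map_mul, ← hs]; rfl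

lemma nice_fin {F0 F R Q : Type*} [Field F0] [Field F] [CommRing R] [CommRing Q]
    [Algebra F0 F] [Algebra F0 R] [Algebra F0 Q] [Algebra R Q] [IsScalarTower F0 R Q]
    [IsFractionRing R Q] [IsNoetherianRing R] [Nontrivial R] [FiniteDimensional F0 F]
    (hR : Nice R) (p : ℕ) [ExpChar F0 p]
    (hq : ∀ e, HQ (F0 := F0) (p ^ e) (algebraMap R Q)) : Nice (F ⊗[F0] R) := by
  have : IsReduced R := hR.1
  have : IsReduced Q := isReduced_loc (nonZeroDivisors R) Q
  have : Nontrivial Q := (IsFractionRing.injective R Q).nontrivial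
  obtain ⟨h1, h2⟩ := finStep (F := F) p (IsScalarTower.toAlgHom F0 R Q) (icl_of_nice hR) hq
  exact nice_of_ICl h1 h2

lemma nice_sep {F0 F R : Type*} [Field F0] [Field F] [CommRing R]
    [Algebra F0 F] [Algebra F0 R] [IsNoetherianRing R] [FiniteDimensional F0 F]
    [Algebra.IsSeparable F0 F]
    (hR : Nice R) : Nice (F ⊗[F0] R) := by
  have : IsReduced R := hR.1
  let Q := FractionRing R
  have : IsReduced Q := isReduced_loc (nonZeroDivisors R) Q
  exact nice_of_ICl (sepStep (IsScalarTower.toAlgHom F0 R Q) (icl_of_nice hR)) (sepRed (Q := Q))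

end field3
end CTN

namespace CTN
section L4

lemma map_nzd_of_flat {P T : Type*} [CommRing P] [CommRing T] [Algebra P T] [Module.Flat P T]
    {a : P} (ha : a ∈ nonZeroDivisors P) : algebraMap P T a ∈ nonZeroDivisors T := by
  rw [mem_nonZeroDivisors_iff_right]
  intro z hz
  have h1 : IsSMulRegular T a := by
    apply Module.Flat.isSMulRegular_of_nonZeroDivisors ha
  have : a • z = a • (0 : T) := by rw [smul_zero, Algebra.smul_def, mul_comm, hz]
  exact h1 this

lemma baseLoc {P F0 T : Type*} [CommRing P] [CommRing F0] [CommRing T] [Algebra P F0] [Algebra P T]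
    (M : Submonoid P) [IsLocalization M F0] :
    letI := Algebra.TensorProduct.rightAlgebra (R := P) (A := F0) (B := T)
    IsLocalization (Algebra.algebraMapSubmonoid T M) (F0 ⊗[P] T) := by
  let _ := Algebra.TensorProduct.rightAlgebra (R := P) (A := F0) (B := T)
  rw [← isLocalizedModule_iff_isLocalization]
  infer_instance

lemma nice_baseLoc {P F0 T : Type*} [CommRing P] [CommRing F0] [CommRing T] [Algebra P F0]
    [Algebra P T] (M : Submonoid P) (hM : M ≤ nonZeroDivisors P) [IsLocalization M F0]
    [Module.Flat P T] (h : Nice T) : Nice (F0 ⊗[P] T) := by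
  let _ := Algebra.TensorProduct.rightAlgebra (R := P) (A := F0) (B := T)
  have := baseLoc (F0 := F0) (T := T) M
  refine h.localization (Algebra.algebraMapSubmonoid T M) ?_ _
  rintro _ ⟨a, ha, rfl⟩
  exact map_nzd_of_flat (hM ha)

lemma noeth_baseLoc {P F0 T : Type*} [CommRing P] [CommRing F0] [CommRing T] [Algebra P F0]
    [Algebra P T] (M : Submonoid P) [IsLocalization M F0]
    [IsNoetherianRing T] : IsNoetherianRing (F0 ⊗[P] T) := by
  let _ := Algebra.TensorProduct.rightAlgebra (R := P) (A := F0) (B := T)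
  have := baseLoc (F0 := F0) (T := T) M
  exact IsLocalization.isNoetherianRing (Algebra.algebraMapSubmonoid T M) _ inferInstance

lemma nice_domain {R : Type*} [CommRing R] [IsDomain R] [IsIntegrallyClosed R] : Nice R :=
  ⟨inferInstance, fun _ _ hv h => dvd_of_homInt (nonZeroDivisors.ne_zero hv) h⟩


lemma nice_tr_aux {k P F0 L ι : Type*} [Field k] [Field F0] [CommRing P] [Field L] [Algebra k P]
    [Algebra P F0] [Algebra k F0] [IsScalarTower k P F0] [Algebra k L] [IsFractionRing P F0]
    [Finite ι] (e : MvPolynomial ι k ≃ₐ[k] P) :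
    Nice (F0 ⊗[k] L) ∧ IsNoetherianRing (F0 ⊗[k] L) := by
  let e1 : MvPolynomial ι L ≃+* P ⊗[k] L :=
    ((MvPolynomial.algebraTensorAlgEquiv (σ := ι) k L).symm.toRingEquiv.trans
      (Algebra.TensorProduct.comm k L (MvPolynomial ι k)).toRingEquiv).trans
      (Algebra.TensorProduct.congr e (AlgEquiv.refl : L ≃ₐ[k] L)).toRingEquiv
  have h1 : Nice (P ⊗[k] L) := Nice.of_equiv nice_domain e1
  have h2 : IsNoetherianRing (P ⊗[k] L) := isNoetherianRing_of_ringEquiv _ e1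
  let e2 := (Algebra.TensorProduct.cancelBaseChange k P P F0 L).toRingEquiv
  have h3 : Nice (F0 ⊗[P] (P ⊗[k] L)) := nice_baseLoc (nonZeroDivisors P) le_rfl h1
  have h4 : IsNoetherianRing (F0 ⊗[P] (P ⊗[k] L)) := noeth_baseLoc (nonZeroDivisors P)
  exact ⟨h3.of_equiv e2, isNoetherianRing_of_ringEquiv _ e2⟩

open IntermediateField.algebraAdjoinAdjoin in
lemma nice_tr {k K L ι : Type*} [Field k] [Field K] [Field L] [Algebra k K] [Algebra k L] [Finite ι]
    (x : ι → K) (hs : AlgebraicIndependent k x) :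
    Nice (IntermediateField.adjoin k (Set.range x) ⊗[k] L) ∧
    IsNoetherianRing (IntermediateField.adjoin k (Set.range x) ⊗[k] L) :=
  nice_tr_aux hs.aevalEquiv

lemma nice_fg {k K L : Type*} [Field k] [PerfectField k] [Field K] [Field L] [Algebra k K]
    [Algebra k L] [Algebra.EssFiniteType k K] : Nice (K ⊗[k] L) := by
  obtain ⟨s, hs, H⟩ := exists_isTranscendenceBasis_and_isSeparable_of_perfectField k K
  have hS : (s : Set K) = Set.range ((↑) : s → K) := by simp
  rw [hS] at H
  obtain ⟨h1, h2⟩ := nice_tr (L := L) _ hs.1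
  have h3 : Algebra.EssFiniteType (IntermediateField.adjoin k (Set.range ((↑) : s → K))) K :=
    Algebra.EssFiniteType.of_comp k _ _
  have h4 : FiniteDimensional (IntermediateField.adjoin k (Set.range ((↑) : s → K))) K := by
    have : Algebra.FormallyUnramified
        (IntermediateField.adjoin k (Set.range ((↑) : s → K))) K :=
      Algebra.FormallyUnramified.of_isSeparable _ _
    exact Algebra.FormallyUnramified.finite_of_free _ _
  have h5 := nice_sep (F0 := IntermediateField.adjoin k (Set.range ((↑) : s → K))) (F := K)
    (R := IntermediateField.adjoin k (Set.range ((↑) : s → K)) ⊗[k] L) h1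
  exact h5.of_equiv (Algebra.TensorProduct.cancelBaseChange k
    (IntermediateField.adjoin k (Set.range ((↑) : s → K)))
    (IntermediateField.adjoin k (Set.range ((↑) : s → K))) K L).toRingEquiv

lemma exists_fg_mem {k K L : Type*} [Field k] [Field K] [CommRing L] [Algebra k K]
    [Algebra k L] (x : K ⊗[k] L) : ∃ s : Finset K, ∀ F : IntermediateField k K, (s : Set K) ⊆ F →
      x ∈ (Algebra.TensorProduct.map F.val (AlgHom.id k L)).range := by
  classical
  induction x with
  | zero => exact ⟨∅, fun F _ => zero_mem _⟩
  | add x y hx hy =>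
    obtain ⟨s, hs⟩ := hx
    obtain ⟨t, ht⟩ := hy
    refine ⟨s ∪ t, fun F hF => ?_⟩
    rw [Finset.coe_union, Set.union_subset_iff] at hF
    exact add_mem (hs F hF.1) (ht F hF.2)
  | tmul a b =>
    refine ⟨{a}, fun F hF => ⟨(⟨a, hF (by simp)⟩ : F) ⊗ₜ b, ?_⟩⟩
    simp

lemma nice_fields {k K L : Type*} [Field k] [PerfectField k] [Field K] [Field L] [Algebra k K]
    [Algebra k L] : Nice (K ⊗[k] L) := by
  classical
  have hinj : ∀ F : IntermediateField k K, Function.Injective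
      (Algebra.TensorProduct.map F.val (AlgHom.id k L)) := by
    intro F
    have : Function.Injective (LinearMap.rTensor L F.val.toLinearMap) :=
      Module.Flat.rTensor_preserves_injective_linearMap _ Subtype.val_injective
    exact this
  have hfg : ∀ s : Finset K, Nice (IntermediateField.adjoin k (s : Set K) ⊗[k] L) := by
    intro s
    have : Algebra.EssFiniteType k (IntermediateField.adjoin k (s : Set K)) := by
      rw [IntermediateField.essFiniteType_iff]
      exact ⟨s, rfl⟩
    exact nice_fg
  constructor
  · constructor
    rintro x ⟨n, hn⟩
    obtain ⟨s, hs⟩ := exists_fg_mem x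
    obtain ⟨y, hy⟩ := hs _ (IntermediateField.subset_adjoin k (s : Set K))
    have := (hfg s).1
    have h0 : y ^ n = 0 := hinj _ (by
      rw [map_pow, map_zero, ← hn, ← hy]; rfl)
    have h1 := eq_zero_of_pow_eq_zero h0
    rw [← hy, h1]; exact map_zero _
  · intro u v hv huv
    obtain ⟨n, c, h⟩ := huv
    obtain ⟨s1, hs1⟩ := exists_fg_mem u
    obtain ⟨s2, hs2⟩ := exists_fg_mem v
    choose s3 hs3 using fun i => exists_fg_mem (c i)
    let s := s1 ∪ s2 ∪ (Finset.range n).biUnion s3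
    let F := IntermediateField.adjoin k (s : Set K)
    have hsF := IntermediateField.subset_adjoin k (s : Set K)
    obtain ⟨u', hu'⟩ := hs1 F (subset_trans (Finset.coe_subset.2 (by
      intro a ha; simp [s, ha])) hsF)
    obtain ⟨v', hv'⟩ := hs2 F (subset_trans (Finset.coe_subset.2 (by
      intro a ha; simp [s, ha])) hsF)
    have hc : ∀ i, ∃ c', i ∈ Finset.range n →
        Algebra.TensorProduct.map F.val (AlgHom.id k L) c' = c i := by
      intro i
      by_cases hi : i ∈ Finset.range n
      · obtain ⟨c', hc'⟩ := hs3 i F (subset_trans (Finset.coe_subset.2 (by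
          intro a ha; simp only [s, Finset.mem_union, Finset.mem_biUnion]
          exact Or.inr ⟨i, hi, ha⟩)) hsF)
        exact ⟨c', fun _ => hc'⟩
      · exact ⟨0, fun h => absurd h hi⟩
    choose c' hc' using hc
    have hu2 : Algebra.TensorProduct.map F.val (AlgHom.id k L) u' = u := hu'
    have hv2 : Algebra.TensorProduct.map F.val (AlgHom.id k L) v' = v := hv'
    have hv3 : v' ∈ nonZeroDivisors (F ⊗[k] L) := by
      rw [mem_nonZeroDivisors_iff_right] at hv ⊢
      intro z hz
      refine hinj F ?_
      rw [map_zero]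
      exact hv _ (by rw [← hv2, ← map_mul, hz, map_zero])
    have h2 : HomInt u' v' := by
      refine ⟨n, c', hinj F ?_⟩
      rw [map_zero, ← h, map_add, map_sum, map_pow, hu2]
      congr 1
      refine Finset.sum_congr rfl fun i hi => ?_
      rw [map_mul, map_mul, map_pow, map_pow, hu2, hv2, hc' i hi]
    obtain ⟨w, hw⟩ := (hfg s).2 u' v' hv3 h2
    refine ⟨Algebra.TensorProduct.map F.val (AlgHom.id k L) w, ?_⟩
    rw [← hu2, ← hv2, ← map_mul, ← hw]

end L4
end CTN

namespace CTN
section Hprop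

/-- `q`-linear additive maps of `K` extend to `R`. -/
def HExt (K R : Type*) [CommRing K] [CommRing R] [Algebra K R] (q : ℕ) : Prop :=
  ∀ l : K →+ K, (∀ a b, l (a ^ q * b) = a ^ q * l b) →
    ∃ L : R →+ R, (∀ a b, L (a ^ q * b) = a ^ q * L b) ∧
      ∀ a, L (algebraMap K R a) = algebraMap K R (l a)

/-- extendable `q`-linear maps with values in `q`-th powers -/
def QExt (A E : Type*) [CommRing A] [CommRing E] [Algebra A E] (q : ℕ) (φ : A →+ A) : Prop :=
  (∀ a b, φ (a ^ q * b) = a ^ q * φ b) ∧ (∀ x, ∃ y, φ x = y ^ q) ∧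
    ∃ L : E →+ E, (∀ a b, L (a ^ q * b) = a ^ q * L b) ∧
      ∀ a, L (algebraMap A E a) = algebraMap A E (φ a)

lemma QExt.comb {A E : Type*} [CommRing A] [CommRing E] [Algebra A E] (p e : ℕ) [ExpChar A p]
    {φ ψ : A →+ A} (hφ : QExt A E (p ^ e) φ) (hψ : QExt A E (p ^ e) ψ) (b c : A) :
    ∃ θ : A →+ A, QExt A E (p ^ e) θ ∧ ∀ x, θ x = b ^ (p ^ e) * φ x - c ^ (p ^ e) * ψ x := by
  refine ⟨(AddMonoidHom.mulLeft (b ^ p ^ e)).comp φ - (AddMonoidHom.mulLeft (c ^ p ^ e)).comp ψ,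
    ⟨?_, ?_, ?_⟩, fun x => rfl⟩
  · intro x y
    simp only [AddMonoidHom.sub_apply, AddMonoidHom.comp_apply, AddMonoidHom.coe_mulLeft]
    rw [hφ.1, hψ.1]; ring
  · intro x
    obtain ⟨y, hy⟩ := hφ.2.1 x
    obtain ⟨z, hz⟩ := hψ.2.1 x
    refine ⟨b * y - c * z, ?_⟩
    simp only [AddMonoidHom.sub_apply, AddMonoidHom.comp_apply, AddMonoidHom.coe_mulLeft]
    rw [hy, hz, sub_pow_expChar_pow, mul_pow, mul_pow]
  · obtain ⟨L, hL, hL'⟩ := hφ.2.2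
    obtain ⟨M, hM, hM'⟩ := hψ.2.2
    refine ⟨(AddMonoidHom.mulLeft (algebraMap A E b ^ p ^ e)).comp L -
      (AddMonoidHom.mulLeft (algebraMap A E c ^ p ^ e)).comp M, ?_, ?_⟩
    · intro x y
      simp only [AddMonoidHom.sub_apply, AddMonoidHom.comp_apply, AddMonoidHom.coe_mulLeft]
      rw [hL, hM]; ring
    · intro x
      simp only [AddMonoidHom.sub_apply, AddMonoidHom.comp_apply, AddMonoidHom.coe_mulLeft]
      rw [hL', hM', map_sub, map_mul, map_mul, map_pow, map_pow]

lemma QExt.separate {A E : Type*} [CommRing A] [IsDomain A] [CommRing E] [Algebra A E] (p e : ℕ)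
    [ExpChar A p] (H : ∀ f : A, f ≠ 0 → ∃ φ, QExt A E (p ^ e) φ ∧ φ f ≠ 0) (m : ℕ) :
    ∀ (g : Fin m → A) (f : A), (∀ (b : A) (a : Fin m → A),
      b ^ p ^ e * f = ∑ i, a i ^ p ^ e * g i → b = 0) →
      ∃ φ, QExt A E (p ^ e) φ ∧ (∀ i, φ (g i) = 0) ∧ φ f ≠ 0 := by
  have hq0 : p ^ e ≠ 0 := (expChar_pow_pos A p e).ne'
  induction m with
  | zero =>
    intro g f hf
    obtain ⟨φ, h1, h2⟩ := H f (by
      rintro rfl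
      exact one_ne_zero (hf 1 0 (by simp)))
    exact ⟨φ, h1, fun i => i.elim0, h2⟩
  | succ m ih =>
    intro g f hf
    let g' : Fin m → A := fun i => g i.castSucc
    by_cases hg : ∀ (b : A) (a : Fin m → A),
      b ^ p ^ e * g (Fin.last m) = ∑ i, a i ^ p ^ e * g' i → b = 0
    · obtain ⟨ψ, h1, h2, h3⟩ := ih g' _ hg
      obtain ⟨c, hc⟩ := h1.2.1 (g (Fin.last m))
      obtain ⟨d, hd⟩ := h1.2.1 f
      have hc0 : c ≠ 0 := by rintro rfl; rw [hc, zero_pow hq0] at h3; exact h3 rfl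
      obtain ⟨φ', k1, k2, k3⟩ := ih g' (c ^ p ^ e * f - d ^ p ^ e * g (Fin.last m)) (by
        intro b a hb
        have := hf (b * c) (Fin.snoc a (b * d)) (by
          rw [Fin.sum_univ_castSucc]
          simp only [Fin.snoc_castSucc, Fin.snoc_last]
          rw [← hb]
          ring)
        exact (mul_eq_zero.1 this).resolve_right hc0)
      obtain ⟨t, ht⟩ := k1.2.1 (g (Fin.last m))
      obtain ⟨θ, l1, l2⟩ := QExt.comb p e k1 h1 c t
      refine ⟨θ, l1, ?_, ?_⟩
      · intro i
        rw [l2]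
        induction i using Fin.lastCases with
        | last => rw [ht, hc]; ring
        | cast i => rw [show φ' (g i.castSucc) = 0 from k2 i, show ψ (g i.castSucc) = 0 from h2 i]; ring
      · rw [l2]
        rw [map_sub, k1.1, k1.1, ht] at k3
        rw [hd]
        intro h
        apply k3
        rw [← h]; ring
    · push Not at hg
      obtain ⟨b, a, hba, hb0⟩ := hg
      obtain ⟨φ, h1, h2, h3⟩ := ih g' f (by
        intro c a' h
        refine hf c (Fin.snoc a' 0) ?_
        rw [Fin.sum_univ_castSucc]
        simp only [Fin.snoc_castSucc, Fin.snoc_last]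
        rw [zero_pow hq0, zero_mul, add_zero, h])
      refine ⟨φ, h1, ?_, h3⟩
      intro i
      induction i using Fin.lastCases with
      | last =>
        have := congrArg φ hba
        rw [h1.1, map_sum] at this
        simp only [h1.1, h2, mul_zero, Finset.sum_const_zero] at this
        exact (mul_eq_zero.1 this).resolve_left (pow_ne_zero _ hb0)
      | cast i => exact h2 i

lemma hq_of_qext {A E F0 R0 Q : Type*} [CommRing A] [IsDomain A] [CommRing E] [Algebra A E]
    [Field F0] [Algebra A F0] [IsFractionRing A F0] [CommRing R0] [CommRing Q] [Algebra R0 Q]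
    [Algebra E R0] [Algebra E Q] [IsScalarTower E R0 Q] [IsFractionRing E Q]
    [Algebra F0 R0] [Algebra F0 Q] [IsScalarTower F0 R0 Q]
    [Algebra A R0] [IsScalarTower A E R0] [IsScalarTower A F0 R0]
    [IsLocalization (Algebra.algebraMapSubmonoid E (nonZeroDivisors A)) R0]
    [IsReduced E] [Module.Flat A E]
    (p e : ℕ) [ExpChar A p] (H : ∀ f : A, f ≠ 0 → ∃ φ, QExt A E (p ^ e) φ ∧ φ f ≠ 0)
    (hI : ICl (algebraMap R0 Q)) :
    HQ (F0 := F0) (p ^ e) (algebraMap R0 Q) := by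
  intro m h hind r
  have hq0 : p ^ e ≠ 0 := (expChar_pow_pos A p e).ne'
  -- common denominator of h
  obtain ⟨c, hc⟩ := IsLocalization.exist_integer_multiples_of_finite (nonZeroDivisors A) h
  obtain ⟨t, ht⟩ := IsLocalization.exist_integer_multiples_of_finite (nonZeroDivisors E) r
  choose g0 hg0 using hc
  choose s hs using ht
  have hc0 : c.1 ≠ 0 := nonZeroDivisors.coe_ne_zero c
  let g : Fin m → A := fun i => c.1 ^ (p ^ e - 1) * g0 i
  have hg : ∀ i, algebraMap A F0 (g i) = algebraMap A F0 c.1 ^ p ^ e * h i := by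
    intro i
    simp only [g, map_mul, map_pow]
    rw [hg0, Algebra.smul_def, ← mul_assoc, ← pow_succ, Nat.sub_add_cancel (Nat.pos_of_ne_zero hq0)]
  have hginj := IsFractionRing.injective A F0
  have gind : ∀ a : Fin m → A, ∑ i, a i ^ p ^ e * g i = 0 → a = 0 := by
    intro a ha
    have h1 := hind (fun i => algebraMap A F0 (a i * c.1)) (by
      have := congrArg (algebraMap A F0) ha
      rw [map_sum, map_zero] at this
      rw [← this]
      refine Finset.sum_congr rfl fun i _ => ?_
      simp only [map_mul, map_pow]
      rw [hg]; ring)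
    funext i
    have h2 := congrFun h1 i
    have h3 : a i * c.1 = 0 := hginj (by rw [map_zero]; exact h2)
    exact (mul_eq_zero.1 h3).resolve_right hc0
  have hdual : ∀ j, ∃ φ, QExt A E (p ^ e) φ ∧ (∀ i, i ≠ j → φ (g i) = 0) ∧ φ (g j) ≠ 0 := by
    intro j
    obtain ⟨m', rfl⟩ : ∃ m', m = m' + 1 := ⟨m - 1, by have := j.2; omega⟩
    obtain ⟨φ, h1, h2, h3⟩ := QExt.separate p e H m' (fun i => g (j.succAbove i)) (g j) (by
      intro b a hb
      have := gind (j.insertNth (-b) a) (by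
        rw [Fin.sum_univ_succAbove _ j]
        simp only [Fin.insertNth_apply_same, Fin.insertNth_apply_succAbove]
        rw [← hb, ← add_mul, ← add_pow_expChar_pow, neg_add_cancel, zero_pow hq0, zero_mul])
      have := congrFun this j
      simpa using this)
    refine ⟨φ, h1, ?_, h3⟩
    intro i hij
    obtain ⟨i', rfl⟩ := Fin.exists_succAbove_eq hij
    exact h2 i'
  have hAQ : ∀ a : A, algebraMap F0 Q (algebraMap A F0 a) = algebraMap E Q (algebraMap A E a) := by
    intro a
    rw [IsScalarTower.algebraMap_apply F0 R0 Q, IsScalarTower.algebraMap_apply E R0 Q,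
      ← IsScalarTower.algebraMap_apply A F0 R0, ← IsScalarTower.algebraMap_apply A E R0]
  have hEinj := IsFractionRing.injective E Q
  -- main computation
  have main : ∀ (a : A) (w : E), a ≠ 0 → algebraMap E Q (algebraMap A E a) *
      (∑ i, r i ^ p ^ e * algebraMap F0 Q (h i)) = algebraMap E Q w → ∀ j,
      ∃ d : A, d ≠ 0 ∧ ∃ L : E →+ E, algebraMap A E d * (algebraMap A E a * s j) ^ p ^ e =
        t.1 ^ p ^ e * L (algebraMap A E a ^ (p ^ e - 1) * algebraMap A E c.1 ^ p ^ e * w) := by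
    intro a w ha haw j
    obtain ⟨φ, h1, h2, h3⟩ := hdual j
    obtain ⟨L, hL, hL'⟩ := h1.2.2
    refine ⟨φ (g j), h3, L, ?_⟩
    have e1 : ∑ i, (algebraMap A E a * s i) ^ p ^ e * algebraMap A E (g i) =
        t.1 ^ p ^ e * (algebraMap A E a ^ (p ^ e - 1) * algebraMap A E c.1 ^ p ^ e * w) := by
      apply hEinj
      rw [map_sum, map_mul, map_mul, map_mul, ← haw]
      simp only [map_mul, map_pow, Finset.mul_sum]
      refine Finset.sum_congr rfl fun i _ => ?_
      rw [hs, ← hAQ (g i), hg, map_mul, map_pow, hAQ, Algebra.smul_def]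
      have : algebraMap E Q (algebraMap A E a) ^ p ^ e =
        algebraMap E Q (algebraMap A E a) ^ (p ^ e - 1) * algebraMap E Q (algebraMap A E a) := by
        rw [← pow_succ, Nat.sub_add_cancel (Nat.pos_of_ne_zero hq0)]
      rw [mul_pow, mul_pow, this]
      ring
    have e2 := congrArg L e1
    rw [hL, map_sum, Finset.sum_eq_single j] at e2
    · rw [← e2, hL, hL', mul_comm]
    · intro i _ hij
      rw [hL, hL', h2 i hij, map_zero, mul_zero]
    · simp
  have hts : ∀ i, algebraMap E Q t.1 * r i = algebraMap E Q (s i) := by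
    intro i; rw [hs, Algebra.smul_def]
  have htu := IsLocalization.map_units Q t
  have hnz : ∀ d : A, d ≠ 0 → algebraMap A E d ∈ nonZeroDivisors E := fun d hd =>
    map_nzd_of_flat (mem_nonZeroDivisors_of_ne_zero hd)
  have hunit : ∀ d : A, d ≠ 0 → IsUnit (algebraMap E R0 (algebraMap A E d)) := fun d hd =>
    IsLocalization.map_units (M := Algebra.algebraMapSubmonoid E (nonZeroDivisors A)) R0
      ⟨algebraMap A E d, ⟨d, mem_nonZeroDivisors_of_ne_zero hd, rfl⟩⟩
  constructor
  · rintro ⟨y, hy⟩ j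
    obtain ⟨w, y', rfl⟩ := IsLocalization.exists_mk'_eq
      (Algebra.algebraMapSubmonoid E (nonZeroDivisors A)) y
    obtain ⟨a, ha, hay⟩ := y'.2
    have ha0 := nonZeroDivisors.ne_zero ha
    obtain ⟨d, hd, L, hL⟩ := main a w ha0 (by
      rw [← hy, IsScalarTower.algebraMap_apply E R0 Q (algebraMap A E a), ← map_mul, hay,
        IsLocalization.mk'_spec', ← IsScalarTower.algebraMap_apply E R0 Q]) j
    set W := L (algebraMap A E a ^ (p ^ e - 1) * algebraMap A E c.1 ^ p ^ e * w)
    obtain ⟨a', ha'⟩ := (hunit a ha0).exists_right_inv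
    obtain ⟨d', hd'⟩ := (hunit d hd).exists_right_inv
    have hpow : r j ^ p ^ e = algebraMap R0 Q (algebraMap E R0 W * d' * a' ^ p ^ e) := by
      have e3 := congrArg (algebraMap E Q) hL
      simp only [map_mul, map_pow] at e3
      rw [← hts, mul_pow, mul_pow] at e3
      have e4 : algebraMap E Q (algebraMap A E d) * algebraMap E Q (algebraMap A E a) ^ p ^ e *
          r j ^ p ^ e = algebraMap E Q W := by
        apply (htu.pow (p ^ e)).mul_left_cancel
        rw [← e3]; ring
      have ha2 : algebraMap E Q (algebraMap A E a) * algebraMap R0 Q a' = 1 := by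
        rw [IsScalarTower.algebraMap_apply E R0 Q, ← map_mul, ha', map_one]
      have hd2 : algebraMap E Q (algebraMap A E d) * algebraMap R0 Q d' = 1 := by
        rw [IsScalarTower.algebraMap_apply E R0 Q, ← map_mul, hd', map_one]
      rw [map_mul, map_mul, map_pow, ← IsScalarTower.algebraMap_apply E R0 Q, ← e4]
      calc r j ^ p ^ e = (algebraMap E Q (algebraMap A E d) * algebraMap R0 Q d') *
          (algebraMap E Q (algebraMap A E a) * algebraMap R0 Q a') ^ p ^ e * r j ^ p ^ e := by
            rw [ha2, hd2]; simp
        _ = _ := by ring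
    refine hI _ ⟨Polynomial.X ^ p ^ e - Polynomial.C (algebraMap E R0 W * d' * a' ^ p ^ e),
      Polynomial.monic_X_pow_sub_C _ hq0, ?_⟩
    simp [hpow]
  · intro h0
    funext j
    obtain ⟨d, hd, L, hL⟩ := main 1 0 one_ne_zero (by rw [h0]; simp) j
    rw [mul_zero, map_zero, mul_zero, map_one, one_mul] at hL
    have h1 : s j ^ p ^ e = 0 := (mem_nonZeroDivisors_iff_left.1 (hnz d hd)) _ hL
    have h2 := eq_zero_of_pow_eq_zero h1
    have h3 := hts j
    rw [h2, map_zero] at h3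
    exact htu.mul_right_eq_zero.1 h3

end Hprop
end CTN

namespace CTN
section HPow
open MvPowerSeries

/-- apply an additive map to the coefficients -/
noncomputable def cwise {σ S T : Type*} [CommRing S] [CommRing T] (l : S →+ T) :
    MvPowerSeries σ S →+ MvPowerSeries σ T where
  toFun g := fun n => l (coeff n g)
  map_zero' := by ext n; exact l.map_zero
  map_add' f g := by
    ext n
    change l (coeff n (f + g)) = l (coeff n f) + l (coeff n g)
    rw [map_add, map_add]

lemma coeff_cwise {σ S T : Type*} [CommRing S] [CommRing T] (l : S →+ T) (g : MvPowerSeries σ S)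
    (n) : coeff n (cwise l g) = l (coeff n g) := rfl

/-- the Cartier-type operator -/
noncomputable def carT {σ S : Type*} [CommRing S] (q : ℕ) (β : σ →₀ ℕ) :
    MvPowerSeries σ S →+ MvPowerSeries σ S where
  toFun g := fun n => coeff (q • n + β) g
  map_zero' := by ext n; exact (coeff (q • n + β)).map_zero
  map_add' f g := by
    ext n
    change coeff (q • n + β) (f + g) = coeff (q • n + β) f + coeff (q • n + β) g
    rw [map_add]

lemma coeff_carT {σ S : Type*} [CommRing S] (q : ℕ) (β : σ →₀ ℕ) (g : MvPowerSeries σ S)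
    (n) : coeff n (carT q β g) = coeff (q • n + β) g := rfl

lemma carT_expand_mul {σ S : Type*} [CommRing S] (q : ℕ) (hq : q ≠ 0) (β : σ →₀ ℕ)
    (hβ : ∀ i, β i < q) (e g : MvPowerSeries σ S) :
    carT q β (expand q hq e * g) = e * carT q β g := by
  classical
  ext n
  rw [coeff_carT, coeff_mul, coeff_mul]
  symm
  refine Finset.sum_of_injOn (fun x => (q • x.1, q • x.2 + β)) ?_ ?_ ?_ ?_
  · rintro ⟨a, b⟩ _ ⟨c, d⟩ _ h
    simp only [Prod.mk.injEq, add_left_inj] at h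
    have aux : ∀ a b : σ →₀ ℕ, q • a = q • b → a = b := by
      intro a b h
      ext i
      have := DFunLike.congr_fun h i
      simp only [Finsupp.smul_apply, smul_eq_mul] at this
      exact Nat.eq_of_mul_eq_mul_left (Nat.pos_of_ne_zero hq) this
    rw [aux _ _ h.1, aux _ _ h.2]
  · rintro ⟨a, b⟩ h
    simp only [Finset.mem_coe, Finset.HasAntidiagonal.mem_antidiagonal] at h ⊢
    rw [← h, smul_add, add_assoc]
  · rintro ⟨a, b⟩ h h'
    by_cases hd : ∀ i, q ∣ a i
    · exfalso
      apply h'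
      obtain ⟨a', rfl⟩ : ∃ a', a = q • a' := ⟨a.mapRange (fun n => n / q) (Nat.zero_div q),
        by ext i; simp [Nat.mul_div_cancel' (hd i)]⟩
      rw [Finset.HasAntidiagonal.mem_antidiagonal] at h
      have hle : a' ≤ n := by
        intro i
        have := DFunLike.congr_fun h i
        simp only [Finsupp.add_apply, Finsupp.smul_apply, smul_eq_mul] at this
        by_contra hlt
        push Not at hlt
        have h1 : q * (n i + 1) ≤ q * a' i := Nat.mul_le_mul_left _ hlt
        have h2 := hβ i
        rw [mul_add, mul_one] at h1
        omega
      refine ⟨(a', n - a'), ?_, ?_⟩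
      · simp only [Finset.mem_coe, Finset.HasAntidiagonal.mem_antidiagonal]
        exact add_tsub_cancel_of_le hle
      · simp only [Prod.mk.injEq, true_and]
        apply add_left_cancel (a := q • a')
        rw [h, ← add_assoc, ← smul_add, add_tsub_cancel_of_le hle]
    · push Not at hd
      obtain ⟨i, hi⟩ := hd
      dsimp only
      rw [coeff_expand_of_not_dvd q hq _ hi, zero_mul]
  · rintro ⟨a, b⟩ h
    dsimp only
    rw [coeff_expand_smul, coeff_carT]

lemma cwise_mul_pow {σ S : Type*} [CommRing S] (p e : ℕ) [ExpChar S p] (l : S →+ S)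
    (hl : ∀ a b, l (a ^ p ^ e * b) = a ^ p ^ e * l b) (f g : MvPowerSeries σ S) :
    cwise l (map (iterateFrobenius S p e) f * g) = map (iterateFrobenius S p e) f * cwise l g := by
  classical
  ext n
  rw [coeff_cwise, coeff_mul, coeff_mul, map_sum]
  refine Finset.sum_congr rfl fun x _ => ?_
  rw [coeff_map, iterateFrobenius_def, hl, coeff_cwise]

/-- the operators used for separation -/
noncomputable def carPhi {σ S : Type*} [CommRing S] (q : ℕ) (hq : q ≠ 0) (β : σ →₀ ℕ) (l : S →+ S) :
    MvPowerSeries σ S →+ MvPowerSeries σ S :=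
  ((expand q hq : MvPowerSeries σ S →ₐ[S] MvPowerSeries σ S) :
    MvPowerSeries σ S →+ MvPowerSeries σ S).comp ((cwise l).comp (carT q β))

lemma carPhi_apply {σ S : Type*} [CommRing S] (q : ℕ) (hq : q ≠ 0) (β : σ →₀ ℕ) (l : S →+ S) (g) :
    carPhi q hq β l g = expand q hq (cwise l (carT q β g)) := rfl

lemma carPhi_pow_mul {σ S : Type*} [CommRing S] (p e : ℕ) [ExpChar S p] (hp : p ≠ 0)
    (β : σ →₀ ℕ) (hβ : ∀ i, β i < p ^ e) (l : S →+ S)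
    (hl : ∀ a b, l (a ^ p ^ e * b) = a ^ p ^ e * l b) (f g : MvPowerSeries σ S) :
    carPhi (p ^ e) (pow_ne_zero e hp) β l (f ^ p ^ e * g) =
      f ^ p ^ e * carPhi (p ^ e) (pow_ne_zero e hp) β l g := by
  rw [carPhi_apply, carPhi_apply, ← map_iterateFrobenius_expand p hp f e, map_expand,
    carT_expand_mul _ _ _ hβ, cwise_mul_pow p e l hl, map_mul]

lemma exists_qlin {K : Type*} [Field K] (p e : ℕ) [ExpChar K p] (c : K) (hc : c ≠ 0) :
    ∃ l : K →+ K, (∀ a b, l (a ^ p ^ e * b) = a ^ p ^ e * l b) ∧ (∀ x, ∃ y, l x = y ^ p ^ e) ∧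
      l c ≠ 0 := by
  let k' := (iterateFrobenius K p e).fieldRange
  have : ∃ f : Module.Dual k' K, f c ≠ 0 := by
    by_contra h
    push Not at h
    exact hc ((Module.forall_dual_apply_eq_zero_iff k' c).1 h)
  obtain ⟨f, hf⟩ := this
  refine ⟨(algebraMap k' K : k' →+ K).comp f.toAddMonoidHom, ?_, ?_, ?_⟩
  · intro a b
    have : a ^ p ^ e * b = (⟨a ^ p ^ e, ⟨a, by simp [iterateFrobenius_def]⟩⟩ : k') • b := rfl
    change (algebraMap k' K) (f _) = _ * (algebraMap k' K) (f b)
    rw [this, map_smul, smul_eq_mul, map_mul]; rfl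
  · intro x
    obtain ⟨y, hy⟩ := (f x).2
    exact ⟨y, by rw [← iterateFrobenius_def]; exact hy.symm⟩
  · intro h
    apply hf
    exact (algebraMap k' K).injective (by rw [map_zero]; exact h)

lemma qext_powerSeries {σ K R : Type*} [Finite σ] [Field K] [CommRing R] [Nontrivial R] [Algebra K R] (p e : ℕ)
    [ExpChar K p] (H : HExt K R (p ^ e)) (f : MvPowerSeries σ K) (hf : f ≠ 0) :
    ∃ φ, QExt (MvPowerSeries σ K) (MvPowerSeries σ R) (p ^ e) φ ∧ φ f ≠ 0 := by
  have hp : p ≠ 0 := (expChar_pos K p).ne'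
  have hq : p ^ e ≠ 0 := pow_ne_zero e hp
  have : ExpChar R p := expChar_of_injective_algebraMap (algebraMap K R).injective p
  obtain ⟨γ, hγ⟩ : ∃ γ, coeff γ f ≠ 0 := by
    by_contra h
    push Not at h
    exact hf (MvPowerSeries.ext (by simpa using h))
  let β : σ →₀ ℕ := γ.mapRange (fun n => n % p ^ e) (Nat.zero_mod _)
  let α : σ →₀ ℕ := γ.mapRange (fun n => n / p ^ e) (Nat.zero_div _)
  have hγ' : p ^ e • α + β = γ := by ext i; simp [α, β, Nat.div_add_mod]
  have hβ : ∀ i, β i < p ^ e := fun i => by simpa [β] using Nat.mod_lt _ (Nat.pos_of_ne_zero hq)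
  obtain ⟨l, hl, hl', hl0⟩ := exists_qlin p e _ hγ
  obtain ⟨L, hL, hL'⟩ := H l hl
  refine ⟨carPhi (p ^ e) hq β l, ⟨carPhi_pow_mul p e hp β hβ l hl, ?_,
    carPhi (p ^ e) hq β L, carPhi_pow_mul p e hp β hβ L hL, ?_⟩, ?_⟩
  · intro x
    choose y hy using hl'
    let z : MvPowerSeries σ K := fun n => y (coeff n (carT (p ^ e) β x))
    refine ⟨z, ?_⟩
    rw [← map_iterateFrobenius_expand p hp z e, map_expand, carPhi_apply]
    congr 1
    ext n
    rw [coeff_cwise, coeff_map, hy, iterateFrobenius_def]; rfl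
  · intro a
    change _ = map (algebraMap K R) _
    rw [carPhi_apply, carPhi_apply, map_expand]
    congr 1
    ext n
    rw [coeff_cwise, coeff_map, coeff_cwise, coeff_carT, coeff_carT, ← hL']
    rfl
  · intro h
    have := congrArg (coeff (p ^ e • α)) h
    rw [carPhi_apply, coeff_expand_smul, coeff_cwise, coeff_carT, hγ', map_zero] at this
    exact hl0 this

end HPow
end CTN

namespace CTN
section VarIdeal
open MvPowerSeries

/-- the ideal generated by the variables -/
noncomputable def varI (σ R : Type*) [CommRing R] : Ideal (MvPowerSeries σ R) :=
  Ideal.span (Set.range (X : σ → MvPowerSeries σ R))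

lemma X_mem_varI {σ R : Type*} [CommRing R] (i : σ) : (X i : MvPowerSeries σ R) ∈ varI σ R :=
  Ideal.subset_span ⟨i, rfl⟩

lemma mem_varI_pow_of_coeff {σ R : Type*} [Finite σ] [CommRing R] (n : ℕ) :
    ∀ f : MvPowerSeries σ R, (∀ m, m.degree < n → coeff m f = 0) → f ∈ varI σ R ^ n := by
  classical
  have := Fintype.ofFinite σ
  induction n with
  | zero => intro f _; simp
  | succ n ih =>
    intro f hf
    have hex : ∀ m : σ →₀ ℕ, m ≠ 0 → ∃ i, m i ≠ 0 := by
      intro m hm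
      by_contra h
      push Not at h
      exact hm (Finsupp.ext h)
    choose ix hix using hex
    let g : σ → MvPowerSeries σ R := fun i m =>
      if h : m + Finsupp.single i 1 = 0 then 0 else
        if ix _ h = i then coeff (m + Finsupp.single i 1) f else 0
    have hg : ∀ i m, coeff m (g i) = if h : m + Finsupp.single i 1 = 0 then 0 else
        if ix _ h = i then coeff (m + Finsupp.single i 1) f else 0 := fun i m => rfl
    have hsum : f = ∑ i, X i * g i := by
      ext m
      rw [map_sum]
      have hX : ∀ i, coeff m (X i * g i) = if h : m = 0 then 0 else
          if ix m h = i then coeff m f else 0 := by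
        intro i
        rw [X, coeff_monomial_mul]
        by_cases hle : Finsupp.single i 1 ≤ m
        · rw [if_pos hle, one_mul, hg]
          simp only [tsub_add_cancel_of_le hle]
        · rw [if_neg hle]
          split_ifs with h1 h2
          · rfl
          · exfalso
            apply hle
            rw [Finsupp.single_le_iff, Nat.one_le_iff_ne_zero, ← h2]
            exact hix m h1
          · rfl
      simp only [hX]
      by_cases hm : m = 0
      · subst hm
        simp only [dite_true, Finset.sum_const_zero]
        exact hf 0 (by simp)
      · simp only [hm, dite_false]
        rw [Finset.sum_ite_eq]
        simp
    rw [hsum]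
    refine Ideal.sum_mem _ fun i _ => ?_
    rw [pow_succ']
    refine Ideal.mul_mem_mul (X_mem_varI i) (ih _ ?_)
    intro m hm
    rw [hg]
    split_ifs with h1 h2
    · rfl
    · apply hf
      rw [map_add, Finsupp.degree_single]
      omega
    · rfl

/-- the ideal `J R[[x]] + (x)` -/
noncomputable def cI {R : Type*} (σ : Type*) [CommRing R] (J : Ideal R) : Ideal (MvPowerSeries σ R) :=
  J.map (C : R →+* MvPowerSeries σ R) ⊔ varI σ R

lemma coeff_of_mem_cI_pow {σ R : Type*} [CommRing R] (J : Ideal R) (n : ℕ) :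
    ∀ f : MvPowerSeries σ R, f ∈ cI σ J ^ n → ∀ m : σ →₀ ℕ, coeff m f ∈ J ^ (n - m.degree) := by
  classical
  let W : ℕ → Ideal (MvPowerSeries σ R) := fun n =>
    { carrier := {f | ∀ m : σ →₀ ℕ, coeff m f ∈ J ^ (n - m.degree)}
      add_mem' := fun {f g} hf hg m => by rw [map_add]; exact Ideal.add_mem _ (hf m) (hg m)
      zero_mem' := fun m => by rw [map_zero]; exact Ideal.zero_mem _
      smul_mem' := fun c f hf m => by
        rw [smul_eq_mul, coeff_mul]
        refine Ideal.sum_mem _ fun x hx => Ideal.mul_mem_left _ _ ?_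
        refine Ideal.pow_le_pow_right ?_ (hf x.2)
        rw [Finset.HasAntidiagonal.mem_antidiagonal] at hx
        rw [← hx, map_add]; omega }
  have hW : ∀ n f, f ∈ W n ↔ ∀ m : σ →₀ ℕ, coeff m f ∈ J ^ (n - m.degree) := fun n f => Iff.rfl
  suffices h : cI σ J ^ n ≤ W n from fun f hf => (hW n f).1 (h hf)
  have h1 : cI σ J ≤ W 1 := by
    refine sup_le ?_ ?_
    · rw [Ideal.map_le_iff_le_comap]
      intro j hj
      rw [Ideal.mem_comap, hW]
      intro m
      rw [coeff_C]
      split_ifs with h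
      · subst h; simpa using hj
      · exact Ideal.zero_mem _
    · refine Ideal.span_le.2 ?_
      rintro _ ⟨i, rfl⟩
      rw [SetLike.mem_coe, hW]
      intro m
      rw [coeff_X]
      split_ifs with h
      · subst h; simp
      · exact Ideal.zero_mem _
  induction n with
  | zero =>
    intro f _
    rw [hW]
    intro m; simp
  | succ n ih =>
    rw [pow_succ, Ideal.mul_le]
    intro f hf g hg
    have hf := (hW _ _).1 (ih hf)
    have hg := (hW _ _).1 (h1 hg)
    rw [hW]
    intro m
    rw [coeff_mul]
    refine Ideal.sum_mem _ fun x hx => ?_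
    have := Ideal.mul_mem_mul (hf x.1) (hg x.2)
    rw [← pow_add] at this
    refine Ideal.pow_le_pow_right ?_ this
    rw [Finset.HasAntidiagonal.mem_antidiagonal] at hx
    rw [← hx, map_add]; omega

lemma mem_cI_pow_iff {σ R : Type*} [Finite σ] [CommRing R] (J : Ideal R) (n : ℕ)
    (f : MvPowerSeries σ R) :
    f ∈ cI σ J ^ n ↔ ∀ m : σ →₀ ℕ, m.degree < n → coeff m f ∈ J ^ (n - m.degree) := by
  classical
  refine ⟨fun h m _ => coeff_of_mem_cI_pow J n f h m, fun h => ?_⟩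
  have e : f = (f - (truncTotal n f : MvPolynomial σ R)) + (truncTotal n f : MvPolynomial σ R) := by
    ring
  rw [e]
  refine Ideal.add_mem _ ?_ ?_
  · refine Ideal.pow_right_mono (le_sup_right : varI σ R ≤ cI σ J) n (mem_varI_pow_of_coeff n _ ?_)
    intro m hm
    rw [map_sub, MvPolynomial.coeff_coe, coeff_truncTotal _ hm, sub_self]
  · rw [MvPolynomial.as_sum (truncTotal n f)]
    rw [← MvPolynomial.coeToMvPowerSeries.ringHom_apply, map_sum]
    refine Ideal.sum_mem _ fun m hm => ?_
    have hmn : m.degree < n := by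
      by_contra hlt
      rw [MvPolynomial.mem_support_iff, coeff_truncTotal_eq_zero _ (not_lt.1 hlt)] at hm
      exact hm rfl
    rw [coeff_truncTotal _ hmn, MvPolynomial.coeToMvPowerSeries.ringHom_apply,
      MvPolynomial.coe_monomial]
    have h1 : monomial m (coeff m f) = C (coeff m f) * monomial m 1 := by
      rw [← monomial_zero_eq_C_apply, monomial_mul_monomial, zero_add, mul_one]
    have h2 : (monomial m (1 : R) : MvPowerSeries σ R) ∈ cI σ J ^ m.degree := by
      refine Ideal.pow_right_mono (le_sup_right : varI σ R ≤ cI σ J) _ (mem_varI_pow_of_coeff _ _ ?_)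
      intro m' hm'
      rw [coeff_monomial, if_neg]
      rintro rfl
      exact lt_irrefl _ hm'
    have h3 : C (coeff m f) ∈ cI σ J ^ (n - m.degree) := by
      refine Ideal.pow_right_mono (le_sup_left : J.map C ≤ cI σ J) _ ?_
      rw [← Ideal.map_pow]
      exact Ideal.mem_map_of_mem _ (h m hmn)
    have h4 := Ideal.mul_mem_mul h3 h2
    rw [← pow_add, Nat.sub_add_cancel hmn.le] at h4
    rw [h1]
    exact h4

lemma cI_bot {σ R : Type*} [CommRing R] : cI σ (⊥ : Ideal R) = varI σ R := by
  rw [cI, Ideal.map_bot, bot_sup_eq]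

lemma mem_varI_pow_iff {σ R : Type*} [Finite σ] [CommRing R] (n : ℕ) (f : MvPowerSeries σ R) :
    f ∈ varI σ R ^ n ↔ ∀ m : σ →₀ ℕ, m.degree < n → coeff m f = 0 := by
  rw [← cI_bot, mem_cI_pow_iff]
  refine forall₂_congr fun m hm => ?_
  rw [← Ideal.zero_eq_bot, zero_pow (by omega), Ideal.zero_eq_bot, Ideal.mem_bot]

lemma isAdicComplete_cI {σ R : Type*} [Finite σ] [CommRing R] (J : Ideal R) [IsAdicComplete J R] :
    IsAdicComplete (cI σ J) (MvPowerSeries σ R) where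
  haus' := by
    intro f hf
    ext m
    rw [map_zero]
    refine IsHausdorff.haus (I := J) inferInstance _ fun n => ?_
    have := hf (n + m.degree)
    rw [SModEq.zero, smul_eq_mul, Ideal.mul_top] at this ⊢
    have := coeff_of_mem_cI_pow J _ _ this m
    rwa [Nat.add_sub_cancel] at this
  prec' := by
    intro f hf
    have h1 : ∀ m : σ →₀ ℕ, ∃ L : R, ∀ n, coeff m (f (n + m.degree)) ≡ L [SMOD J ^ n • (⊤ : Ideal R)] := by
      intro m
      refine IsPrecomplete.prec (I := J) inferInstance ?_
      intro a b hab
      have := hf (show a + m.degree ≤ b + m.degree by omega)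
      rw [SModEq.sub_mem, smul_eq_mul, Ideal.mul_top] at this ⊢
      have := coeff_of_mem_cI_pow J _ _ this m
      rwa [Nat.add_sub_cancel, map_sub] at this
    choose L hL using h1
    let g : MvPowerSeries σ R := fun m => L m
    have hg : ∀ m, coeff m g = L m := fun m => rfl
    refine ⟨g, fun n => ?_⟩
    rw [SModEq.sub_mem, smul_eq_mul, Ideal.mul_top, mem_cI_pow_iff]
    intro m hm
    have := hL m (n - m.degree)
    rw [Nat.sub_add_cancel hm.le, SModEq.sub_mem, smul_eq_mul, Ideal.mul_top] at this
    rw [map_sub, hg]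
    exact this

lemma isAdicComplete_bot (R : Type*) [CommRing R] : IsAdicComplete (⊥ : Ideal R) R := inferInstance

lemma isAdicComplete_varI {σ R : Type*} [Finite σ] [CommRing R] :
    IsAdicComplete (varI σ R) (MvPowerSeries σ R) := by
  have := isAdicComplete_cI (σ := σ) (⊥ : Ideal R)
  rwa [cI_bot] at this

end VarIdeal

section FlatPow
open MvPowerSeries

lemma flat_powerSeries {σ K R : Type*} [Finite σ] [Field K] [CommRing R] [Algebra K R] :
    Module.Flat (MvPowerSeries σ K) (MvPowerSeries σ R) := by
  classical
  let b := Module.Free.chooseBasis K R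
  have hmul : ∀ i (a : MvPowerSeries σ K) (f : MvPowerSeries σ R),
      cwise (b.coord i).toAddMonoidHom (a • f) = a * cwise (b.coord i).toAddMonoidHom f := by
    intro i a f
    ext n
    rw [Algebra.smul_def, coeff_cwise, coeff_mul, coeff_mul, map_sum]
    refine Finset.sum_congr rfl fun x _ => ?_
    rw [coeff_cwise]
    change b.coord i (algebraMap K R (coeff x.1 a) * _) = _
    rw [← Algebra.smul_def, map_smul, smul_eq_mul]; rfl
  have hext : ∀ f g : MvPowerSeries σ R, (∀ i, cwise (b.coord i).toAddMonoidHom f =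
      cwise (b.coord i).toAddMonoidHom g) → f = g := by
    intro f g h
    ext n
    apply b.repr.injective
    ext i
    exact congrArg (coeff n) (h i)
  refine Module.Flat.of_forall_isTrivialRelation ?_
  intro l a f haf
  let φ : (Fin l → MvPowerSeries σ K) →ₗ[MvPowerSeries σ K] MvPowerSeries σ K :=
    Fintype.linearCombination (MvPowerSeries σ K) a
  let N := LinearMap.ker φ
  obtain ⟨s, hs⟩ := Ideal.exists_pow_inf_eq_pow_smul (varI σ K) N
  obtain ⟨k, ρ, hρ⟩ := Submodule.fg_iff_exists_fin_generating_family.1 (IsNoetherian.noetherian N)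
  let v : _ → Fin l → MvPowerSeries σ K := fun i t => cwise (b.coord i).toAddMonoidHom (f t)
  have hv : ∀ i, v i ∈ N := by
    intro i
    rw [LinearMap.mem_ker, Fintype.linearCombination_apply]
    have := congrArg (cwise (b.coord i).toAddMonoidHom) haf
    rw [map_sum, map_zero] at this
    simp only [hmul] at this
    rw [← this]
    refine Finset.sum_congr rfl fun t _ => ?_
    rw [smul_eq_mul, mul_comm]
  -- choice of coefficients of controlled order
  have key : ∀ (n : ℕ) (w : Fin l → MvPowerSeries σ K), w ∈ N → (∀ t, w t ∈ varI σ K ^ (n + s)) →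
      ∃ c : Fin k → MvPowerSeries σ K, (∀ j, c j ∈ varI σ K ^ n) ∧ ∑ j, c j • ρ j = w := by
    intro n w hw hwn
    have h1 : w ∈ varI σ K ^ (n + s) • (⊤ : Submodule (MvPowerSeries σ K) (Fin l → MvPowerSeries σ K)) ⊓ N := by
      refine ⟨?_, hw⟩
      rw [← (Pi.basisFun (MvPowerSeries σ K) (Fin l)).sum_repr w]
      refine Submodule.sum_mem _ fun t _ => Submodule.smul_mem_smul ?_ trivial
      simpa using hwn t
    rw [hs (n + s) (by omega), Nat.add_sub_cancel] at h1
    have h2 : w ∈ varI σ K ^ n • N := Submodule.smul_mono le_rfl inf_le_right h1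
    rw [← hρ] at h2
    rw [Submodule.mem_ideal_smul_span_iff_exists_sum] at h2
    obtain ⟨c, hc, hcw⟩ := h2
    refine ⟨fun j => c j, hc, ?_⟩
    rw [← hcw, Finsupp.sum_fintype]
    intro i; simp
  have key' : ∀ w : Fin l → MvPowerSeries σ K, w ∈ N →
      ∃ c : Fin k → MvPowerSeries σ K, (∀ n, (∀ t, w t ∈ varI σ K ^ (n + s)) →
        ∀ j, c j ∈ varI σ K ^ n) ∧ ∑ j, c j • ρ j = w := by
    intro w hw
    by_cases h0 : ∀ n, ∀ t, w t ∈ varI σ K ^ (n + s)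
    · refine ⟨0, fun n _ j => by simp, ?_⟩
      have : w = 0 := by
        funext t
        ext m
        rw [Pi.zero_apply, map_zero]
        exact (mem_varI_pow_iff _ _).1 (h0 (m.degree + 1) t) m (by omega)
      rw [this]; simp
    · push Not at h0
      have hP : ∃ n, ¬ ∀ t, w t ∈ varI σ K ^ (n + s) := by
        obtain ⟨n, t, h⟩ := h0
        exact ⟨n, fun h' => h (h' t)⟩
      let n0 := Nat.find hP
      have hn0 := Nat.find_spec hP
      by_cases hz : n0 = 0
      · have h2 : w ∈ Submodule.span (MvPowerSeries σ K) (Set.range ρ) := hρ ▸ hw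
        obtain ⟨c, hc⟩ := (Submodule.mem_span_range_iff_exists_fun _).1 h2
        refine ⟨c, ?_, hc⟩
        intro n hn j
        exfalso
        apply hn0
        intro t
        refine Ideal.pow_le_pow_right ?_ (hn t)
        change n0 + s ≤ _
        omega
      · have h3 : ∀ t, w t ∈ varI σ K ^ (n0 - 1 + s) := by
          by_contra hcon
          have := Nat.find_min' hP hcon
          change n0 ≤ _ at this
          omega
        obtain ⟨c, hc, hcw⟩ := key _ w hw h3
        refine ⟨c, ?_, hcw⟩
        intro n hn j
        refine Ideal.pow_le_pow_right ?_ (hc j)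
        by_contra hlt
        apply hn0
        intro t
        refine Ideal.pow_le_pow_right ?_ (hn t)
        change n0 + s ≤ _
        omega
  choose c hc1 hc2 using fun i => key' (v i) (hv i)
  -- finiteness
  have hfin : ∀ (m : σ →₀ ℕ) j, {i | coeff m (c i j) ≠ 0}.Finite := by
    intro m j
    have hfs : {m' : σ →₀ ℕ | m'.degree < m.degree + 1 + s}.Finite :=
      Finsupp.finite_of_degree_le (m.degree + s) |>.subset (fun x hx => by
        have : x.degree < m.degree + 1 + s := hx
        change x.degree ≤ _
        omega)
    have : (⋃ m' ∈ {m' : σ →₀ ℕ | m'.degree < m.degree + 1 + s}, ⋃ t : Fin l,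
        ((b.repr (coeff m' (f t))).support : Set (Module.Free.ChooseBasisIndex K R))).Finite :=
      hfs.biUnion fun m' _ => Set.finite_iUnion fun t => Finset.finite_toSet _
    refine this.subset ?_
    intro i hi
    by_contra hcon
    apply hi
    refine (mem_varI_pow_iff (m.degree + 1) _).1 (hc1 i _ ?_ j) m (by omega)
    intro t
    rw [mem_varI_pow_iff]
    intro m' hm'
    by_contra h
    apply hcon
    refine Set.mem_biUnion (x := m') hm' (Set.mem_iUnion.2 ⟨t, ?_⟩)
    rw [Finset.mem_coe, Finsupp.mem_support_iff]
    exact h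
  let y : Fin k → MvPowerSeries σ R := fun j m =>
    b.repr.symm (Finsupp.ofSupportFinite (fun i => coeff m (c i j)) (hfin m j))
  have hy : ∀ i j, cwise (b.coord i).toAddMonoidHom (y j) = c i j := by
    intro i j
    ext m
    change b.repr (b.repr.symm _) i = _
    rw [LinearEquiv.apply_symm_apply]
    rfl
  refine ⟨k, fun t j => ρ j t, y, ?_, ?_⟩
  · intro t
    apply hext
    intro i
    rw [map_sum]
    simp only [hmul, hy]
    change v i t = _
    rw [← hc2 i]
    rw [Finset.sum_apply]
    refine Finset.sum_congr rfl fun j _ => ?_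
    rw [Pi.smul_apply, smul_eq_mul, mul_comm]
  · intro j
    have : ρ j ∈ N := hρ ▸ Submodule.subset_span ⟨j, rfl⟩
    rw [LinearMap.mem_ker, Fintype.linearCombination_apply] at this
    rw [← this]
    refine Finset.sum_congr rfl fun t _ => ?_
    rw [smul_eq_mul, mul_comm]
end FlatPow
end CTN

namespace CTN
section FlatDiv

lemma flat_colon {A E : Type*} [CommRing A] [CommRing E] [Algebra A E] [Module.Flat A E]
    (p : Ideal A) (hp : p.FG) (a : A) (w : E)
    (h : ∀ g ∈ p, algebraMap A E a ∣ algebraMap A E g * w) :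
    ∃ (k : ℕ) (t : Fin k → A) (y : Fin k → E), w = ∑ j, algebraMap A E (t j) * y j ∧
      ∀ j, ∀ g ∈ p, a ∣ t j * g := by
  obtain ⟨n, g, hg⟩ := Submodule.fg_iff_exists_fin_generating_family.1 hp
  have hgp : ∀ i, g i ∈ p := fun i => hg ▸ Submodule.subset_span ⟨i, rfl⟩
  choose e he using fun i => h (g i) (hgp i)
  let f : (Fin n → A) →ₗ[A] A × (Fin n → A) :=
    (Fintype.linearCombination A g).prod (-(a • LinearMap.id))
  let x : A × (Fin n → A) →ₗ[A] E :=
    (LinearMap.toSpanSingleton A E w).coprod (Fintype.linearCombination A e)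
  have hf : ∀ c, f c = (∑ i, c i • g i, -(a • c)) := fun c => rfl
  have hx : ∀ r c, x (r, c) = r • w + ∑ i, c i • e i := fun r c => rfl
  have hxf : x ∘ₗ f = 0 := by
    refine LinearMap.pi_ext' fun i => LinearMap.ext fun c => ?_
    rw [LinearMap.comp_apply, LinearMap.comp_apply, hf, hx, LinearMap.single_apply, LinearMap.zero_comp,
      LinearMap.zero_apply]
    rw [Finset.sum_eq_single i, Finset.sum_eq_single i]
    · simp only [Pi.single_eq_same, Pi.neg_apply, Pi.smul_apply, smul_eq_mul, neg_smul]
      simp only [Algebra.smul_def, map_mul]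
      rw [mul_assoc, he]; ring
    · intro b _ hb; simp [Pi.single_eq_of_ne hb]
    · simp
    · intro b _ hb; simp [Pi.single_eq_of_ne hb]
    · simp
  obtain ⟨k, a', y, h1, h2⟩ := Module.Flat.exists_factorization_of_comp_eq_zero_of_free hxf
  refine ⟨k, fun j => a' (1, 0) j, fun j => y (Finsupp.single j 1), ?_, ?_⟩
  · have h3 := LinearMap.congr_fun h1 (1, 0)
    have h4 : x (1, 0) = w := by simp [x]
    rw [h4, LinearMap.comp_apply] at h3
    rw [h3]
    conv_lhs => rw [← Finsupp.univ_sum_single (a' (1, 0)), map_sum]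
    refine Finset.sum_congr rfl fun j _ => ?_
    rw [← Algebra.smul_def, ← map_smul, Finsupp.smul_single, smul_eq_mul, mul_one]
  · intro j
    have h3 : ∀ i, a ∣ a' (1, 0) j * g i := by
      intro i
      have h5 := LinearMap.congr_fun h2 (Pi.single i 1)
      have h6 : f (Pi.single i 1) = g i • ((1 : A), (0 : Fin n → A)) - a • ((0 : A), (Pi.single i 1 : Fin n → A)) := by
        rw [hf]
        rw [Finset.sum_eq_single i]
        · ext <;> simp
        · intro b _ hb; simp [Pi.single_eq_of_ne hb]
        · simp
      rw [LinearMap.comp_apply, h6, map_sub, map_smul, map_smul, LinearMap.zero_apply] at h5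
      have h7 := DFunLike.congr_fun h5 j
      simp only [Finsupp.sub_apply, Finsupp.smul_apply, smul_eq_mul, Finsupp.zero_apply] at h7
      exact ⟨_, by rw [mul_comm]; exact sub_eq_zero.1 h7⟩
    intro u hu
    rw [← hg] at hu
    induction hu using Submodule.span_induction with
    | mem x hx => obtain ⟨i, rfl⟩ := hx; exact h3 i
    | zero => simp
    | add x y _ _ hx hy => rw [mul_add]; exact dvd_add hx hy
    | smul c x _ hx => rw [smul_eq_mul, mul_left_comm]; exact hx.mul_left c

lemma flat_div {A E : Type*} [CommRing A] [IsDomain A] [IsNoetherianRing A] [IsIntegrallyClosed A]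
    [CommRing E] [Algebra A E] [Module.Flat A E]
    (hred : ∀ p : Ideal A, p.IsPrime → IsReduced (E ⧸ p.map (algebraMap A E)))
    (a : A) (ha : a ≠ 0) (w : E) (hw : HomInt w (algebraMap A E a)) : algebraMap A E a ∣ w := by
  by_contra hnd
  let I : E → Ideal A := fun x =>
    { carrier := {s | algebraMap A E a ∣ algebraMap A E s * x}
      add_mem' := fun {s t} hs ht => by
        change algebraMap A E a ∣ algebraMap A E (s + t) * x
        rw [map_add, add_mul]; exact dvd_add hs ht
      zero_mem' := by change algebraMap A E a ∣ algebraMap A E 0 * x; simp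
      smul_mem' := fun c s hs => by
        change algebraMap A E a ∣ algebraMap A E (c • s) * x
        rw [smul_eq_mul, map_mul, mul_assoc]; exact Dvd.dvd.mul_left hs _ }
  have hI : ∀ x s, s ∈ I x ↔ algebraMap A E a ∣ algebraMap A E s * x := fun x s => Iff.rfl
  obtain ⟨p, ⟨w1, ⟨b, rfl⟩, hw1, rfl⟩, hmax⟩ := set_has_maximal_iff_noetherian.mpr ‹IsNoetherianRing A›
    {J | ∃ x, (∃ b : A, x = algebraMap A E b * w) ∧ ¬ algebraMap A E a ∣ x ∧ J = I x}
    ⟨I w, w, ⟨1, by simp⟩, hnd, rfl⟩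
  set w1 := algebraMap A E b * w with hw1def
  have hHI : HomInt w1 (algebraMap A E a) := hw.mul_left _
  have hp1 : (1 : A) ∉ I w1 := by rw [hI]; simpa using hw1
  have hprime : (I w1).IsPrime := by
    refine ⟨fun h => hp1 (h ▸ trivial), ?_⟩
    intro u v huv
    by_contra hcon
    push Not at hcon
    obtain ⟨hu, hv⟩ := hcon
    refine hmax (I (algebraMap A E u * w1)) ⟨_, ⟨u * b, ?_⟩, ?_, rfl⟩ ?_
    · rw [map_mul, mul_assoc]
    · rw [hI] at hu; exact hu
    · refine lt_of_le_of_ne ?_ ?_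
      · intro s hs
        rw [hI] at hs ⊢
        rw [mul_left_comm]; exact Dvd.dvd.mul_left hs _
      · intro heq
        apply hv
        rw [heq, hI, ← mul_assoc, ← map_mul, mul_comm v u]
        exact huv
  have haE : algebraMap A E a ∈ nonZeroDivisors E :=
    map_nzd_of_flat (mem_nonZeroDivisors_of_ne_zero ha)
  have haI : a ∈ I w1 := (hI _ _).2 ⟨w1, rfl⟩
  obtain ⟨k, t, y, hty, ht⟩ := flat_colon (I w1) (IsNoetherian.noetherian _) a w1 (fun g hg => hg)
  -- find the multiplier
  have hex : ∃ t0 g s : A, (∀ g ∈ I w1, a ∣ t0 * g) ∧ g ∈ I w1 ∧ s ∉ I w1 ∧ t0 * g = a * s := by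
    by_contra hcon
    push Not at hcon
    have hdiv : ∀ j, a ∣ t j := by
      intro j
      let F := FractionRing A
      have hinj := IsFractionRing.injective A F
      have ha' : algebraMap A F a ≠ 0 := fun h => ha (hinj (by rw [h, map_zero]))
      let N : Submodule A F := Submodule.map (Algebra.linearMap A F) (I w1)
      have hIntF : IsIntegral A (algebraMap A F (t j) / algebraMap A F a) := by
        refine isIntegral_of_smul_mem_submodule N ?_ ?_ _ ?_
        · intro hN
          have : algebraMap A F a ∈ N := ⟨a, haI, rfl⟩
          rw [hN] at this
          exact ha' this
        · exact (IsNoetherian.noetherian _ : (I w1).FG).map _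
        · rintro _ ⟨g, hg, rfl⟩
          obtain ⟨s, hs⟩ := ht j g hg
          refine ⟨s, ?_, ?_⟩
          · by_contra hsn
            exact hcon (t j) g s (ht j) hg hsn hs
          · rw [Algebra.linearMap_apply, Algebra.linearMap_apply, smul_eq_mul, div_mul_eq_mul_div,
              ← map_mul, hs, map_mul, mul_div_cancel_left₀ _ ha']
      obtain ⟨c, hc⟩ := IsIntegrallyClosed.isIntegral_iff.1 hIntF
      refine ⟨c, hinj ?_⟩
      rw [map_mul, hc, mul_div_cancel₀ _ ha']
    apply hw1
    rw [hty]
    refine Finset.dvd_sum fun j _ => ?_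
    exact Dvd.dvd.mul_right (map_dvd _ (hdiv j)) _
  obtain ⟨t0, g, s, ht0, hg, hs, hts⟩ := hex
  apply hs
  obtain ⟨z, hz⟩ := (hI _ _).1 hg
  have hsz : algebraMap A E s * w1 = algebraMap A E t0 * z := by
    refine (mul_cancel_left_mem_nonZeroDivisors haE).1 ?_
    rw [← mul_assoc, ← map_mul, ← hts, map_mul, mul_assoc, hz]; ring
  have hzg : HomInt z (algebraMap A E g) := by
    obtain ⟨n, c, h⟩ := hHI.mul_both (algebraMap A E g)
    refine ⟨n, c, ?_⟩
    rw [hz, mul_comm (algebraMap A E g)] at h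
    have e : (algebraMap A E a * z) ^ n + ∑ i ∈ Finset.range n, c i * (algebraMap A E a * z) ^ i *
        (algebraMap A E a * algebraMap A E g) ^ (n - i) = (algebraMap A E a) ^ n *
        (z ^ n + ∑ i ∈ Finset.range n, c i * z ^ i * (algebraMap A E g) ^ (n - i)) := by
      rw [mul_add, Finset.mul_sum, mul_pow]
      congr 1
      refine Finset.sum_congr rfl fun i hi => ?_
      have : (algebraMap A E a) ^ n = (algebraMap A E a) ^ i * (algebraMap A E a) ^ (n - i) := by
        rw [← pow_add, Nat.add_sub_cancel' (Finset.mem_range.1 hi).le]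
      rw [this, mul_pow, mul_pow]; ring
    rw [e] at h
    exact (mem_nonZeroDivisors_iff_left.1 (pow_mem haE n)) _ h
  have hzp : z ∈ (I w1).map (algebraMap A E) := by
    have := hred _ hprime
    obtain ⟨n, c, h⟩ := hzg
    have h2 : z ^ n ∈ (I w1).map (algebraMap A E) := by
      rw [eq_neg_of_add_eq_zero_left h]
      refine Ideal.neg_mem_iff _ |>.2 (Ideal.sum_mem _ fun i hi => ?_)
      refine Ideal.mul_mem_left _ _ (Ideal.pow_mem_of_mem _ (Ideal.mem_map_of_mem _ hg) _ ?_)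
      have := Finset.mem_range.1 hi
      omega
    rw [← Ideal.Quotient.eq_zero_iff_mem] at h2 ⊢
    rw [map_pow] at h2
    exact eq_zero_of_pow_eq_zero h2
  rw [hI, hsz]
  clear hsz hzg hz
  induction hzp using Submodule.span_induction with
  | mem x hx =>
    obtain ⟨u, hu, rfl⟩ := hx
    rw [← map_mul]
    exact map_dvd _ (ht0 u hu)
  | zero => simp
  | add x y _ _ hx hy => rw [mul_add]; exact dvd_add hx hy
  | smul c x _ hx => rw [smul_eq_mul, mul_left_comm]; exact hx.mul_left c

end FlatDiv
end CTN

namespace CTN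
section generic

lemma gen_aux {A E F0 R0 F : Type*} [CommRing A] [IsDomain A] [CommRing E] [Algebra A E]
    [Field F0] [Algebra A F0] [IsFractionRing A F0] [CommRing R0]
    [Algebra E R0] [Algebra F0 R0] [Algebra A R0] [IsScalarTower A E R0] [IsScalarTower A F0 R0]
    [IsLocalization (Algebra.algebraMapSubmonoid E (nonZeroDivisors A)) R0]
    [Field F] [Algebra F0 F] [FiniteDimensional F0 F]
    [Module.Flat A E] [IsNoetherianRing E] [Nontrivial E] (hE : Nice E)
    (p : ℕ) [ExpChar A p]
    (H : ∀ e, ∀ f : A, f ≠ 0 → ∃ φ, QExt A E (p ^ e) φ ∧ φ f ≠ 0) : Nice (F ⊗[F0] R0) := by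
  have hle : Algebra.algebraMapSubmonoid E (nonZeroDivisors A) ≤ nonZeroDivisors E := by
    rintro _ ⟨a, ha, rfl⟩
    exact map_nzd_of_flat ha
  let Q := FractionRing E
  let _ : Algebra R0 Q := IsLocalization.localizationAlgebraOfSubmonoidLe R0 Q
    (Algebra.algebraMapSubmonoid E (nonZeroDivisors A)) (nonZeroDivisors E) hle
  have : IsScalarTower E R0 Q := IsLocalization.localization_isScalarTower_of_submonoid_le R0 Q
    (Algebra.algebraMapSubmonoid E (nonZeroDivisors A)) (nonZeroDivisors E) hle
  have : IsFractionRing R0 Q := IsFractionRing.isFractionRing_of_isLocalization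
    (Algebra.algebraMapSubmonoid E (nonZeroDivisors A)) R0 Q hle
  let _ : Algebra F0 Q := ((algebraMap R0 Q).comp (algebraMap F0 R0)).toAlgebra
  have : IsScalarTower F0 R0 Q := IsScalarTower.of_algebraMap_eq fun _ => rfl
  have : IsReduced E := hE.1
  have hR : Nice R0 := hE.localization _ hle R0
  have : IsNoetherianRing R0 := IsLocalization.isNoetherianRing
    (Algebra.algebraMapSubmonoid E (nonZeroDivisors A)) _ inferInstance
  have : Nontrivial R0 := (IsLocalization.injective R0 hle).nontrivial
  have : ExpChar F0 p := expChar_of_injective_algebraMap (IsFractionRing.injective A F0) p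
  exact nice_fin (Q := Q) hR p fun e => hq_of_qext (E := E) p e (H e) (icl_of_nice hR)

lemma gen_nice {S E1 F0 F : Type*} [CommRing S] [IsDomain S] [CommRing E1] [Algebra S E1]
    [Field F0] [Algebra S F0] [IsFractionRing S F0]
    [Field F] [Algebra S F] [Algebra F0 F] [IsScalarTower S F0 F] [FiniteDimensional F0 F]
    [Module.Flat S E1] [IsNoetherianRing E1] [Nontrivial E1] (hE : Nice E1)
    (p : ℕ) [ExpChar S p]
    (H : ∀ e, ∀ f : S, f ≠ 0 → ∃ φ, QExt S E1 (p ^ e) φ ∧ φ f ≠ 0) : Nice (F ⊗[S] E1) := by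
  let _ := Algebra.TensorProduct.rightAlgebra (R := S) (A := F0) (B := E1)
  have := baseLoc (F0 := F0) (T := E1) (nonZeroDivisors S)
  have h := gen_aux (R0 := F0 ⊗[S] E1) (F := F) (F0 := F0) hE p H
  exact h.of_equiv (Algebra.TensorProduct.cancelBaseChange S F0 F0 F E1).toRingEquiv

lemma gen_conc {S E1 D F : Type*} [CommRing S] [IsDomain S] [CommRing E1] [Algebra S E1]
    [CommRing D] [Algebra S D] [Field F] [Algebra S F] [Algebra D F] [IsScalarTower S D F]
    (hinj : Function.Injective (algebraMap D F)) (hSF : Function.Injective (algebraMap S F))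
    (hden : ∀ z : F, ∃ s : S, s ≠ 0 ∧ ∃ d : D, s • z = algebraMap D F d)
    [Module.Flat S E1] (hF : Nice (F ⊗[S] E1)) :
    IsReduced (D ⊗[S] E1) ∧ ∀ u v : D ⊗[S] E1, v ∈ nonZeroDivisors (D ⊗[S] E1) → HomInt u v →
      ∃ s : S, s ≠ 0 ∧ v ∣ s • u := by
  let j : D ⊗[S] E1 →ₐ[S] F ⊗[S] E1 :=
    Algebra.TensorProduct.map (IsScalarTower.toAlgHom S D F) (AlgHom.id S E1)
  have hj : Function.Injective j := by
    have : Function.Injective (LinearMap.rTensor E1 (IsScalarTower.toAlgHom S D F).toLinearMap) :=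
      Module.Flat.rTensor_preserves_injective_linearMap _ hinj
    exact this
  have hd : ∀ z : F ⊗[S] E1, ∃ s : S, s ≠ 0 ∧ ∃ d, s • z = j d := by
    intro z
    induction z with
    | zero => exact ⟨1, one_ne_zero, 0, by simp⟩
    | add x y hx hy =>
      obtain ⟨s, hs, a, ha⟩ := hx
      obtain ⟨t, ht, b, hb⟩ := hy
      refine ⟨s * t, mul_ne_zero hs ht, t • a + s • b, ?_⟩
      rw [map_add, map_smul, map_smul, ← ha, ← hb, smul_add, smul_smul, smul_smul, mul_comm s t]
    | tmul a b =>
      obtain ⟨s, hs, d, hd⟩ := hden a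
      refine ⟨s, hs, d ⊗ₜ b, ?_⟩
      rw [TensorProduct.smul_tmul', hd]
      simp [j]
  have := hF.1
  refine ⟨isReduced_of_injective j hj, fun u v hv huv => ?_⟩
  have hjv : j v ∈ nonZeroDivisors (F ⊗[S] E1) := by
    rw [mem_nonZeroDivisors_iff_right] at hv ⊢
    intro z hz
    obtain ⟨s, hs, d, hd'⟩ := hd z
    have : d * v = 0 := hj (by rw [map_mul, ← hd', smul_mul_assoc, hz, smul_zero, map_zero])
    have h2 := hv d this
    rw [h2, map_zero] at hd'
    have hs' : algebraMap S F s ≠ 0 := by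
      rw [Ne, ← map_zero (algebraMap S F)]; exact fun h => hs (hSF h)
    have : (algebraMap S F s)⁻¹ • (s • z) = z := by
      rw [← algebraMap_smul F s z, smul_smul, inv_mul_cancel₀ hs', one_smul]
    rw [← this, hd', smul_zero]
  have h2 : HomInt (j u) (j v) := huv.map j.toRingHom
  obtain ⟨z, hz⟩ := hF.2 _ _ hjv h2
  obtain ⟨s, hs, w, hw⟩ := hd z
  refine ⟨s, hs, w, hj ?_⟩
  rw [map_smul, map_mul, ← hw, hz, mul_smul_comm]

lemma gen {S E1 D : Type*} [CommRing S] [IsDomain S] [CommRing E1] [Algebra S E1]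
    [CommRing D] [IsDomain D] [Algebra S D] [Module.Finite S D]
    (hSD : Function.Injective (algebraMap S D))
    [Module.Flat S E1] [IsNoetherianRing E1] [Nontrivial E1] (hE : Nice E1)
    (p : ℕ) [ExpChar S p]
    (H : ∀ e, ∀ f : S, f ≠ 0 → ∃ φ, QExt S E1 (p ^ e) φ ∧ φ f ≠ 0) :
    IsReduced (D ⊗[S] E1) ∧ ∀ u v : D ⊗[S] E1, v ∈ nonZeroDivisors (D ⊗[S] E1) → HomInt u v →
      ∃ s : S, s ≠ 0 ∧ v ∣ s • u := by
  have hf : FaithfulSMul S D := (faithfulSMul_iff_algebraMap_injective S D).2 hSD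
  have hDF := IsFractionRing.injective D (FractionRing D)
  have hSF : Function.Injective (algebraMap S (FractionRing D)) := by
    rw [IsScalarTower.algebraMap_eq S D (FractionRing D)]
    exact hDF.comp hSD
  have : FaithfulSMul S (FractionRing D) := (faithfulSMul_iff_algebraMap_injective _ _).2 hSF
  let _ : Algebra (FractionRing S) (FractionRing D) := FractionRing.liftAlgebra S (FractionRing D)
  have : IsScalarTower S (FractionRing S) (FractionRing D) :=
    FractionRing.isScalarTower_liftAlgebra S (FractionRing D)
  have hl : IsLocalization (Algebra.algebraMapSubmonoid D (nonZeroDivisors S)) (FractionRing D) :=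
    inferInstance
  have : FiniteDimensional (FractionRing S) (FractionRing D) :=
    Module.Finite.of_isLocalization S D (nonZeroDivisors S)
  refine gen_conc (F := FractionRing D) hDF hSF (fun z => ?_)
    (gen_nice (F0 := FractionRing S) hE p H)
  obtain ⟨⟨d, t⟩, ht⟩ := IsLocalization.surj
    (Algebra.algebraMapSubmonoid D (nonZeroDivisors S)) z
  obtain ⟨s, hs, hs2⟩ := t.2
  refine ⟨s, nonZeroDivisors.ne_zero hs, d, ?_⟩
  rw [← ht, ← hs2, Algebra.smul_def, mul_comm]
  rfl

lemma HomInt.cancel {R : Type*} [CommRing R] {u v t : R} (h : HomInt (t * u) (t * v))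
    (ht : t ∈ nonZeroDivisors R) : HomInt u v := by
  obtain ⟨n, c, h⟩ := h
  refine ⟨n, c, ?_⟩
  have h1 : t ^ n * (u ^ n + ∑ i ∈ Finset.range n, c i * u ^ i * v ^ (n - i)) = 0 := by
    rw [← h, mul_add, Finset.mul_sum, mul_pow]
    congr 1
    refine Finset.sum_congr rfl fun i hi => ?_
    have : t ^ n = t ^ i * t ^ (n - i) := by
      rw [← pow_add, Nat.add_sub_cancel' (Finset.mem_range.1 hi).le]
    rw [mul_pow, mul_pow, this]
    ring
  have h2 := pow_mem ht n
  rw [mem_nonZeroDivisors_iff] at h2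
  exact h2.1 _ h1

/-- From generic normality to normality, using reducedness of the fibres. -/
lemma nice_of_gen {S E1 D : Type*} [CommRing S] [IsDomain S] [CommRing E1] [Algebra S E1]
    [CommRing D] [IsDomain D] [Algebra S D] [Module.Finite S D]
    (hSD : Function.Injective (algebraMap S D))
    [Module.Flat S E1] [IsNoetherianRing E1] [Nontrivial E1] (hE : Nice E1)
    (p : ℕ) [ExpChar S p]
    (H : ∀ e, ∀ f : S, f ≠ 0 → ∃ φ, QExt S E1 (p ^ e) φ ∧ φ f ≠ 0)
    [IsNoetherianRing D] [IsIntegrallyClosed D]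
    (hred : ∀ P : Ideal D, P.IsPrime →
      IsReduced ((D ⊗[S] E1) ⧸ P.map (algebraMap D (D ⊗[S] E1)))) : Nice (D ⊗[S] E1) := by
  obtain ⟨h1, h2⟩ := gen (D := D) hSD hE p H
  refine ⟨h1, fun u v hv huv => ?_⟩
  obtain ⟨s, hs, w, hw⟩ := h2 u v hv huv
  have e1 : ∀ x : D ⊗[S] E1, s • x = algebraMap D (D ⊗[S] E1) (algebraMap S D s) * x := by
    intro x
    rw [← IsScalarTower.algebraMap_apply, Algebra.smul_def]
  rw [e1] at hw
  have hsD : algebraMap S D s ≠ 0 := by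
    rw [Ne, ← map_zero (algebraMap S D)]; exact fun h => hs (hSD h)
  set a := algebraMap S D s
  set b := algebraMap D (D ⊗[S] E1) a with hb
  have h3 : HomInt (v * w) (v * b) := by
    rw [← hw, mul_comm v b]
    exact huv.mul_both b
  have h4 : HomInt w b := h3.cancel hv
  obtain ⟨w', hw'⟩ := flat_div hred a hsD w h4
  have hbn : b ∈ nonZeroDivisors (D ⊗[S] E1) :=
    map_nzd_of_flat (mem_nonZeroDivisors_of_ne_zero hsD)
  refine ⟨w', ?_⟩
  rw [← hb] at hw'
  rw [hw'] at hw
  rw [mem_nonZeroDivisors_iff] at hbn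
  refine sub_eq_zero.1 (hbn.1 _ ?_)
  rw [mul_sub, hw]; ring

end generic
end CTN

namespace CTN
section Cpl

/-- `φ` presents `E` modulo powers of `I E` as `C` modulo powers of `I`. -/
structure PreCpl {C E : Type*} [CommRing C] [CommRing E] (I : Ideal C) (φ : C →+* E) : Prop where
  psi : ∀ n, ∃ ψ : E →+* C ⧸ I ^ n, ψ.comp φ = Ideal.Quotient.mk (I ^ n)
  surj : ∀ e, ∃ c, e - φ c ∈ I.map φ

/-- `φ` presents `E` as the completion of `C`. -/
structure IsCpl {C E : Type*} [CommRing C] [CommRing E] (I : Ideal C) (φ : C →+* E) : Prop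
    extends PreCpl I φ where
  complete : IsAdicComplete (I.map φ) E

lemma PreCpl.surj_pow {C E : Type*} [CommRing C] [CommRing E] {I : Ideal C} {φ : C →+* E}
    (h : PreCpl I φ) (n : ℕ) (e : E) : ∃ c, e - φ c ∈ I.map φ ^ n := by
  induction n generalizing e with
  | zero => exact ⟨0, by simp⟩
  | succ n ih =>
    have key : ∀ y ∈ I.map φ ^ n, ∃ c ∈ I ^ n, y - φ c ∈ I.map φ ^ (n + 1) := by
      intro y hy
      rw [← Ideal.map_pow] at hy
      refine Submodule.span_induction ?_ ?_ ?_ ?_ hy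
      · rintro _ ⟨c, hc, rfl⟩
        exact ⟨c, hc, by simp⟩
      · exact ⟨0, zero_mem _, by simp⟩
      · rintro x y _ _ ⟨c, hc1, hc⟩ ⟨d, hd1, hd⟩
        refine ⟨c + d, add_mem hc1 hd1, ?_⟩
        rw [map_add, add_sub_add_comm]
        exact add_mem hc hd
      · rintro a x _ ⟨c, hc1, hc⟩
        obtain ⟨d, hd⟩ := h.surj a
        refine ⟨d * c, Ideal.mul_mem_left _ _ hc1, ?_⟩
        have h1 : (a - φ d) * φ c ∈ I.map φ ^ (n + 1) := by
          rw [pow_succ']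
          refine Ideal.mul_mem_mul hd ?_
          rw [← Ideal.map_pow]; exact Ideal.mem_map_of_mem _ hc1
        have := add_mem (Ideal.mul_mem_left _ a hc) h1
        rw [smul_eq_mul, map_mul]
        convert this using 1
        ring
    obtain ⟨c, hc⟩ := ih e
    obtain ⟨d, -, hd⟩ := key _ hc
    exact ⟨c + d, by rwa [map_add, ← sub_sub]⟩

lemma PreCpl.psi_kill {C E : Type*} [CommRing C] [CommRing E] {I : Ideal C} {φ : C →+* E}
    {n : ℕ} {ψ : E →+* C ⧸ I ^ n} (hψ : ψ.comp φ = Ideal.Quotient.mk (I ^ n)) :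
    I.map φ ^ n ≤ RingHom.ker ψ := by
  rw [← Ideal.map_pow, Ideal.map_le_iff_le_comap]
  intro c hc
  rw [Ideal.mem_comap, RingHom.mem_ker, ← RingHom.comp_apply, hψ]
  exact Ideal.Quotient.eq_zero_iff_mem.2 hc

lemma PreCpl.psi_ker {C E : Type*} [CommRing C] [CommRing E] {I : Ideal C} {φ : C →+* E}
    (h : PreCpl I φ) {n : ℕ} {ψ : E →+* C ⧸ I ^ n} (hψ : ψ.comp φ = Ideal.Quotient.mk (I ^ n)) :
    RingHom.ker ψ = I.map φ ^ n := by
  refine le_antisymm ?_ (psi_kill hψ)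
  intro e he
  obtain ⟨c, hc⟩ := h.surj_pow n e
  have h1 : ψ (e - φ c) = 0 := psi_kill hψ hc
  rw [map_sub, (he : ψ e = 0), zero_sub, neg_eq_zero, ← RingHom.comp_apply, hψ,
    Ideal.Quotient.eq_zero_iff_mem] at h1
  have := add_mem hc (show φ c ∈ I.map φ ^ n by
    rw [← Ideal.map_pow]; exact Ideal.mem_map_of_mem _ h1)
  rwa [sub_add_cancel] at this

lemma PreCpl.psi_compat {C E : Type*} [CommRing C] [CommRing E] {I : Ideal C} {φ : C →+* E}
    (h : PreCpl I φ) {m n : ℕ} (hmn : m ≤ n)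
    {ψ : E →+* C ⧸ I ^ n} (hψ : ψ.comp φ = Ideal.Quotient.mk (I ^ n))
    {ψ' : E →+* C ⧸ I ^ m} (hψ' : ψ'.comp φ = Ideal.Quotient.mk (I ^ m)) :
    (Ideal.Quotient.factorPow I hmn).comp ψ = ψ' := by
  refine RingHom.ext fun e => ?_
  obtain ⟨c, hc⟩ := h.surj_pow n e
  have h1 : ψ (e - φ c) = 0 := psi_kill hψ hc
  have h2 : ψ' (e - φ c) = 0 := psi_kill hψ' (Ideal.pow_le_pow_right hmn hc)
  rw [map_sub, sub_eq_zero, ← RingHom.comp_apply, hψ] at h1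
  rw [map_sub, sub_eq_zero, ← RingHom.comp_apply, hψ'] at h2
  rw [RingHom.comp_apply, h1, h2]
  rfl

lemma IsCpl.equiv {C E : Type*} [CommRing C] [CommRing E] {I : Ideal C} {φ : C →+* E}
    (h : IsCpl I φ) : Nonempty (E ≃+* AdicCompletion I C) := by
  choose ψ hψ using h.psi
  have hf : ∀ {m n : ℕ} (hle : m ≤ n), (Ideal.Quotient.factorPow I hle).comp (ψ n) = ψ m :=
    fun hle => h.psi_compat hle (hψ _) (hψ _)
  have hk := fun n => h.psi_ker (hψ n)
  have := h.complete
  refine ⟨RingEquiv.ofBijective (AdicCompletion.liftRingHom I ψ hf) ⟨?_, ?_⟩⟩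
  · rw [injective_iff_map_eq_zero]
    intro e he
    refine IsHausdorff.haus (I := I.map φ) inferInstance _ fun n => ?_
    rw [SModEq.zero, smul_eq_mul, Ideal.mul_top, ← hk n, RingHom.mem_ker,
      ← AdicCompletion.evalₐ_liftRingHom I ψ hf, he, map_zero]
  · intro x
    have hs : ∀ n, ∃ e, ψ n e = AdicCompletion.evalₐ I n x := by
      intro n
      obtain ⟨c, hc⟩ := Ideal.Quotient.mk_surjective (AdicCompletion.evalₐ I n x)
      exact ⟨φ c, by rw [← RingHom.comp_apply, hψ, hc]⟩
    choose e he using hs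
    obtain ⟨L, hL⟩ := IsPrecomplete.prec (I := I.map φ) (M := E) inferInstance (f := e) (by
      intro m n hmn
      rw [SModEq.sub_mem, smul_eq_mul, Ideal.mul_top, ← hk m, RingHom.mem_ker, map_sub, he,
        ← hf hmn, RingHom.comp_apply, he]
      rw [sub_eq_zero]
      obtain ⟨y, rfl⟩ := AdicCompletion.mk_surjective I C x
      rw [AdicCompletion.evalₐ_mk, AdicCompletion.evalₐ_mk]
      have h3 := y.2 hmn
      rw [SModEq.sub_mem, smul_eq_mul, Ideal.mul_top] at h3
      exact Ideal.Quotient.eq.2 h3)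
    refine ⟨L, AdicCompletion.ext_evalₐ fun n => ?_⟩
    rw [AdicCompletion.evalₐ_liftRingHom, ← he n]
    have := hL n
    rw [SModEq.sub_mem, smul_eq_mul, Ideal.mul_top, ← hk n, RingHom.mem_ker, map_sub,
      sub_eq_zero] at this
    exact this.symm

lemma IsCpl.unique {C E E' : Type*} [CommRing C] [CommRing E] [CommRing E'] {I : Ideal C}
    {φ : C →+* E} (h : IsCpl I φ) {φ' : C →+* E'} (h' : IsCpl I φ') : Nonempty (E ≃+* E') := by
  obtain ⟨e⟩ := h.equiv
  obtain ⟨e'⟩ := h'.equiv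
  exact ⟨e.trans e'.symm⟩

lemma isAdicComplete_cofinal {E : Type*} [CommRing E] {I J : Ideal E} [IsAdicComplete I E]
    (hIJ : I ≤ J) (k : ℕ) (hk : J ^ (k + 1) ≤ I) : IsAdicComplete J E where
  haus' := by
    intro x hx
    refine IsHausdorff.haus (I := I) inferInstance _ fun n => ?_
    have := hx ((k + 1) * n)
    rw [SModEq.zero, smul_eq_mul, Ideal.mul_top] at this ⊢
    rw [pow_mul] at this
    exact Ideal.pow_right_mono hk n this
  prec' := by
    intro f hf
    obtain ⟨L, hL⟩ := IsPrecomplete.prec (I := I) (M := E) inferInstance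
      (f := fun n => f ((k + 1) * n)) (by
      intro m n hmn
      have := hf (Nat.mul_le_mul_left (k + 1) hmn)
      rw [SModEq.sub_mem, smul_eq_mul, Ideal.mul_top] at this ⊢
      rw [pow_mul] at this
      exact Ideal.pow_right_mono hk m this)
    refine ⟨L, fun n => ?_⟩
    have h1 := hL n
    have h2 := hf (show n ≤ (k + 1) * n by nlinarith)
    rw [SModEq.sub_mem, smul_eq_mul, Ideal.mul_top] at h1 h2 ⊢
    have := add_mem h2 (Ideal.pow_right_mono hIJ n h1)
    rwa [sub_add_sub_cancel] at this

lemma PreCpl.mono {C E : Type*} [CommRing C] [CommRing E] {I J : Ideal C} {φ : C →+* E}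
    (h : PreCpl I φ) (hIJ : I ≤ J) : PreCpl J φ where
  psi n := by
    obtain ⟨ψ, hψ⟩ := h.psi n
    exact ⟨(Ideal.Quotient.factor (Ideal.pow_right_mono hIJ n)).comp ψ, by
      rw [RingHom.comp_assoc, hψ]; rfl⟩
  surj e := by
    obtain ⟨c, hc⟩ := h.surj e
    exact ⟨c, Ideal.map_mono hIJ hc⟩

lemma IsCpl.cofinal {C E : Type*} [CommRing C] [CommRing E] {I J : Ideal C} {φ : C →+* E}
    (h : IsCpl I φ) (hIJ : I ≤ J) (k : ℕ) (hk : J ^ (k + 1) ≤ I) : IsCpl J φ where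
  toPreCpl := h.toPreCpl.mono hIJ
  complete := by
    have := h.complete
    exact isAdicComplete_cofinal (Ideal.map_mono hIJ) k (by
      rw [← Ideal.map_pow]; exact Ideal.map_mono hk)

lemma IsCpl.trans {C1 C2 E : Type*} [CommRing C1] [CommRing C2] [CommRing E] {I1 : Ideal C1}
    {φ1 : C1 →+* C2} (h1 : PreCpl I1 φ1) {φ2 : C2 →+* E} (h2 : IsCpl (I1.map φ1) φ2) :
    IsCpl I1 (φ2.comp φ1) where
  psi n := by
    obtain ⟨ψ1, hψ1⟩ := h1.psi n
    obtain ⟨ψ2, hψ2⟩ := h2.psi n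
    refine ⟨(Ideal.Quotient.lift _ ψ1 fun a ha => PreCpl.psi_kill hψ1 ha).comp ψ2, ?_⟩
    rw [RingHom.comp_assoc, ← RingHom.comp_assoc φ1, hψ2, ← RingHom.comp_assoc, ← hψ1]
    rfl
  surj e := by
    obtain ⟨c2, hc2⟩ := h2.surj e
    obtain ⟨c1, hc1⟩ := h1.surj c2
    refine ⟨c1, ?_⟩
    rw [← Ideal.map_map]
    have := add_mem hc2 (Ideal.mem_map_of_mem φ2 hc1)
    rwa [map_sub, sub_add_sub_cancel] at this
  complete := by
    rw [← Ideal.map_map]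
    exact h2.complete

lemma PreCpl.precomp {C0 C E : Type*} [CommRing C0] [CommRing C] [CommRing E] {I : Ideal C0}
    (f : C0 ≃+* C) : PreCpl I (f : C0 →+* C) where
  psi n := ⟨(Ideal.Quotient.mk _).comp (f.symm : C →+* C0), by
    refine RingHom.ext fun x => ?_
    simp⟩
  surj e := ⟨f.symm e, by simp⟩

end Cpl
end CTN

namespace CTN
section LemmaG
open MvPowerSeries

lemma isAdicComplete_finite {R M : Type*} [CommRing R] [IsNoetherianRing R] [AddCommGroup M]
    [Module R M] [Module.Finite R M] (I : Ideal R) [IsAdicComplete I R] : IsAdicComplete I M where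
  toIsHausdorff := IsHausdorff.of_le_jacobson I M (IsAdicComplete.le_jacobson_bot I)
  toIsPrecomplete := by
    rw [← AdicCompletion.of_surjective_iff]
    intro y
    obtain ⟨z, rfl⟩ := AdicCompletion.ofTensorProduct_surjective_of_finite I M y
    induction z with
    | zero => exact ⟨0, by simp⟩
    | add a b ha hb =>
      obtain ⟨x, hx⟩ := ha
      obtain ⟨y, hy⟩ := hb
      exact ⟨x + y, by rw [map_add, map_add, hx, hy]⟩
    | tmul r m =>
      obtain ⟨s, rfl⟩ := AdicCompletion.of_surjective I R r
      refine ⟨s • m, ?_⟩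
      rw [AdicCompletion.ofTensorProduct_tmul, map_smul]
      refine AdicCompletion.ext fun n => ?_
      rfl

lemma isAdicComplete_algebra_finite {R E : Type*} [CommRing R] [IsNoetherianRing R] [CommRing E]
    [Algebra R E] [Module.Finite R E] (I : Ideal R) [IsAdicComplete I R] :
    IsAdicComplete (I.map (algebraMap R E)) E := by
  rw [IsAdicComplete.map_algebraMap_iff]
  exact isAdicComplete_finite I

lemma psHom_exists {σ R T : Type*} [Finite σ] [CommRing R] [CommRing T] (h : R →+* T) (t : σ → T)
    (n : ℕ) (hn : Ideal.span (Set.range t) ^ n = ⊥) :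
    ∃ g : MvPowerSeries σ R →+* T, g.comp C = h ∧ ∀ i, g (X i) = t i := by
  have hk : ∀ a ∈ MvPolynomial.idealOfVars σ R ^ n, MvPolynomial.eval₂Hom h t a = 0 := by
    intro a ha
    have h1 : (MvPolynomial.idealOfVars σ R).map (MvPolynomial.eval₂Hom h t) ≤
        Ideal.span (Set.range t) := by
      rw [MvPolynomial.idealOfVars, Ideal.map_span, Ideal.span_le]
      rintro _ ⟨_, ⟨i, rfl⟩, rfl⟩
      refine Ideal.subset_span ⟨i, ?_⟩
      simp
    have h2 := Ideal.mem_map_of_mem (MvPolynomial.eval₂Hom h t) ha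
    rw [Ideal.map_pow] at h2
    have h3 := Ideal.pow_right_mono h1 n h2
    rwa [hn, Ideal.mem_bot] at h3
  refine ⟨(Ideal.Quotient.lift _ (MvPolynomial.eval₂Hom h t) hk).comp
    (truncTotalAlgHom σ R n).toRingHom, ?_, ?_⟩
  · refine RingHom.ext fun r => ?_
    have : truncTotalAlgHom σ R n (C r) = Ideal.Quotient.mk _ (MvPolynomial.C r) := by
      rw [← MvPolynomial.coe_C]
      exact (truncTotalAlgHom σ R n).commutes (MvPolynomial.C r)
    change Ideal.Quotient.lift _ (MvPolynomial.eval₂Hom h t) hk (truncTotalAlgHom σ R n (C r)) = _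
    rw [this, Ideal.Quotient.lift_mk]
    simp
  · intro i
    have : truncTotalAlgHom σ R n (X i) = Ideal.Quotient.mk _ (MvPolynomial.X i) := by
      rw [← MvPolynomial.coe_X]
      exact (truncTotalAlgHom σ R n).commutes (MvPolynomial.X i)
    change Ideal.Quotient.lift _ (MvPolynomial.eval₂Hom h t) hk (truncTotalAlgHom σ R n (X i)) = _
    rw [this, Ideal.Quotient.lift_mk]
    simp

lemma psHom_ext_mod {σ R T : Type*} [Finite σ] [CommRing R] [CommRing T]
    {f g : MvPowerSeries σ R →+* T} (hC : ∀ r, f (C r) = g (C r)) (hX : ∀ i, f (X i) = g (X i))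
    (n : ℕ) (y : MvPowerSeries σ R) : f y - g y ∈ ((varI σ R).map g) ^ n := by
  have hp : ∀ p : MvPolynomial σ R, f p = g p := by
    intro p
    have : f.comp MvPolynomial.coeToMvPowerSeries.ringHom =
        g.comp MvPolynomial.coeToMvPowerSeries.ringHom := by
      refine MvPolynomial.ringHom_ext (fun r => ?_) fun i => ?_
      · simpa using hC r
      · simpa using hX i
    exact RingHom.congr_fun this p
  have hI : (varI σ R).map f = (varI σ R).map g := by
    rw [varI, Ideal.map_span, Ideal.map_span]
    congr 1
    ext z
    constructor
    · rintro ⟨_, ⟨i, rfl⟩, rfl⟩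
      exact ⟨_, ⟨i, rfl⟩, (hX i).symm⟩
    · rintro ⟨_, ⟨i, rfl⟩, rfl⟩
      exact ⟨_, ⟨i, rfl⟩, (hX i)⟩
  have hy : y - truncTotal n y ∈ varI σ R ^ n := by
    rw [mem_varI_pow_iff]
    intro m hm
    rw [map_sub, MvPolynomial.coeff_coe, coeff_truncTotal _ hm, sub_self]
  have h1 := Ideal.mem_map_of_mem f hy
  have h2 := Ideal.mem_map_of_mem g hy
  rw [Ideal.map_pow] at h1 h2
  rw [hI] at h1
  have := sub_mem h1 h2
  rw [map_sub, map_sub, hp] at this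
  simpa using this

lemma psHom_ext {σ R T : Type*} [Finite σ] [CommRing R] [CommRing T]
    {f g : MvPowerSeries σ R →+* T} (hC : ∀ r, f (C r) = g (C r)) (hX : ∀ i, f (X i) = g (X i))
    (n : ℕ) (hn : ((varI σ R).map g) ^ n = ⊥) : f = g := by
  refine RingHom.ext fun y => ?_
  have := psHom_ext_mod hC hX n y
  rwa [hn, Ideal.mem_bot, sub_eq_zero] at this

lemma alg_eq_map {σ K R : Type*} [CommRing K] [CommRing R] [Algebra K R] :
    algebraMap (MvPowerSeries σ K) (MvPowerSeries σ R) = map (algebraMap K R) := rfl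

/-- the map `D ⊗[K] R → D ⊗[K[[x]]] R[[x]]` -/
lemma phiG_exists {σ K R D : Type*} [CommRing K] [CommRing R] [Algebra K R] [CommRing D]
    [Algebra K D] [Algebra (MvPowerSeries σ K) D]
    (hKD : ∀ a : K, algebraMap (MvPowerSeries σ K) D (C a) = algebraMap K D a) :
    ∃ φ : D ⊗[K] R →+* D ⊗[MvPowerSeries σ K] MvPowerSeries σ R,
      ∀ d r, φ (d ⊗ₜ r) = d ⊗ₜ C r := by
  let _ : Algebra K (D ⊗[MvPowerSeries σ K] MvPowerSeries σ R) :=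
    ((algebraMap D (D ⊗[MvPowerSeries σ K] MvPowerSeries σ R)).comp (algebraMap K D)).toAlgebra
  let f : D →ₐ[K] D ⊗[MvPowerSeries σ K] MvPowerSeries σ R :=
    { algebraMap D (D ⊗[MvPowerSeries σ K] MvPowerSeries σ R) with commutes' := fun _ => rfl }
  let g : R →ₐ[K] D ⊗[MvPowerSeries σ K] MvPowerSeries σ R :=
    { ((Algebra.TensorProduct.includeRight (R := MvPowerSeries σ K) (A := D)
        (B := MvPowerSeries σ R)).toRingHom).comp C with
      commutes' := fun a => by
        have h1 : (C (algebraMap K R a) : MvPowerSeries σ R) =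
          algebraMap (MvPowerSeries σ K) (MvPowerSeries σ R) (C a) := by
          rw [alg_eq_map, map_C]
        have h2 : (1 : D) ⊗ₜ[MvPowerSeries σ K] (C (algebraMap K R a) : MvPowerSeries σ R) =
            (algebraMap K D a) ⊗ₜ 1 := by
          rw [h1, ← hKD, Algebra.algebraMap_eq_smul_one, Algebra.algebraMap_eq_smul_one,
            TensorProduct.smul_tmul]
        exact h2 }
  refine ⟨(Algebra.TensorProduct.productMap f g).toRingHom, fun d r => ?_⟩
  change Algebra.TensorProduct.productMap f g (d ⊗ₜ r) = _
  rw [Algebra.TensorProduct.productMap_apply_tmul]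
  change (d ⊗ₜ 1) * ((1 : D) ⊗ₜ[MvPowerSeries σ K] (C r : MvPowerSeries σ R)) = _
  rw [Algebra.TensorProduct.tmul_mul_tmul, mul_one, one_mul]

end LemmaG
end CTN

namespace CTN
section LemmaG2
open MvPowerSeries

/-- `I ⊗ B + A ⊗ J` -/
noncomputable def mixI {A B : Type*} (k : Type*) [CommRing k] [CommRing A] [CommRing B]
    [Algebra k A] [Algebra k B] (I : Ideal A) (J : Ideal B) : Ideal (A ⊗[k] B) :=
  I.map (algebraMap A (A ⊗[k] B)) ⊔
    J.map (Algebra.TensorProduct.includeRight (R := k) (A := A) (B := B)).toRingHom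

lemma mixI_left {k A B : Type*} [CommRing k] [CommRing A] [CommRing B]
    [Algebra k A] [Algebra k B] {I : Ideal A} {J : Ideal B} {a : A} (ha : a ∈ I) (b : B) :
    a ⊗ₜ b ∈ mixI k I J := by
  have : a ⊗ₜ[k] b = (1 ⊗ₜ b) * algebraMap A (A ⊗[k] B) a := by
    rw [Algebra.TensorProduct.algebraMap_apply, Algebra.TensorProduct.tmul_mul_tmul]
    simp
  rw [this]
  exact Ideal.mul_mem_left _ _ (Ideal.mem_sup_left (Ideal.mem_map_of_mem _ ha))

lemma mixI_right {k A B : Type*} [CommRing k] [CommRing A] [CommRing B]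
    [Algebra k A] [Algebra k B] {I : Ideal A} {J : Ideal B} {b : B} (hb : b ∈ J) (a : A) :
    a ⊗ₜ b ∈ mixI k I J := by
  have : a ⊗ₜ[k] b = (a ⊗ₜ 1) *
      (Algebra.TensorProduct.includeRight (R := k) (A := A) (B := B)).toRingHom b := by
    change _ = (a ⊗ₜ[k] 1) * (1 ⊗ₜ b)
    rw [Algebra.TensorProduct.tmul_mul_tmul]
    simp
  rw [this]
  exact Ideal.mul_mem_left _ _ (Ideal.mem_sup_right (Ideal.mem_map_of_mem _ hb))

lemma mixI_le {k A B : Type*} [CommRing k] [CommRing A] [CommRing B]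
    [Algebra k A] [Algebra k B] {I : Ideal A} {J : Ideal B} {T : Ideal (A ⊗[k] B)}
    (h1 : ∀ a ∈ I, a ⊗ₜ 1 ∈ T) (h2 : ∀ b ∈ J, 1 ⊗ₜ b ∈ T) : mixI k I J ≤ T := by
  refine sup_le ?_ ?_
  · rw [Ideal.map_le_iff_le_comap]
    exact fun a ha => h1 a ha
  · rw [Ideal.map_le_iff_le_comap]
    exact fun a ha => h2 a ha

lemma mixI_mono {k A B : Type*} [CommRing k] [CommRing A] [CommRing B]
    [Algebra k A] [Algebra k B] {I I' : Ideal A} {J J' : Ideal B} (h : I ≤ I') (h' : J ≤ J') :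
    mixI k I J ≤ mixI k I' J' :=
  mixI_le (fun _ ha => mixI_left (h ha) _) (fun _ hb => mixI_right (h' hb) _)

lemma sup_pow_le {R : Type*} [CommRing R] (P Q : Ideal R) (m : ℕ) :
    (P ⊔ Q) ^ (m + 1) ≤ P ^ (m + 1) ⊔ Q := by
  induction m with
  | zero => simp
  | succ m ih =>
    rw [pow_succ]
    refine (Ideal.mul_mono_left ih).trans ?_
    rw [Ideal.mul_sup, Ideal.sup_mul, ← pow_succ]
    have h1 : Q * P ≤ Q := Ideal.mul_le_left
    have h2 : (P ^ (m + 1) ⊔ Q) * Q ≤ Q := Ideal.mul_le_right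
    exact sup_le (sup_le le_sup_left (le_trans h1 le_sup_right)) (le_trans h2 le_sup_right)

lemma mixI_pow_le {k A B : Type*} [CommRing k] [CommRing A] [CommRing B]
    [Algebra k A] [Algebra k B] {I I' : Ideal A} {J : Ideal B} (n : ℕ) (h : I' ^ (n + 1) ≤ I) :
    mixI k I' J ^ (n + 1) ≤ mixI k I J := by
  rw [mixI, mixI]
  refine (sup_pow_le _ _ _).trans (sup_le_sup ?_ le_rfl)
  rw [← Ideal.map_pow]
  exact Ideal.map_mono h

lemma map_varI {σ R S : Type*} [CommRing R] [CommRing S] (f : R →+* S) :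
    (varI σ R).map (map f) = varI σ S := by
  rw [varI, varI, Ideal.map_span]
  congr 1
  ext z
  constructor
  · rintro ⟨_, ⟨i, rfl⟩, rfl⟩
    exact ⟨i, by rw [map_X]⟩
  · rintro ⟨i, rfl⟩
    exact ⟨_, ⟨i, rfl⟩, by rw [map_X]⟩

lemma complete_right {S M D : Type*} [CommRing S] [CommRing M] [CommRing D] [Algebra S M]
    [Algebra S D] [Module.Finite S D] [IsNoetherianRing M] (I : Ideal M) [IsAdicComplete I M] :
    IsAdicComplete (I.map (Algebra.TensorProduct.includeRight (R := S) (A := D)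
        (B := M)).toRingHom) (D ⊗[S] M) := by
  have h1 : IsAdicComplete (I.map (algebraMap M (M ⊗[S] D))) (M ⊗[S] D) :=
    isAdicComplete_algebra_finite _
  let e : (M ⊗[S] D) ≃+* (D ⊗[S] M) := (Algebra.TensorProduct.comm S M D).toRingEquiv
  rw [← IsAdicComplete.congr_ringEquiv _ e] at h1
  have h2 : Ideal.map e (I.map (algebraMap M (M ⊗[S] D))) =
      I.map (Algebra.TensorProduct.includeRight (R := S) (A := D) (B := M)).toRingHom := by
    have h3 := Ideal.map_map (I := I) (algebraMap M (M ⊗[S] D)) (e : M ⊗[S] D →+* D ⊗[S] M)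
    exact h3
  rwa [h2] at h1

section
variable {σ K R D : Type*} [Finite σ] [CommRing K] [CommRing R] [Algebra K R] [CommRing D]
    [Algebra K D] [Algebra (MvPowerSeries σ K) D]

lemma smul_swap (s : MvPowerSeries σ K) :
    (algebraMap (MvPowerSeries σ K) D s) ⊗ₜ[MvPowerSeries σ K] (1 : MvPowerSeries σ R) =
      1 ⊗ₜ (algebraMap (MvPowerSeries σ K) (MvPowerSeries σ R) s) := by
  rw [Algebra.algebraMap_eq_smul_one, Algebra.algebraMap_eq_smul_one, TensorProduct.smul_tmul]

lemma mapG_ideal (J : Ideal R) (φ : D ⊗[K] R →+* D ⊗[MvPowerSeries σ K] MvPowerSeries σ R)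
    (hφ : ∀ d r, φ (d ⊗ₜ r) = d ⊗ₜ C r) :
    (mixI K ((varI σ K).map (algebraMap (MvPowerSeries σ K) D)) J).map φ =
      (cI σ J).map (Algebra.TensorProduct.includeRight (R := MvPowerSeries σ K) (A := D)
        (B := MvPowerSeries σ R)).toRingHom := by
  rw [mixI, cI, Ideal.map_sup, Ideal.map_sup, Ideal.map_map, Ideal.map_map, Ideal.map_map,
    Ideal.map_map, sup_comm, ← map_varI (algebraMap K R), Ideal.map_map]
  congr 1
  · congr 1
    refine RingHom.ext fun r => ?_
    exact hφ 1 r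
  · congr 1
    refine RingHom.ext fun s => ?_
    change φ ((algebraMap (MvPowerSeries σ K) D s) ⊗ₜ 1) = _
    rw [hφ, map_one, smul_swap]
    rfl

lemma preCplG (J : Ideal R)
    (hKD : ∀ a : K, algebraMap (MvPowerSeries σ K) D (C a) = algebraMap K D a)
    (φ : D ⊗[K] R →+* D ⊗[MvPowerSeries σ K] MvPowerSeries σ R)
    (hφ : ∀ d r, φ (d ⊗ₜ r) = d ⊗ₜ C r) :
    PreCpl (mixI K ((varI σ K).map (algebraMap (MvPowerSeries σ K) D)) J) φ where
  psi n := by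
    set I0 := mixI K ((varI σ K).map (algebraMap (MvPowerSeries σ K) D)) J with hI0
    let q := Ideal.Quotient.mk (I0 ^ n)
    let hR : R →+* (D ⊗[K] R) ⧸ I0 ^ n := q.comp
      (Algebra.TensorProduct.includeRight (R := K) (A := D) (B := R)).toRingHom
    let hD : D →+* (D ⊗[K] R) ⧸ I0 ^ n := q.comp (algebraMap D (D ⊗[K] R))
    let t : σ → (D ⊗[K] R) ⧸ I0 ^ n := fun i => hD (algebraMap (MvPowerSeries σ K) D (X i))
    have hq : (I0.map q) ^ n = ⊥ := by
      rw [← Ideal.map_pow, Ideal.map_quotient_self]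
    have hv : (varI σ K).map (hD.comp (algebraMap (MvPowerSeries σ K) D)) ≤ I0.map q := by
      rw [← Ideal.map_map, ← Ideal.map_map]
      exact Ideal.map_mono le_sup_left
    have hv' : ((varI σ K).map (hD.comp (algebraMap (MvPowerSeries σ K) D))) ^ n = ⊥ := by
      rw [eq_bot_iff, ← hq]
      exact Ideal.pow_right_mono hv n
    have ht : Ideal.span (Set.range t) ^ n = ⊥ := by
      rw [eq_bot_iff, ← hv']
      refine Ideal.pow_right_mono ?_ n
      rw [Ideal.span_le]
      rintro _ ⟨i, rfl⟩
      exact Ideal.mem_map_of_mem (hD.comp (algebraMap (MvPowerSeries σ K) D)) (X_mem_varI i)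
    obtain ⟨g, hg1, hg2⟩ := psHom_exists hR t n ht
    have hcomp : g.comp (algebraMap (MvPowerSeries σ K) (MvPowerSeries σ R)) =
        hD.comp (algebraMap (MvPowerSeries σ K) D) := by
      refine psHom_ext (fun a => ?_) (fun i => ?_) n hv'
      · rw [RingHom.comp_apply, RingHom.comp_apply, alg_eq_map, map_C, hKD,
          ← RingHom.comp_apply, hg1]
        change q (1 ⊗ₜ algebraMap K R a) = q (algebraMap K D a ⊗ₜ 1)
        rw [Algebra.algebraMap_eq_smul_one, Algebra.algebraMap_eq_smul_one,
          TensorProduct.smul_tmul]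
      · rw [RingHom.comp_apply, RingHom.comp_apply, alg_eq_map, map_X, hg2]
    let _ : Algebra (MvPowerSeries σ K) ((D ⊗[K] R) ⧸ I0 ^ n) :=
      (hD.comp (algebraMap (MvPowerSeries σ K) D)).toAlgebra
    let f' : D →ₐ[MvPowerSeries σ K] (D ⊗[K] R) ⧸ I0 ^ n := { hD with commutes' := fun _ => rfl }
    let g' : MvPowerSeries σ R →ₐ[MvPowerSeries σ K] (D ⊗[K] R) ⧸ I0 ^ n :=
      { g with commutes' := fun s => RingHom.congr_fun hcomp s }
    refine ⟨(Algebra.TensorProduct.productMap f' g').toRingHom, ?_⟩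
    refine RingHom.ext fun z => ?_
    induction z with
    | zero => simp
    | add x y hx hy => rw [map_add, map_add, hx, hy]
    | tmul d r =>
      rw [RingHom.comp_apply, hφ]
      change Algebra.TensorProduct.productMap f' g' (d ⊗ₜ C r) = _
      rw [Algebra.TensorProduct.productMap_apply_tmul]
      change hD d * g (C r) = _
      rw [← RingHom.comp_apply, hg1]
      change q (d ⊗ₜ 1) * q (1 ⊗ₜ r) = q _
      rw [← map_mul, Algebra.TensorProduct.tmul_mul_tmul, mul_one, one_mul]
  surj e := by
    rw [mapG_ideal J φ hφ]
    induction e with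
    | zero => exact ⟨0, by simp⟩
    | add x y hx hy =>
      obtain ⟨a, ha⟩ := hx
      obtain ⟨b, hb⟩ := hy
      exact ⟨a + b, by rw [map_add, add_sub_add_comm]; exact add_mem ha hb⟩
    | tmul d f =>
      refine ⟨d ⊗ₜ constantCoeff f, ?_⟩
      rw [hφ, ← TensorProduct.tmul_sub]
      have h1 : f - C (constantCoeff f) ∈ cI σ J := by
        refine Ideal.mem_sup_right ?_
        have := (mem_varI_pow_iff 1 (f - C (constantCoeff f))).2 ?_
        · rwa [pow_one] at this
        · intro m hm
          have hm0 : m = 0 := by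
            rw [← Finsupp.degree_eq_zero_iff]; omega
          rw [hm0]; simp
      have h2 : d ⊗ₜ[MvPowerSeries σ K] (f - C (constantCoeff f)) = (d ⊗ₜ 1) *
        (Algebra.TensorProduct.includeRight (R := MvPowerSeries σ K) (A := D)
        (B := MvPowerSeries σ R)).toRingHom (f - C (constantCoeff f)) := by
        change _ = (d ⊗ₜ 1) * ((1 : D) ⊗ₜ[MvPowerSeries σ K] (f - C (constantCoeff f)))
        rw [Algebra.TensorProduct.tmul_mul_tmul, mul_one, one_mul]
      rw [h2]
      exact Ideal.mul_mem_left _ _ (Ideal.mem_map_of_mem _ h1)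

lemma isCplG [IsNoetherianRing R] (J : Ideal R) [IsAdicComplete J R]
    [Module.Finite (MvPowerSeries σ K) D]
    (hKD : ∀ a : K, algebraMap (MvPowerSeries σ K) D (C a) = algebraMap K D a)
    (φ : D ⊗[K] R →+* D ⊗[MvPowerSeries σ K] MvPowerSeries σ R)
    (hφ : ∀ d r, φ (d ⊗ₜ r) = d ⊗ₜ C r) :
    IsCpl (mixI K ((varI σ K).map (algebraMap (MvPowerSeries σ K) D)) J) φ where
  toPreCpl := preCplG J hKD φ hφ
  complete := by
    rw [mapG_ideal J φ hφ]
    have := isAdicComplete_cI (σ := σ) J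
    exact complete_right _

end

end LemmaG2
end CTN

namespace CTN
section Cohen
open MvPowerSeries

lemma evalHom_exists {σ R D : Type*} [Finite σ] [CommRing R] [CommRing D] (I : Ideal D)
    [IsAdicComplete I D] (h : R →+* D) (t : σ → D) (ht : ∀ i, t i ∈ I) :
    ∃ f : MvPowerSeries σ R →+* D, (∀ r, f (C r) = h r) ∧ ∀ i, f (X i) = t i := by
  have hex : ∀ n, ∃ g : MvPowerSeries σ R →+* D ⧸ I ^ n,
      g.comp C = (Ideal.Quotient.mk (I ^ n)).comp h ∧
        ∀ i, g (X i) = Ideal.Quotient.mk (I ^ n) (t i) := by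
    intro n
    refine psHom_exists _ _ n ?_
    have h1 : Ideal.span (Set.range fun i => Ideal.Quotient.mk (I ^ n) (t i)) ≤
        I.map (Ideal.Quotient.mk (I ^ n)) := by
      rw [Ideal.span_le]
      rintro _ ⟨i, rfl⟩
      exact Ideal.mem_map_of_mem _ (ht i)
    have h2 := Ideal.pow_right_mono h1 n
    rw [← Ideal.map_pow, Ideal.map_quotient_self] at h2
    exact le_bot_iff.mp h2
  choose g hg1 hg2 using hex
  have hc : ∀ {m n : ℕ} (hle : m ≤ n), (Ideal.Quotient.factorPow I hle).comp (g n) = g m := by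
    intro m n hle
    refine psHom_ext (fun r => ?_) (fun i => ?_) m ?_
    · have a1 : g n (C r) = Ideal.Quotient.mk (I ^ n) (h r) := DFunLike.congr_fun (hg1 n) r
      have a2 : g m (C r) = Ideal.Quotient.mk (I ^ m) (h r) := DFunLike.congr_fun (hg1 m) r
      rw [RingHom.comp_apply, a1, a2]
      rfl
    · rw [RingHom.comp_apply, hg2, hg2]
      rfl
    · have h1 : (varI σ R).map (g m) ≤ I.map (Ideal.Quotient.mk (I ^ m)) := by
        rw [varI, Ideal.map_span, Ideal.span_le]
        rintro _ ⟨_, ⟨i, rfl⟩, rfl⟩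
        rw [hg2]
        exact Ideal.mem_map_of_mem _ (ht i)
      have h2 := Ideal.pow_right_mono h1 m
      rw [← Ideal.map_pow (I := I), Ideal.map_quotient_self] at h2
      exact le_bot_iff.mp h2
  have key : ∀ x y : D, (∀ n, Ideal.Quotient.mk (I ^ n) x = Ideal.Quotient.mk (I ^ n) y) → x = y := by
    intro x y hxy
    rw [← sub_eq_zero]
    refine IsHausdorff.haus (I := I) inferInstance _ fun n => ?_
    rw [SModEq.zero, smul_eq_mul, Ideal.mul_top]
    exact Ideal.Quotient.eq.mp (hxy n)
  refine ⟨IsAdicComplete.liftRingHom I g hc, fun r => key _ _ fun n => ?_, fun i => key _ _ fun n => ?_⟩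
  · rw [IsAdicComplete.mk_liftRingHom]
    exact DFunLike.congr_fun (hg1 n) r
  · rw [IsAdicComplete.mk_liftRingHom, hg2]

lemma finite_of_mod {S D : Type*} [CommRing S] [IsNoetherianRing S] [CommRing D] [Algebra S D]
    (I : Ideal S) [IsAdicComplete I S] [IsHausdorff I D] (G : Finset D)
    (h : ∀ d : D, ∃ c ∈ Submodule.span S (G : Set D), d - c ∈ I.map (algebraMap S D)) :
    Module.Finite S D := by
  have _ : IsAdicComplete I (Submodule.span S (G : Set D)) := by
    have : Module.Finite S (Submodule.span S (G : Set D)) :=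
      Module.Finite.iff_fg.mpr ⟨G, rfl⟩
    exact isAdicComplete_finite I
  have hs : Function.Surjective (Submodule.span S (G : Set D)).subtype := by
    refine surjective_of_mkQ_comp_surjective (I := I) ?_
    intro y
    obtain ⟨d, rfl⟩ := Submodule.mkQ_surjective _ y
    obtain ⟨c, hc, hd⟩ := h d
    refine ⟨⟨c, hc⟩, ?_⟩
    symm
    rw [LinearMap.comp_apply, Submodule.mkQ_apply, Submodule.mkQ_apply, Submodule.Quotient.eq,
      Ideal.smul_top_eq_map]
    exact hd
  refine ⟨⟨G, ?_⟩⟩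
  rw [eq_top_iff]
  intro x _
  obtain ⟨y, rfl⟩ := hs x
  exact y.2

/-- modulo a power of the maximal ideal, the ring is generated by finitely many elements over the
coefficient field -/
lemma coeff_gen {K D : Type*} [Field K] [CommRing D] [IsNoetherianRing D] [Algebra K D]
    (m : Ideal D) (hK : ∀ d : D, ∃ a : K, d - algebraMap K D a ∈ m) (n : ℕ) :
    ∃ G : Finset D, ∀ d : D, ∃ c ∈ Submodule.span K (G : Set D), d - c ∈ m ^ n := by
  classical
  induction n with
  | zero => exact ⟨∅, fun d => ⟨0, zero_mem _, by simp⟩⟩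
  | succ n ih =>
    obtain ⟨G, hG⟩ := ih
    obtain ⟨H, hH⟩ := IsNoetherian.noetherian (m ^ n)
    have key : ∀ x ∈ m ^ n, ∃ c ∈ Submodule.span K (H : Set D), x - c ∈ m ^ (n + 1) := by
      intro x hx
      rw [← hH] at hx
      induction hx using Submodule.span_induction with
      | mem x hx => exact ⟨x, Submodule.subset_span hx, by simp⟩
      | zero => exact ⟨0, zero_mem _, by simp⟩
      | add x y hx hy h1 h2 =>
        obtain ⟨c, hc, hc'⟩ := h1
        obtain ⟨e, he, he'⟩ := h2
        refine ⟨c + e, add_mem hc he, ?_⟩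
        have := add_mem hc' he'
        convert this using 1
        ring
      | smul a x hx h1 =>
        obtain ⟨c, hc, hc'⟩ := h1
        obtain ⟨b, hb⟩ := hK a
        refine ⟨b • c, Submodule.smul_mem _ _ hc, ?_⟩
        have hxm : x ∈ m ^ n := by
          rw [← hH]
          exact hx
        have e1 : (a - algebraMap K D b) * x ∈ m ^ (n + 1) := by
          rw [pow_succ, mul_comm (a - algebraMap K D b)]
          exact Ideal.mul_mem_mul hxm hb
        have e2 := add_mem e1 (Ideal.mul_mem_left _ (algebraMap K D b) hc')
        convert e2 using 1
        rw [smul_eq_mul, Algebra.smul_def]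
        ring
    refine ⟨G ∪ H, fun d => ?_⟩
    obtain ⟨c, hc, hc'⟩ := hG d
    obtain ⟨e, he, he'⟩ := key _ hc'
    refine ⟨c + e, add_mem (Submodule.span_mono (by simp) hc)
      (Submodule.span_mono (by simp) he), ?_⟩
    convert he' using 1
    ring

lemma varI_eq_max {σ K : Type*} [Finite σ] [Field K] :
    IsLocalRing.maximalIdeal (MvPowerSeries σ K) = varI σ K := by
  ext f
  rw [IsLocalRing.mem_maximalIdeal, mem_nonunits_iff, MvPowerSeries.isUnit_iff_constantCoeff,
    isUnit_iff_ne_zero, not_not]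
  have := mem_varI_pow_iff 1 f
  rw [pow_one] at this
  rw [this]
  constructor
  · intro h m hm
    have : m = 0 := by
      have : Finsupp.degree m = 0 := by omega
      exact (Finsupp.degree_eq_zero_iff m).mp this
    rw [this]
    simpa using h
  · intro h
    simpa using h 0 (by simp)

lemma dim_powerSeries_le (d : ℕ) (K : Type*) [Field K] :
    ringKrullDim (MvPowerSeries (Fin d) K) ≤ d := by
  refine (ringKrullDim_le_spanFinrank_maximalIdeal _).trans ?_
  rw [varI_eq_max, varI]
  have h := Submodule.spanFinrank_span_le_ncard_of_finite (R := MvPowerSeries (Fin d) K)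
    (Set.finite_range fun i : Fin d => (X i : MvPowerSeries (Fin d) K))
  have h2 : (Set.range fun i : Fin d => (X i : MvPowerSeries (Fin d) K)).ncard ≤ d := by
    have := Set.ncard_image_le (f := fun i : Fin d => (X i : MvPowerSeries (Fin d) K))
      (s := Set.univ) Set.finite_univ
    rw [Set.image_univ] at this
    simpa using this
  exact_mod_cast h.trans h2

lemma dim_le_of_integral {S D : Type*} [CommRing S] [CommRing D] [Algebra S D]
    [Algebra.IsIntegral S D] : ringKrullDim D ≤ ringKrullDim S := by
  refine Order.krullDim_le_of_strictMono
    (fun P : PrimeSpectrum D => PrimeSpectrum.comap (algebraMap S D) P) ?_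
  intro P Q h
  exact Ideal.IsIntegral.comap_lt_comap (R := S) (I := P.asIdeal) (J := Q.asIdeal) h

lemma cohen {K D : Type*} [Field K] [CommRing D] [IsNoetherianRing D] [IsLocalRing D]
    [Algebra K D] [IsAdicComplete (IsLocalRing.maximalIdeal D) D]
    (hK : ∀ d : D, ∃ a : K, d - algebraMap K D a ∈ IsLocalRing.maximalIdeal D) :
    ∃ (d : ℕ) (f : MvPowerSeries (Fin d) K →+* D), Function.Injective f ∧ f.Finite ∧
      (∀ a, f (C a) = algebraMap K D a) ∧
      (∀ i, f (X i) ∈ IsLocalRing.maximalIdeal D) ∧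
      ∃ n, IsLocalRing.maximalIdeal D ^ (n + 1) ≤ (varI (Fin d) K).map f := by
  classical
  set m := IsLocalRing.maximalIdeal D with hm
  obtain ⟨s, hs, hcard⟩ := Ideal.exists_finset_card_eq_height_of_isNoetherianRing m
  let t : Fin s.card → D := fun i => (s.equivFin.symm i : D)
  have htr : Set.range t = (s : Set D) := by
    ext x
    constructor
    · rintro ⟨i, rfl⟩
      exact (s.equivFin.symm i).2
    · intro hx
      exact ⟨s.equivFin ⟨x, hx⟩, by simp [t]⟩
  have hsm : Ideal.span (s : Set D) ≤ m := hs.1.2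
  have ht : ∀ i, t i ∈ m := fun i => hsm (Ideal.subset_span (by rw [← htr]; exact ⟨i, rfl⟩))
  obtain ⟨f, hfC, hfX⟩ := evalHom_exists m (algebraMap K D) t ht
  have hmap : (varI (Fin s.card) K).map f = Ideal.span (s : Set D) := by
    rw [varI, Ideal.map_span, ← htr, ← Set.range_comp]
    congr 2
    funext i
    exact hfX i
  have hrad : m ≤ (Ideal.span (s : Set D)).radical := by
    rw [Ideal.radical_eq_sInf]
    refine le_sInf ?_
    rintro J ⟨hJ1, hJ2⟩
    exact hs.2 ⟨hJ2, hJ1⟩ (IsLocalRing.le_maximalIdeal hJ2.ne_top)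
  obtain ⟨n, hn⟩ := Ideal.exists_pow_le_of_le_radical_of_fg hrad (IsNoetherian.noetherian m)
  have hn1 : m ^ (n + 1) ≤ (varI (Fin s.card) K).map f := by
    rw [hmap]
    exact (Ideal.pow_le_pow_right (Nat.le_succ n)).trans hn
  have hfin : f.Finite := by
    let _ := f.toAlgebra
    obtain ⟨G, hG⟩ := coeff_gen m hK n
    have _ := isAdicComplete_varI (σ := Fin s.card) (R := K)
    have _ : IsHausdorff (varI (Fin s.card) K) D := by
      rw [← IsHausdorff.map_algebraMap_iff (I := varI (Fin s.card) K) (S := D)]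
      refine ⟨fun x hx => ?_⟩
      refine IsHausdorff.haus (I := m) inferInstance _ fun n => ?_
      have := hx n
      rw [SModEq.zero, smul_eq_mul, Ideal.mul_top] at this ⊢
      refine Ideal.pow_right_mono ?_ n this
      change (varI (Fin s.card) K).map f ≤ m
      rw [hmap]
      exact hsm
    refine finite_of_mod (varI (Fin s.card) K) G fun d => ?_
    obtain ⟨c, hc, hd⟩ := hG d
    refine ⟨c, ?_, ?_⟩
    · clear hd
      induction hc using Submodule.span_induction with
      | mem x hx => exact Submodule.subset_span hx
      | zero => exact zero_mem _
      | add x y _ _ h1 h2 => exact add_mem h1 h2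
      | smul a x _ h1 =>
        have := Submodule.smul_mem _ (C a : MvPowerSeries (Fin s.card) K) h1
        rw [Algebra.smul_def] at this ⊢
        rw [← hfC]
        exact this
    · change d - c ∈ (varI (Fin s.card) K).map f
      rw [hmap]
      exact hn hd
  refine ⟨s.card, f, ?_, hfin, hfC, fun i => by rw [hfX]; exact ht i, n, hn1⟩
  by_contra hinj
  rw [RingHom.injective_iff_ker_eq_bot] at hinj
  obtain ⟨r, hr, hr0⟩ := Submodule.exists_mem_ne_zero_of_ne_bot hinj
  let g : MvPowerSeries (Fin s.card) K ⧸ RingHom.ker f →+* D := RingHom.kerLift f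
  have hg : g.IsIntegral := by
    refine RingHom.IsIntegral.tower_top (Ideal.Quotient.mk _) g ?_
    have : g.comp (Ideal.Quotient.mk (RingHom.ker f)) = f := RingHom.ext fun x => rfl
    rw [this]
    exact hfin.to_isIntegral
  have h1 : ringKrullDim D ≤ ringKrullDim (MvPowerSeries (Fin s.card) K ⧸ RingHom.ker f) := by
    let _ := g.toAlgebra
    have _ : Algebra.IsIntegral (MvPowerSeries (Fin s.card) K ⧸ RingHom.ker f) D := ⟨hg⟩
    exact dim_le_of_integral
  have h2 := ringKrullDim_succ_le_of_surjective (Ideal.Quotient.mk (RingHom.ker f))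
    Ideal.Quotient.mk_surjective (mem_nonZeroDivisors_of_ne_zero hr0)
    (Ideal.Quotient.eq_zero_iff_mem.mpr hr)
  have h3 := dim_powerSeries_le s.card K
  have h4 := IsLocalRing.maximalIdeal_height_eq_ringKrullDim (R := D)
  rw [← hm, ← hcard] at h4
  rw [← h4] at h1
  have h5 : ((s.card : ℕ∞) : WithBot ℕ∞) + 1 ≤ ((s.card : ℕ∞) : WithBot ℕ∞) := by
    refine le_trans (add_le_add_left h1 1) (h2.trans ?_)
    exact_mod_cast h3
  have h6 : ((s.card : ℕ∞)) + 1 ≤ ((s.card : ℕ∞)) := by exact_mod_cast h5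
  have h7 : s.card + 1 ≤ s.card := by exact_mod_cast h6
  omega

end Cohen
end CTN

namespace CTN
section ThmT
open MvPowerSeries

lemma add_pow_alg {K T : Type*} [Field K] [CommRing T] [Algebra K T] (p e : ℕ) [ExpChar K p]
    (x y : T) : (x + y) ^ p ^ e = x ^ p ^ e + y ^ p ^ e := by
  rcases subsingleton_or_nontrivial T with h | h
  · exact Subsingleton.elim _ _
  · have : ExpChar T p := expChar_of_injective_algebraMap (algebraMap K T).injective p
    exact add_pow_expChar_pow x y p e

lemma qlin_tensor {K S B M : Type*} [Field K] [CommRing S] [Algebra K S] [CommRing B] [CommRing M]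
    [Algebra S B] [Algebra S M] (p e : ℕ) [ExpChar K p] (Λ : M →ₗ[S] M)
    (hΛ : ∀ a b, Λ (a ^ p ^ e * b) = a ^ p ^ e * Λ b) (x y : B ⊗[S] M) :
    LinearMap.lTensor B Λ (x ^ p ^ e * y) = x ^ p ^ e * LinearMap.lTensor B Λ y := by
  let _ : Algebra K (B ⊗[S] M) := ((algebraMap S (B ⊗[S] M)).comp (algebraMap K S)).toAlgebra
  have hp : p ^ e ≠ 0 := (expChar_pow_pos K p e).ne'
  induction x with
  | zero => rw [zero_pow hp, zero_mul, zero_mul, map_zero]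
  | add x x' h h' => rw [add_pow_alg (K := K) p e, add_mul, map_add, h, h', add_mul]
  | tmul b m =>
    rw [Algebra.TensorProduct.tmul_pow]
    induction y with
    | zero => rw [map_zero, mul_zero, map_zero]
    | add y y' h h' => rw [mul_add, map_add, h, h', map_add, mul_add]
    | tmul b' m' =>
      rw [Algebra.TensorProduct.tmul_mul_tmul, LinearMap.lTensor_tmul, LinearMap.lTensor_tmul,
        Algebra.TensorProduct.tmul_mul_tmul, hΛ]

lemma cwise_smul {σ K R : Type*} [CommRing K] [CommRing R] [Algebra K R] (l : R →+ R)
    (hl : ∀ (a : K) r, l (a • r) = a • l r) (f : MvPowerSeries σ K) (g : MvPowerSeries σ R) :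
    cwise l (f • g) = f • cwise l g := by
  classical
  rw [Algebra.smul_def, Algebra.smul_def, alg_eq_map]
  ext n
  rw [coeff_cwise, coeff_mul, coeff_mul, map_sum]
  refine Finset.sum_congr rfl fun i _ => ?_
  rw [coeff_map, ← Algebra.smul_def, hl, ← Algebra.smul_def, coeff_cwise]

lemma cwise_pow_mul {σ S : Type*} [Finite σ] [CommRing S] (p e : ℕ) [ExpChar S p] (hp : p ≠ 0) (l : S →+ S)
    (hl : ∀ a b, l (a ^ p ^ e * b) = a ^ p ^ e * l b) (f g : MvPowerSeries σ S) :
    cwise l (f ^ p ^ e * g) = f ^ p ^ e * cwise l g := by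
  classical
  have hq : p ^ e ≠ 0 := pow_ne_zero e hp
  have hco : ∀ i, ∃ y, coeff i (f ^ p ^ e) = y ^ p ^ e := by
    intro i
    rw [← map_iterateFrobenius_expand p hp f e, map_expand]
    by_cases h : ∀ j, p ^ e ∣ i j
    · choose c hc using h
      let m : σ →₀ ℕ := Finsupp.equivFunOnFinite.symm c
      have hi : i = (p ^ e) • m := by
        ext j
        simp [m, hc]
      rw [hi, coeff_expand_smul, coeff_map]
      exact ⟨_, iterateFrobenius_def _ _ _⟩
    · push Not at h
      obtain ⟨j, hj⟩ := h
      rw [coeff_expand_of_not_dvd _ _ _ hj]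
      exact ⟨0, (zero_pow hq).symm⟩
  ext n
  rw [coeff_cwise, coeff_mul, coeff_mul, map_sum]
  refine Finset.sum_congr rfl fun i _ => ?_
  obtain ⟨y, hy⟩ := hco i.1
  rw [hy, hl, coeff_cwise]

lemma cwise_C {σ R : Type*} [CommRing R] (l : R →+ R) (r : R) :
    cwise l (C r : MvPowerSeries σ R) = C (l r) := by
  classical
  ext n
  rw [coeff_cwise, coeff_C, coeff_C]
  split_ifs <;> simp

lemma isNoeth_tensor {S D E : Type*} [CommRing S] [CommRing D] [CommRing E] [Algebra S D]
    [Algebra S E] [Module.Finite S D] [IsNoetherianRing E] : IsNoetherianRing (D ⊗[S] E) := by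
  have : IsNoetherianRing (E ⊗[S] D) := IsNoetherianRing.of_finite E _
  exact isNoetherianRing_of_ringEquiv _ (Algebra.TensorProduct.comm S E D).toRingEquiv

lemma red_quot_tensor {S D E : Type*} [CommRing S] [CommRing D] [CommRing E] [Algebra S D]
    [Algebra S E] (P : Ideal D) (h : IsReduced ((D ⧸ P) ⊗[S] E)) :
    IsReduced ((D ⊗[S] E) ⧸ P.map (algebraMap D (D ⊗[S] E))) := by
  let g : D ⊗[S] E →ₐ[S] (D ⧸ P) ⊗[S] E :=
    Algebra.TensorProduct.map (Ideal.Quotient.mkₐ S P) (AlgHom.id S E)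
  have hk : RingHom.ker g = P.map (algebraMap D (D ⊗[S] E)) := by
    have := Algebra.TensorProduct.rTensor_ker (R := S) (S := S) (C := E) (Ideal.Quotient.mkₐ S P)
      (Ideal.Quotient.mkₐ_surjective S P)
    have h2 : RingHom.ker (Ideal.Quotient.mkₐ S P) = P := Ideal.Quotient.mkₐ_ker S P
    rw [h2] at this
    exact this
  rw [← hk]
  exact isReduced_of_injective (RingHom.kerLift (g : D ⊗[S] E →+* (D ⧸ P) ⊗[S] E))
    (RingHom.kerLift_injective _)

/-- completeness for the maximal ideal of `D` itself -/
lemma isCplM {σ K R D : Type*} [Finite σ] [CommRing K] [CommRing R] [Algebra K R]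
    [CommRing D] [Algebra K D] [Algebra (MvPowerSeries σ K) D] [IsNoetherianRing K]
    [IsNoetherianRing R] (J : Ideal R) [IsAdicComplete J R]
    [Module.Finite (MvPowerSeries σ K) D]
    (hKD : ∀ a : K, algebraMap (MvPowerSeries σ K) D (C a) = algebraMap K D a)
    (φ : D ⊗[K] R →+* D ⊗[MvPowerSeries σ K] MvPowerSeries σ R)
    (hφ : ∀ d r, φ (d ⊗ₜ r) = d ⊗ₜ C r) (m : Ideal D)
    (h1 : (varI σ K).map (algebraMap (MvPowerSeries σ K) D) ≤ m) (n : ℕ)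
    (h2 : m ^ (n + 1) ≤ (varI σ K).map (algebraMap (MvPowerSeries σ K) D)) :
    IsCpl (mixI K m J) φ :=
  (isCplG J hKD φ hφ).cofinal (mixI_mono h1 le_rfl) n (mixI_pow_le n h2)

lemma red_of_cohen {σ K R D : Type*} [Finite σ] [Field K] [CommRing R] [Nontrivial R] [Algebra K R]
    [CommRing D] [IsDomain D] [IsNoetherianRing D] [IsLocalRing D] [Algebra K D]
    [IsAdicComplete (IsLocalRing.maximalIdeal D) D]
    (hK : ∀ d : D, ∃ a : K, d - algebraMap K D a ∈ IsLocalRing.maximalIdeal D)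
    [Algebra (MvPowerSeries σ K) D] [IsNoetherianRing R] (hR : Nice R)
    [Module.Finite (MvPowerSeries σ K) D]
    (hKD : ∀ a : K, algebraMap (MvPowerSeries σ K) D (C a) = algebraMap K D a)
    (h1 : (varI σ K).map (algebraMap (MvPowerSeries σ K) D) ≤ IsLocalRing.maximalIdeal D) (n : ℕ)
    (h2 : IsLocalRing.maximalIdeal D ^ (n + 1) ≤
      (varI σ K).map (algebraMap (MvPowerSeries σ K) D))
    (p : ℕ) [ExpChar K p] (H : ∀ e, HExt K R (p ^ e)) :
    IsReduced (D ⊗[MvPowerSeries σ K] MvPowerSeries σ R) := by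
  obtain ⟨φ, hφ⟩ := phiG_exists (σ := σ) (R := R) hKD
  have c1 := isCplM (⊥ : Ideal R) hKD φ hφ _ h1 n h2
  obtain ⟨d, f, hinj, hfin, hfC, hfX, n', h2'⟩ := cohen hK
  let _ := f.toAlgebra
  have _ : Module.Finite (MvPowerSeries (Fin d) K) D := hfin
  have hKD' : ∀ a : K, algebraMap (MvPowerSeries (Fin d) K) D (C a) = algebraMap K D a := hfC
  obtain ⟨φ', hφ'⟩ := phiG_exists (σ := Fin d) (R := R) hKD'
  have h1' : (varI (Fin d) K).map (algebraMap (MvPowerSeries (Fin d) K) D) ≤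
      IsLocalRing.maximalIdeal D := by
    rw [varI, Ideal.map_span, Ideal.span_le]
    rintro _ ⟨_, ⟨i, rfl⟩, rfl⟩
    exact hfX i
  have c2 := isCplM (⊥ : Ideal R) hKD' φ' hφ' _ h1' n' h2'
  obtain ⟨e⟩ := c1.unique c2
  have _ : Module.Flat (MvPowerSeries (Fin d) K) (MvPowerSeries (Fin d) R) := flat_powerSeries
  have _ : ExpChar (MvPowerSeries (Fin d) K) p :=
    expChar_of_injective_algebraMap (algebraMap K (MvPowerSeries (Fin d) K)).injective p
  have _ : IsDomain (MvPowerSeries (Fin d) K) := NoZeroDivisors.to_isDomain _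
  have hred := (gen (S := MvPowerSeries (Fin d) K) (E1 := MvPowerSeries (Fin d) R) (D := D) hinj
    (nice_mvPowerSeries hR d) p (fun e f hf => qext_powerSeries p e (H e) f hf)).1
  exact isReduced_of_injective (e : _ →+* D ⊗[MvPowerSeries (Fin d) K] MvPowerSeries (Fin d) R)
    e.injective

theorem thmT {K : Type*} {R : Type*} {D : Type*} [Field K] [CommRing R] [Nontrivial R] [Algebra K R]
    [CommRing D] [IsDomain D] [IsNoetherianRing D] [IsLocalRing D] [Algebra K D]
    [IsIntegrallyClosed D] [IsAdicComplete (IsLocalRing.maximalIdeal D) D]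
    (hK : ∀ d : D, ∃ a : K, d - algebraMap K D a ∈ IsLocalRing.maximalIdeal D)
    [IsNoetherianRing R] (hR : Nice R)
    (p : ℕ) [ExpChar K p] (H : ∀ e, HExt K R (p ^ e)) :
    ∃ (d : ℕ) (f : MvPowerSeries (Fin d) K →+* D),
      let _ : Algebra (MvPowerSeries (Fin d) K) D := f.toAlgebra
      ∃ φ : D ⊗[K] R →+* D ⊗[MvPowerSeries (Fin d) K] MvPowerSeries (Fin d) R,
      Nice (D ⊗[MvPowerSeries (Fin d) K] MvPowerSeries (Fin d) R) ∧
      IsNoetherianRing (D ⊗[MvPowerSeries (Fin d) K] MvPowerSeries (Fin d) R) ∧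
      (∀ J : Ideal R, IsAdicComplete J R → IsCpl (mixI K (IsLocalRing.maximalIdeal D) J) φ) ∧
      ∀ e, ∀ l : R →+ R, (∀ a b, l (a ^ p ^ e * b) = a ^ p ^ e * l b) →
        (∀ (a : K) r, l (a • r) = a • l r) →
        ∃ L : D ⊗[MvPowerSeries (Fin d) K] MvPowerSeries (Fin d) R →+
            D ⊗[MvPowerSeries (Fin d) K] MvPowerSeries (Fin d) R,
          (∀ a b, L (a ^ p ^ e * b) = a ^ p ^ e * L b) ∧
          ∀ r, L (φ (1 ⊗ₜ r)) = φ (1 ⊗ₜ l r) := by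
  obtain ⟨d, f, hinj, hfin, hfC, hfX, n, h2⟩ := cohen hK
  refine ⟨d, f, ?_⟩
  intro _
  have _ : Module.Finite (MvPowerSeries (Fin d) K) D := hfin
  have hKD : ∀ a : K, algebraMap (MvPowerSeries (Fin d) K) D (C a) = algebraMap K D a := hfC
  obtain ⟨φ, hφ⟩ := phiG_exists (σ := Fin d) (R := R) hKD
  have h1 : (varI (Fin d) K).map (algebraMap (MvPowerSeries (Fin d) K) D) ≤
      IsLocalRing.maximalIdeal D := by
    rw [varI, Ideal.map_span, Ideal.span_le]
    rintro _ ⟨_, ⟨i, rfl⟩, rfl⟩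
    exact hfX i
  have _ : Module.Flat (MvPowerSeries (Fin d) K) (MvPowerSeries (Fin d) R) := flat_powerSeries
  have _ : ExpChar (MvPowerSeries (Fin d) K) p :=
    expChar_of_injective_algebraMap (algebraMap K (MvPowerSeries (Fin d) K)).injective p
  refine ⟨φ, ?_, isNoeth_tensor, fun J hJ => isCplM J hKD φ hφ _ h1 n h2, ?_⟩
  · have _ : IsDomain (MvPowerSeries (Fin d) K) := NoZeroDivisors.to_isDomain _
    refine nice_of_gen (S := MvPowerSeries (Fin d) K) (E1 := MvPowerSeries (Fin d) R) (D := D) hinj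
      (nice_mvPowerSeries hR d) p (fun e f hf => qext_powerSeries p e (H e) f hf) ?_
    intro P hP
    refine red_quot_tensor P ?_
    have hPm : P ≤ IsLocalRing.maximalIdeal D := IsLocalRing.le_maximalIdeal hP.ne_top
    have _ : Nontrivial (D ⧸ P) := Ideal.Quotient.nontrivial_iff.mpr hP.ne_top
    have _ : IsLocalRing (D ⧸ P) :=
      IsLocalRing.of_surjective' (Ideal.Quotient.mk P) Ideal.Quotient.mk_surjective
    have hmm : (IsLocalRing.maximalIdeal D).map (algebraMap D (D ⧸ P)) =
        IsLocalRing.maximalIdeal (D ⧸ P) := by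
      refine (IsLocalRing.eq_maximalIdeal ?_)
      refine (Ideal.map_eq_top_or_isMaximal_of_surjective (Ideal.Quotient.mk P)
        Ideal.Quotient.mk_surjective inferInstance).resolve_left ?_
      intro ht
      have := Ideal.comap_map_of_surjective (Ideal.Quotient.mk P) Ideal.Quotient.mk_surjective
        (IsLocalRing.maximalIdeal D)
      rw [ht, Ideal.comap_top, ← RingHom.ker_eq_comap_bot, Ideal.mk_ker, sup_eq_left.mpr hPm] at this
      exact (IsLocalRing.maximalIdeal.isMaximal D).ne_top this.symm
    have _ : IsAdicComplete (IsLocalRing.maximalIdeal (D ⧸ P)) (D ⧸ P) := by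
      rw [← hmm]
      exact isAdicComplete_algebra_finite _
    have hmap : (varI (Fin d) K).map (algebraMap (MvPowerSeries (Fin d) K) (D ⧸ P)) =
        ((varI (Fin d) K).map (algebraMap (MvPowerSeries (Fin d) K) D)).map
          (algebraMap D (D ⧸ P)) := by
      rw [Ideal.map_map]
      rfl
    have _ : Module.Finite (MvPowerSeries (Fin d) K) (D ⧸ P) :=
      Module.Finite.of_surjective (Ideal.Quotient.mkₐ (MvPowerSeries (Fin d) K) P).toLinearMap
        Ideal.Quotient.mk_surjective
    refine red_of_cohen (D := D ⧸ P) (R := R) (σ := Fin d) ?_ hR ?_ ?_ n ?_ p H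
    · intro x
      obtain ⟨x, rfl⟩ := Ideal.Quotient.mk_surjective x
      obtain ⟨a, ha⟩ := hK x
      refine ⟨a, ?_⟩
      rw [← hmm]
      have := Ideal.mem_map_of_mem (algebraMap D (D ⧸ P)) ha
      rw [map_sub] at this
      exact this
    · intro a
      exact congrArg (Ideal.Quotient.mk P) (hKD a)
    · rw [hmap, ← hmm]
      exact Ideal.map_mono h1
    · rw [hmap, ← hmm, ← Ideal.map_pow]
      exact Ideal.map_mono h2
  · intro e l hl hl'
    have hp : p ≠ 0 := (expChar_pos K p).ne'
    have _ : ExpChar R p := expChar_of_injective_algebraMap (algebraMap K R).injective p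
    let Λ : MvPowerSeries (Fin d) R →ₗ[MvPowerSeries (Fin d) K] MvPowerSeries (Fin d) R :=
      { toFun := cwise l
        map_add' := map_add _
        map_smul' := cwise_smul l hl' }
    refine ⟨(LinearMap.lTensor D Λ).toAddMonoidHom, ?_, ?_⟩
    · exact qlin_tensor (K := K) p e Λ (cwise_pow_mul p e hp l hl)
    · intro r
      rw [hφ, hφ]
      change LinearMap.lTensor D Λ (1 ⊗ₜ C r) = _
      rw [LinearMap.lTensor_tmul]
      change 1 ⊗ₜ cwise l (C r) = _
      rw [cwise_C]
end ThmT
end CTN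

namespace CTN
section CoeffField
open MvPolynomial

lemma crit_mem {k K : Type*} [Field k] [Field K] [Algebra k K]
    (h : Subsingleton (Algebra.H1Cotangent k K)) (f : MvPolynomial K k)
    (h0 : aeval (fun x : K => x) f = 0)
    (h1 : ∀ i, aeval (fun x : K => x) (pderiv i f) = 0) :
    f ∈ (RingHom.ker (aeval (R := k) (fun x : K => x))) ^ 2 := by
  let P := Algebra.Generators.self k K
  have hk : P.ker = RingHom.ker (aeval (R := k) (fun x : K => x)) := P.ker_eq_ker_aeval_val
  have hinj : Function.Injective P.toExtension.cotangentComplex :=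
    (Algebra.Extension.subsingleton_h1Cotangent _).mp h
  have hf : f ∈ P.ker := by rw [hk]; exact h0
  have hz : P.toExtension.cotangentComplex (Algebra.Extension.Cotangent.mk ⟨f, hf⟩) = 0 := by
    rw [Algebra.Extension.cotangentComplex_mk]
    apply P.cotangentSpaceBasis.repr.injective
    rw [map_zero]
    refine Finsupp.ext fun i => ?_
    refine (P.cotangentSpaceBasis_repr_one_tmul f i).trans ?_
    exact h1 i
  have h2 := hinj (hz.trans (map_zero _).symm)
  rw [Algebra.Extension.Cotangent.mk_eq_zero_iff] at h2
  rw [← hk]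
  exact h2

lemma subsingleton_of_crit {k K : Type*} [Field k] [Field K] [Algebra k K]
    (h : ∀ f : MvPolynomial K k, aeval (fun x : K => x) f = 0 →
      (∀ i, aeval (fun x : K => x) (pderiv i f) = 0) →
      f ∈ (RingHom.ker (aeval (R := k) (fun x : K => x))) ^ 2) :
    Subsingleton (Algebra.H1Cotangent k K) := by
  let P := Algebra.Generators.self k K
  have hk : P.ker = RingHom.ker (aeval (R := k) (fun x : K => x)) := P.ker_eq_ker_aeval_val
  refine (Algebra.Extension.subsingleton_h1Cotangent P.toExtension).mpr ?_
  rw [injective_iff_map_eq_zero]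
  intro x hx
  obtain ⟨⟨f, hf⟩, rfl⟩ := Algebra.Extension.Cotangent.mk_surjective x
  rw [Algebra.Extension.Cotangent.mk_eq_zero_iff]
  have hf' : f ∈ P.ker := hf
  rw [hk] at hf'
  have : f ∈ P.ker ^ 2 := by
    rw [hk]
    refine h f hf' fun i => ?_
    rw [Algebra.Extension.cotangentComplex_mk] at hx
    refine (P.cotangentSpaceBasis_repr_one_tmul f i).symm.trans ?_
    have h3 := congrArg (fun z => P.cotangentSpaceBasis.repr z i) hx
    refine h3.trans ?_
    rw [map_zero]
    rfl
  exact this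

lemma formallySmooth_field {k K : Type*} [Field k] [PerfectField k] [Field K] [Algebra k K] :
    Algebra.FormallySmooth k K := by
  classical
  refine ⟨inferInstance, subsingleton_of_crit fun f h0 h1 => ?_⟩
  let K' := IntermediateField.adjoin k (f.vars : Set K)
  have _ : Algebra.EssFiniteType k K' := by
    rw [IntermediateField.essFiniteType_iff]
    exact ⟨f.vars, rfl⟩
  have hs : Algebra.FormallySmooth k K' := inferInstance
  have hinj : Function.Injective (fun x : K' => (x : K)) := Subtype.val_injective
  obtain ⟨g, hg⟩ := exists_rename_eq_of_vars_subset_range f (fun x : K' => (x : K)) hinj (by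
    intro x hx
    exact ⟨⟨x, IntermediateField.subset_adjoin k _ hx⟩, rfl⟩)
  have hcomp : ∀ u : MvPolynomial K' k, aeval (fun x : K => x) (rename (fun x : K' => (x : K)) u) =
      ((aeval (fun x : K' => x) u : K') : K) := by
    intro u
    rw [aeval_rename]
    have := MvPolynomial.comp_aeval_apply (fun x : K' => x) (K'.val) u
    exact this.symm
  have hmem := crit_mem (k := k) (K := K') inferInstance g (by
      apply hinj
      change ((aeval (fun x : K' => x) g : K') : K) = ((0 : K') : K)
      rw [← hcomp, hg, h0]
      rfl) (by
      intro i
      apply hinj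
      change ((aeval (fun x : K' => x) (pderiv i g) : K') : K) = ((0 : K') : K)
      have h3 := h1 i
      rw [← hg, pderiv_rename hinj] at h3
      rw [← hcomp, h3]
      rfl)
  have h4 := Ideal.mem_map_of_mem
    (rename (R := k) (fun x : K' => (x : K)) : MvPolynomial K' k →ₐ[k] MvPolynomial K k).toRingHom hmem
  rw [Ideal.map_pow] at h4
  have h5 : f ∈ Ideal.map (rename (R := k) (fun x : K' => (x : K)) : MvPolynomial K' k →ₐ[k] MvPolynomial K k).toRingHom (RingHom.ker (aeval (R := k) (fun x : K' => x))) ^ 2 := by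
    rw [← hg]
    exact h4
  refine Ideal.pow_right_mono ?_ 2 h5
  rw [Ideal.map_le_iff_le_comap]
  intro u hu
  change aeval (fun x : K => x) (rename (fun x : K' => (x : K)) u) = 0
  rw [hcomp, (hu : aeval (fun x : K' => x) u = 0)]
  rfl

/-- existence of a coefficient field -/
lemma coeff_field {k A : Type*} [Field k] [PerfectField k] [CommRing A] [IsLocalRing A]
    [Algebra k A] [IsAdicComplete (IsLocalRing.maximalIdeal A) A] :
    ∃ g : IsLocalRing.ResidueField A →ₐ[k] A, ∀ x, IsLocalRing.residue A (g x) = x := by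
  have _ : Algebra.FormallySmooth k (IsLocalRing.ResidueField A) := formallySmooth_field
  let f : IsLocalRing.ResidueField A →ₐ[k] A ⧸ IsLocalRing.maximalIdeal A := 
    AlgHom.id k (IsLocalRing.ResidueField A)
  obtain ⟨g, hg⟩ := Algebra.FormallySmooth.exists_mkₐ_comp_eq_of_isAdicComplete f
  exact ⟨g, fun x => DFunLike.congr_fun hg x⟩

end CoeffField
end CTN

namespace CTN
section Assembly

lemma preCpl_tensor {K A X Y : Type*} [CommRing K] [CommRing A] [CommRing X] [CommRing Y]
    [Algebra K A] [Algebra K X] [Algebra K Y] (m : Ideal A) (N : Ideal X) (φ : X →ₐ[K] Y)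
    (h : PreCpl N φ.toRingHom) :
    PreCpl (mixI K m N) (Algebra.TensorProduct.map (AlgHom.id K A) φ).toRingHom where
  psi n := by
    obtain ⟨ψ, hψ⟩ := h.psi n
    have hle : ∀ x ∈ N ^ n, ((Ideal.Quotient.mk (mixI K m N ^ n)).comp
        (Algebra.TensorProduct.includeRight (R := K) (A := A) (B := X)).toRingHom) x = 0 := by
      intro x hx
      rw [RingHom.comp_apply, Ideal.Quotient.eq_zero_iff_mem]
      have h1 : N.map (Algebra.TensorProduct.includeRight (R := K) (A := A) (B := X)).toRingHom
          ≤ mixI K m N := le_sup_right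
      refine Ideal.pow_right_mono h1 n ?_
      rw [← Ideal.map_pow]
      exact Ideal.mem_map_of_mem _ hx
    let χ : Y →+* (A ⊗[K] X) ⧸ mixI K m N ^ n := (Ideal.Quotient.lift (N ^ n) _ hle).comp ψ
    have hχ : ∀ x, χ (φ x) = Ideal.Quotient.mk (mixI K m N ^ n) (1 ⊗ₜ x) := by
      intro x
      have h2 : ψ (φ x) = Ideal.Quotient.mk (N ^ n) x := RingHom.congr_fun hψ x
      change (Ideal.Quotient.lift (N ^ n) _ hle) (ψ (φ x)) = _
      rw [h2]
      rfl
    let χ' : Y →ₐ[K] (A ⊗[K] X) ⧸ mixI K m N ^ n := { χ with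
      commutes' := fun c => by
        change χ (algebraMap K Y c) = _
        rw [← φ.commutes, hχ, ← Algebra.TensorProduct.includeRight_apply, AlgHom.commutes]
        rfl }
    let G := Algebra.TensorProduct.productMap
      ((Ideal.Quotient.mkₐ K (mixI K m N ^ n)).comp Algebra.TensorProduct.includeLeft) χ'
    refine ⟨G.toRingHom, ?_⟩
    refine RingHom.ext fun t => ?_
    induction t with
    | zero => simp
    | add x y hx hy => rw [map_add, map_add, hx, hy]
    | tmul a x =>
      change G ((Algebra.TensorProduct.map (AlgHom.id K A) φ) (a ⊗ₜ x)) = _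
      rw [Algebra.TensorProduct.map_tmul, Algebra.TensorProduct.productMap_apply_tmul]
      change Ideal.Quotient.mk _ (a ⊗ₜ 1) * χ (φ x) = _
      rw [hχ, ← map_mul, Algebra.TensorProduct.tmul_mul_tmul, mul_one, one_mul]
  surj e := by
    set F := (Algebra.TensorProduct.map (AlgHom.id K A) φ).toRingHom with hF
    have hN : N.map φ.toRingHom ≤ ((mixI K m N).map F).comap
        (Algebra.TensorProduct.includeRight (R := K) (A := A) (B := Y)).toRingHom := by
      rw [Ideal.map_le_iff_le_comap]
      intro x hx
      have : F (1 ⊗ₜ x) ∈ (mixI K m N).map F := Ideal.mem_map_of_mem _ (mixI_right hx 1)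
      exact this
    induction e with
    | zero => exact ⟨0, by simp⟩
    | add x y hx hy =>
      obtain ⟨c, hc⟩ := hx
      obtain ⟨d, hd⟩ := hy
      refine ⟨c + d, ?_⟩
      have := add_mem hc hd
      rw [map_add]
      convert this using 1
      ring
    | tmul a y =>
      obtain ⟨x, hx⟩ := h.surj y
      refine ⟨a ⊗ₜ x, ?_⟩
      have h1 := Ideal.mul_mem_left _ (a ⊗ₜ[K] (1 : Y)) (Ideal.mem_comap.1 (hN hx))
      have h2 : (a ⊗ₜ[K] (1 : Y)) * (1 ⊗ₜ (y - φ x)) = a ⊗ₜ y - F (a ⊗ₜ x) := by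
        rw [Algebra.TensorProduct.tmul_mul_tmul, mul_one, one_mul, TensorProduct.tmul_sub]
        rfl
      rw [← h2]
      exact h1

lemma map_mixI {K A X Y : Type*} [CommRing K] [CommRing A] [CommRing X] [CommRing Y]
    [Algebra K A] [Algebra K X] [Algebra K Y] (m : Ideal A) (N : Ideal X) (φ : X →ₐ[K] Y) :
    (mixI K m N).map (Algebra.TensorProduct.map (AlgHom.id K A) φ).toRingHom =
      mixI K m (N.map φ.toRingHom) := by
  refine le_antisymm ?_ (mixI_le ?_ ?_)
  · rw [Ideal.map_le_iff_le_comap]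
    refine mixI_le (fun a ha => ?_) (fun b hb => ?_)
    · have : (Algebra.TensorProduct.map (AlgHom.id K A) φ) (a ⊗ₜ 1) ∈
          mixI K m (N.map φ.toRingHom) := by
        rw [Algebra.TensorProduct.map_tmul]
        exact mixI_left ha _
      exact this
    · have : (Algebra.TensorProduct.map (AlgHom.id K A) φ) (1 ⊗ₜ b) ∈
          mixI K m (N.map φ.toRingHom) := by
        rw [Algebra.TensorProduct.map_tmul]
        exact mixI_right (Ideal.mem_map_of_mem φ.toRingHom hb) _
      exact this
  · intro a ha
    have : (Algebra.TensorProduct.map (AlgHom.id K A) φ).toRingHom (a ⊗ₜ 1) ∈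
      (mixI K m N).map (Algebra.TensorProduct.map (AlgHom.id K A) φ).toRingHom :=
      Ideal.mem_map_of_mem _ (mixI_left ha _)
    have h2 : (Algebra.TensorProduct.map (AlgHom.id K A) φ).toRingHom (a ⊗ₜ 1) = a ⊗ₜ 1 := by
      change (Algebra.TensorProduct.map (AlgHom.id K A) φ) (a ⊗ₜ 1) = a ⊗ₜ 1
      rw [Algebra.TensorProduct.map_tmul, map_one]
      rfl
    rwa [h2] at this
  · have : N.map φ.toRingHom ≤ ((mixI K m N).map
        (Algebra.TensorProduct.map (AlgHom.id K A) φ).toRingHom).comap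
        (Algebra.TensorProduct.includeRight (R := K) (A := A) (B := Y)).toRingHom := by
      rw [Ideal.map_le_iff_le_comap]
      intro x hx
      have : (Algebra.TensorProduct.map (AlgHom.id K A) φ).toRingHom (1 ⊗ₜ x) ∈
        (mixI K m N).map (Algebra.TensorProduct.map (AlgHom.id K A) φ).toRingHom :=
        Ideal.mem_map_of_mem _ (mixI_right hx 1)
      exact this
    exact fun b hb => this hb

/-- the isomorphism `A ⊗ B = A ⊗_K (K ⊗ B)` matches the ideals -/
lemma map_cancel {k K A B : Type*} [CommRing k] [CommRing K] [CommRing A] [CommRing B] [Algebra k K]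
    [Algebra k A] [Algebra K A] [IsScalarTower k K A] [Algebra k B] (m : Ideal A) (n : Ideal B) :
    (mixI k m n).map (((Algebra.TensorProduct.cancelBaseChange k K K A B).symm.toRingEquiv :
      A ⊗[k] B ≃+* A ⊗[K] (K ⊗[k] B)) : A ⊗[k] B →+* A ⊗[K] (K ⊗[k] B)) =
      mixI K m (mixI k ⊥ n) := by
  set F : A ⊗[k] B →+* A ⊗[K] (K ⊗[k] B) :=
    (((Algebra.TensorProduct.cancelBaseChange k K K A B).symm.toRingEquiv :
      A ⊗[k] B ≃+* A ⊗[K] (K ⊗[k] B)) : A ⊗[k] B →+* A ⊗[K] (K ⊗[k] B)) with hF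
  have hf : ∀ a b, F (a ⊗ₜ b) = a ⊗ₜ (1 ⊗ₜ b) := fun a b => by
    change (Algebra.TensorProduct.cancelBaseChange k K K A B).symm (a ⊗ₜ b) = _
    simp
  refine le_antisymm ?_ (mixI_le ?_ ?_)
  · rw [Ideal.map_le_iff_le_comap]
    refine mixI_le (fun a ha => ?_) (fun b hb => ?_)
    · rw [Ideal.mem_comap, hf]
      exact mixI_left ha _
    · rw [Ideal.mem_comap, hf]
      exact mixI_right (mixI_right hb _) _
  · intro a ha
    have : F (a ⊗ₜ 1) ∈ (mixI k m n).map F := Ideal.mem_map_of_mem _ (mixI_left ha _)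
    rw [hf] at this
    exact this
  · have : mixI k (⊥ : Ideal K) n ≤ ((mixI k m n).map F).comap
        (Algebra.TensorProduct.includeRight (R := K) (A := A) (B := K ⊗[k] B)).toRingHom := by
      refine mixI_le (fun a ha => ?_) (fun b hb => ?_)
      · rw [Ideal.mem_bot.1 ha, TensorProduct.zero_tmul]
        exact zero_mem _
      · have : F (1 ⊗ₜ b) ∈ (mixI k m n).map F := Ideal.mem_map_of_mem _ (mixI_right hb _)
        rw [hf] at this
        exact this
    exact fun b hb => this hb

lemma isCpl_base {k K A B Y E : Type*} [CommRing k] [CommRing K] [CommRing A] [CommRing B]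
    [CommRing Y] [CommRing E] [Algebra k K]
    [Algebra k A] [Algebra K A] [IsScalarTower k K A] [Algebra k B] [Algebra K Y]
    (m : Ideal A) (n : Ideal B) (φ : K ⊗[k] B →ₐ[K] Y) (h : PreCpl (mixI k ⊥ n) φ.toRingHom)
    (Φ : A ⊗[K] Y →+* E) (hΦ : IsCpl (mixI K m ((mixI k ⊥ n).map φ.toRingHom)) Φ) :
    ∃ f : A ⊗[k] B →+* E, IsCpl (mixI k m n) f := by
  rw [← map_mixI] at hΦ
  have h1 := IsCpl.trans (preCpl_tensor m _ φ h) hΦ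
  rw [← map_cancel] at h1
  exact ⟨_, IsCpl.trans (PreCpl.precomp (E := E) _) h1⟩

end Assembly
end CTN

namespace CTN
section Assembly2

universe uK uR uD

theorem thmE {K : Type uK} {R : Type uR} {D : Type uD} [Field K] [CommRing R] [Nontrivial R]
    [Algebra K R]
    [CommRing D] [IsDomain D] [IsNoetherianRing D] [IsLocalRing D] [Algebra K D]
    [IsIntegrallyClosed D] [IsAdicComplete (IsLocalRing.maximalIdeal D) D]
    (hK : ∀ d : D, ∃ a : K, d - algebraMap K D a ∈ IsLocalRing.maximalIdeal D)
    [IsNoetherianRing R] (hR : Nice R)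
    (p : ℕ) [ExpChar K p] (H : ∀ e, HExt K R (p ^ e)) :
    ∃ (E : Type (max uD uR)) (_ : CommRing E) (φ : D ⊗[K] R →+* E),
      Nice E ∧ IsNoetherianRing E ∧
      (∀ J : Ideal R, IsAdicComplete J R → IsCpl (mixI K (IsLocalRing.maximalIdeal D) J) φ) ∧
      ∀ e, ∀ l : R →+ R, (∀ a b, l (a ^ p ^ e * b) = a ^ p ^ e * l b) →
        (∀ (a : K) r, l (a • r) = a • l r) →
        ∃ L : E →+ E, (∀ a b, L (a ^ p ^ e * b) = a ^ p ^ e * L b) ∧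
          ∀ r, L (φ (1 ⊗ₜ r)) = φ (1 ⊗ₜ l r) := by
  obtain ⟨d, f, φ, h⟩ := thmT hK hR p H
  exact ⟨_, _, φ, h⟩

lemma klin {k K : Type*} [Field k] [PerfectField k] [CommRing K] [Algebra k K] (p e : ℕ)
    [ExpChar k p] (l : K →+ K) (hl : ∀ a b, l (a ^ p ^ e * b) = a ^ p ^ e * l b) (c : k) (b : K) :
    l (c • b) = c • l b := by
  obtain ⟨d, rfl⟩ : ∃ d : k, d ^ p ^ e = c := by
    obtain ⟨d, hd⟩ := (iterateFrobeniusEquiv k p e).surjective c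
    exact ⟨d, hd⟩
  rw [Algebra.smul_def, Algebra.smul_def, map_pow, hl]

lemma ext_right {k K L : Type*} [Field k] [PerfectField k] [CommRing K] [Algebra k K]
    [CommRing L] [Algebra k L] (p e : ℕ)
    [ExpChar k p] (l : K →+ K) (hl : ∀ a b, l (a ^ p ^ e * b) = a ^ p ^ e * l b) :
    ∃ Λ : L ⊗[k] K →+ L ⊗[k] K, (∀ a b, Λ (a ^ p ^ e * b) = a ^ p ^ e * Λ b) ∧
      (∀ (a : L) r, Λ (a • r) = a • Λ r) ∧ ∀ x y, Λ (x ⊗ₜ y) = x ⊗ₜ l y := by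
  let l' : K →ₗ[k] K := { l with map_smul' := fun c b => klin p e l hl c b }
  refine ⟨(LinearMap.lTensor L l').toAddMonoidHom, ?_, ?_, ?_⟩
  · intro a b
    exact qlin_tensor (K := k) p e l' hl a b
  · intro a r
    induction r with
    | zero => rw [smul_zero, map_zero, smul_zero]
    | add x y hx hy => rw [smul_add, map_add, map_add, smul_add, hx, hy]
    | tmul x y => rfl
  · intro x y
    rfl

lemma hext_left {k K L : Type*} [Field k] [PerfectField k] [CommRing K] [Algebra k K]
    [CommRing L] [Algebra k L] (p e : ℕ) [ExpChar k p] : HExt L (L ⊗[k] K) (p ^ e) := by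
  intro l hl
  obtain ⟨Λ, h1, -, h3⟩ := ext_right (k := k) (L := K) p e l hl
  let c := Algebra.TensorProduct.comm k K L
  refine ⟨(c : K ⊗[k] L →+* L ⊗[k] K).toAddMonoidHom.comp
    (Λ.comp (c.symm : L ⊗[k] K →+* K ⊗[k] L).toAddMonoidHom), ?_, ?_⟩
  · intro a b
    change c (Λ (c.symm (a ^ p ^ e * b))) = a ^ p ^ e * c (Λ (c.symm b))
    rw [map_mul, map_pow, h1, map_mul, map_pow, AlgEquiv.apply_symm_apply]
  · intro a
    change c (Λ (c.symm (a ⊗ₜ 1))) = l a ⊗ₜ 1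
    have : c.symm (a ⊗ₜ 1) = 1 ⊗ₜ a := rfl
    rw [this, h3]
    rfl

universe uk uL uA uB

lemma mixI_ne_top {L B R : Type*} [Field L] [CommRing B] [IsLocalRing B] [CommRing R] [Nontrivial R]
    [Algebra L B] [Algebra L R] :
    mixI L (IsLocalRing.maximalIdeal B) (⊥ : Ideal R) ≠ ⊤ := by
  let F := Algebra.TensorProduct.map
    (IsScalarTower.toAlgHom L B (IsLocalRing.ResidueField B)) (AlgHom.id L R)
  have h : mixI L (IsLocalRing.maximalIdeal B) (⊥ : Ideal R) ≤ RingHom.ker F.toRingHom := by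
    refine mixI_le (fun b hb => ?_) (fun r hr => ?_)
    · change F (b ⊗ₜ 1) = 0
      have h0 : IsScalarTower.toAlgHom L B (IsLocalRing.ResidueField B) b = 0 :=
        (IsLocalRing.residue_eq_zero_iff b).2 hb
      rw [Algebra.TensorProduct.map_tmul, h0, TensorProduct.zero_tmul]
    · rw [Ideal.mem_bot.1 hr, TensorProduct.tmul_zero]
      exact zero_mem _
  intro ht
  rw [ht] at h
  exact RingHom.ker_ne_top F.toRingHom (top_le_iff.1 h)

theorem core {k : Type uk} {K : Type uK} {L : Type uL} {A : Type uA} {B : Type uB}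
    [Field k] [PerfectField k] [Field K] [Field L] [Algebra k K] [Algebra k L]
    [CommRing A] [IsDomain A] [IsNoetherianRing A] [IsLocalRing A] [IsIntegrallyClosed A]
    [IsAdicComplete (IsLocalRing.maximalIdeal A) A]
    [CommRing B] [IsDomain B] [IsNoetherianRing B] [IsLocalRing B] [IsIntegrallyClosed B]
    [IsAdicComplete (IsLocalRing.maximalIdeal B) B]
    [Algebra k A] [Algebra K A] [IsScalarTower k K A]
    [Algebra k B] [Algebra L B] [IsScalarTower k L B]
    (hA : ∀ d : A, ∃ a : K, d - algebraMap K A a ∈ IsLocalRing.maximalIdeal A)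
    (hB : ∀ d : B, ∃ a : L, d - algebraMap L B a ∈ IsLocalRing.maximalIdeal B)
    (hN : IsNoetherianRing (L ⊗[k] K)) :
    ∃ (E : Type (max uA uB uL uK)) (_ : CommRing E) (f : A ⊗[k] B →+* E),
      Nice E ∧ IsCpl (mixI k (IsLocalRing.maximalIdeal A) (IsLocalRing.maximalIdeal B)) f := by
  obtain ⟨p, hp⟩ := ExpChar.exists k
  have _ : ExpChar K p := expChar_of_injective_algebraMap (algebraMap k K).injective p
  have _ : ExpChar L p := expChar_of_injective_algebraMap (algebraMap k L).injective p
  have hR1 : Nice (L ⊗[k] K) := nice_fields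
  have _ : Nontrivial (L ⊗[k] K) := inferInstance
  obtain ⟨R2, _, φ2, hN2, hNo2, hc2, hl2⟩ := thmE (K := L) (R := L ⊗[k] K) hB hR1 p
    (fun e => hext_left p e)
  have hc := hc2 ⊥ inferInstance
  let i2 : K →+* R2 := φ2.comp
    ((Algebra.TensorProduct.includeRight (R := L) (A := B) (B := L ⊗[k] K)).toRingHom.comp
      (Algebra.TensorProduct.includeRight (R := k) (A := L) (B := K)).toRingHom)
  have hi2 : ∀ c, i2 c = φ2 (1 ⊗ₜ (1 ⊗ₜ c)) := fun _ => rfl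
  let _ : Algebra K R2 := i2.toAlgebra
  have hH : ∀ e, HExt K R2 (p ^ e) := by
    intro e l hl
    obtain ⟨Λ, h1, h2, h3⟩ := ext_right (k := k) (L := L) p e l hl
    obtain ⟨M, hM1, hM2⟩ := hl2 e Λ h1 h2
    refine ⟨M, hM1, fun a => ?_⟩
    change M (i2 a) = i2 (l a)
    rw [hi2, hi2, hM2, h3]
  let g : K ⊗[k] B ≃+* B ⊗[L] (L ⊗[k] K) :=
    (Algebra.TensorProduct.comm k K B).toRingEquiv.trans
      (Algebra.TensorProduct.cancelBaseChange k L L B K).symm.toRingEquiv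
  have hg : ∀ c b, g (c ⊗ₜ b) = b ⊗ₜ (1 ⊗ₜ c) := fun c b => by
    change (Algebra.TensorProduct.cancelBaseChange k L L B K).symm (b ⊗ₜ c) = _
    simp
  have hgI : (mixI k (⊥ : Ideal K) (IsLocalRing.maximalIdeal B)).map
      (g : K ⊗[k] B →+* B ⊗[L] (L ⊗[k] K)) = mixI L (IsLocalRing.maximalIdeal B) ⊥ := by
    refine le_antisymm ?_ (mixI_le ?_ ?_)
    · rw [Ideal.map_le_iff_le_comap]
      refine mixI_le (fun a ha => ?_) (fun b hb => ?_)
      · rw [Ideal.mem_bot.1 ha, TensorProduct.zero_tmul]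
        exact zero_mem _
      · rw [Ideal.mem_comap]
        change g (1 ⊗ₜ b) ∈ _
        rw [hg]
        exact mixI_left hb _
    · intro b hb
      have : g (1 ⊗ₜ b) ∈ (mixI k (⊥ : Ideal K) (IsLocalRing.maximalIdeal B)).map
        (g : K ⊗[k] B →+* B ⊗[L] (L ⊗[k] K)) :=
          Ideal.mem_map_of_mem (g : K ⊗[k] B →+* B ⊗[L] (L ⊗[k] K)) (mixI_right hb 1)
      rw [hg] at this
      exact this
    · intro b hb
      rw [Ideal.mem_bot.1 hb, TensorProduct.tmul_zero]
      exact zero_mem _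
  rw [← hgI] at hc
  have hc' := IsCpl.trans (PreCpl.precomp (E := R2) g) hc
  let φ : K ⊗[k] B →ₐ[K] R2 :=
    { φ2.comp (g : K ⊗[k] B →+* B ⊗[L] (L ⊗[k] K)) with
      commutes' := fun c => by
        change φ2 (g (c ⊗ₜ 1)) = i2 c
        rw [hg, hi2] }
  have hφ : IsCpl (mixI k (⊥ : Ideal K) (IsLocalRing.maximalIdeal B)) φ.toRingHom := hc'
  have _ : Nontrivial R2 := by
    obtain ⟨ψ, -⟩ := (hc2 ⊥ inferInstance).psi 1
    have : mixI L (IsLocalRing.maximalIdeal B) (⊥ : Ideal (L ⊗[k] K)) ^ 1 ≠ ⊤ := by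
      rw [pow_one]
      exact mixI_ne_top
    have _ : Nontrivial ((B ⊗[L] (L ⊗[k] K)) ⧸
      mixI L (IsLocalRing.maximalIdeal B) (⊥ : Ideal (L ⊗[k] K)) ^ 1) :=
        Ideal.Quotient.nontrivial_iff.mpr this
    exact ψ.domain_nontrivial
  obtain ⟨E, _, Φ, hE1, -, hE2, -⟩ := thmE (K := K) (R := R2) hA hN2 p hH
  obtain ⟨f, hf⟩ := isCpl_base (IsLocalRing.maximalIdeal A) (IsLocalRing.maximalIdeal B) φ
    hφ.toPreCpl Φ (hE2 _ hφ.complete)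
  exact ⟨E, _, f, hE1, hf⟩

end Assembly2
end CTN

namespace CTN
section Final

lemma local_normal {A : Type*} [CommRing A] [IsLocalRing A] (h : IsNormalRing A) :
    IsDomain A ∧ IsIntegrallyClosed A := by
  obtain ⟨h1, h2⟩ := h (IsLocalRing.maximalIdeal A) inferInstance
  let e := IsLocalization.atUnits A (IsLocalRing.maximalIdeal A).primeCompl
    (S := Localization.AtPrime (IsLocalRing.maximalIdeal A)) (by
      intro x hx
      have hx' : x ∉ IsLocalRing.maximalIdeal A := hx
      rw [IsLocalRing.mem_maximalIdeal, mem_nonunits_iff, not_not] at hx'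
      exact hx')
  have hd : IsDomain A := e.toRingEquiv.toMulEquiv.isDomain _
  exact ⟨hd, IsIntegrallyClosed.of_equiv e.symm.toRingEquiv⟩

lemma tensorRadical_eq {k A B : Type*} [Field k] [CommRing A] [CommRing B]
    [IsLocalRing A] [IsLocalRing B] [Algebra k A] [Algebra k B] :
    tensorRadical k A B = mixI k (IsLocalRing.maximalIdeal A) (IsLocalRing.maximalIdeal B) := by
  rw [tensorRadical, IsLocalRing.jacobson_eq_maximalIdeal _ bot_ne_top,
    IsLocalRing.jacobson_eq_maximalIdeal _ bot_ne_top]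
  rfl

lemma noeth_residue {k A B : Type*} [Field k] [CommRing A] [CommRing B]
    [IsLocalRing A] [IsLocalRing B] [Algebra k A] [Algebra k B]
    (hE : IsNoetherianRing (CompletedTensor k A B)) :
    IsNoetherianRing (IsLocalRing.ResidueField B ⊗[k] IsLocalRing.ResidueField A) := by
  have h1 : IsNoetherianRing ((A ⊗[k] B) ⧸ tensorRadical k A B ^ 1) :=
    isNoetherianRing_of_surjective _ _
      (AdicCompletion.evalₐ (tensorRadical k A B) 1).toRingHom
      (AdicCompletion.surjective_evalₐ (tensorRadical k A B) 1)
  let F := Algebra.TensorProduct.map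
    (IsScalarTower.toAlgHom k A (IsLocalRing.ResidueField A))
    (IsScalarTower.toAlgHom k B (IsLocalRing.ResidueField B))
  have hF : Function.Surjective F := by
    intro t
    induction t with
    | zero => exact ⟨0, map_zero _⟩
    | add x y hx hy =>
      obtain ⟨a, rfl⟩ := hx
      obtain ⟨b, rfl⟩ := hy
      exact ⟨a + b, map_add _ _ _⟩
    | tmul x y =>
      obtain ⟨a, rfl⟩ := IsLocalRing.residue_surjective x
      obtain ⟨b, rfl⟩ := IsLocalRing.residue_surjective y
      exact ⟨a ⊗ₜ b, rfl⟩
  have h : tensorRadical k A B ^ 1 ≤ RingHom.ker F.toRingHom := by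
    rw [pow_one, tensorRadical_eq]
    refine mixI_le (fun a ha => ?_) (fun b hb => ?_)
    · change F (a ⊗ₜ 1) = 0
      have h0 : IsScalarTower.toAlgHom k A (IsLocalRing.ResidueField A) a = 0 :=
        (IsLocalRing.residue_eq_zero_iff a).2 ha
      rw [Algebra.TensorProduct.map_tmul, h0, TensorProduct.zero_tmul]
    · change F (1 ⊗ₜ b) = 0
      have h0 : IsScalarTower.toAlgHom k B (IsLocalRing.ResidueField B) b = 0 :=
        (IsLocalRing.residue_eq_zero_iff b).2 hb
      rw [Algebra.TensorProduct.map_tmul, h0, TensorProduct.tmul_zero]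
  have h2 : IsNoetherianRing (IsLocalRing.ResidueField A ⊗[k] IsLocalRing.ResidueField B) :=
    isNoetherianRing_of_surjective _ _
      (Ideal.Quotient.lift (tensorRadical k A B ^ 1) F.toRingHom fun a ha => h ha)
      (Ideal.Quotient.lift_surjective_of_surjective _ _ hF)
  exact isNoetherianRing_of_ringEquiv _ (Algebra.TensorProduct.comm k
    (IsLocalRing.ResidueField A) (IsLocalRing.ResidueField B)).toRingEquiv

theorem main {k A B : Type*} [Field k] [PerfectField k]
    [CommRing A] [CommRing B] [IsNoetherianRing A] [IsNoetherianRing B]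
    [IsLocalRing A] [IsLocalRing B]
    [IsAdicComplete (IsLocalRing.maximalIdeal A) A]
    [IsAdicComplete (IsLocalRing.maximalIdeal B) B]
    [Algebra k A] [Algebra k B]
    (hE : IsNoetherianRing (CompletedTensor k A B))
    (hA : IsNormalRing A) (hB : IsNormalRing B) :
    IsNormalRing (CompletedTensor k A B) := by
  obtain ⟨_, _⟩ := local_normal hA
  obtain ⟨_, _⟩ := local_normal hB
  obtain ⟨gA, hgA⟩ := coeff_field (k := k) (A := A)
  obtain ⟨gB, hgB⟩ := coeff_field (k := k) (A := B)
  let _ : Algebra (IsLocalRing.ResidueField A) A := gA.toRingHom.toAlgebra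
  let _ : Algebra (IsLocalRing.ResidueField B) B := gB.toRingHom.toAlgebra
  have _ : IsScalarTower k (IsLocalRing.ResidueField A) A :=
    IsScalarTower.of_algebraMap_eq fun x => (gA.commutes x).symm
  have _ : IsScalarTower k (IsLocalRing.ResidueField B) B :=
    IsScalarTower.of_algebraMap_eq fun x => (gB.commutes x).symm
  obtain ⟨E, _, f, hN, hf⟩ := core (k := k) (K := IsLocalRing.ResidueField A)
    (L := IsLocalRing.ResidueField B) (A := A) (B := B)
    (fun d => ⟨IsLocalRing.residue A d, by
      rw [← IsLocalRing.residue_eq_zero_iff, map_sub, sub_eq_zero]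
      exact (hgA _).symm⟩)
    (fun d => ⟨IsLocalRing.residue B d, by
      rw [← IsLocalRing.residue_eq_zero_iff, map_sub, sub_eq_zero]
      exact (hgB _).symm⟩) (noeth_residue hE)
  rw [← tensorRadical_eq] at hf
  obtain ⟨e⟩ := hf.equiv
  exact (hN.of_equiv e).isNormalRing

end Final
end CTN

/-- **Statement 15.** Let `k` be a perfect field and `A` and `B` two complete Noetherian
local commutative rings containing `k` such that `A ⊗̂[k] B` is Noetherian. If `A` and
`B` are normal, then `A ⊗̂[k] B` is normal. -/
theorem isNormalRing_completedTensor (k A B : Type*) [Field k] [PerfectField k]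
    [CommRing A] [CommRing B] [IsNoetherianRing A] [IsNoetherianRing B]
    [IsLocalRing A] [IsLocalRing B]
    [IsAdicComplete (IsLocalRing.maximalIdeal A) A]
    [IsAdicComplete (IsLocalRing.maximalIdeal B) B]
    [Algebra k A] [Algebra k B]
    (hE : IsNoetherianRing (CompletedTensor k A B))
    (hA : IsNormalRing A) (hB : IsNormalRing B) :
    IsNormalRing (CompletedTensor k A B) := by
  exact CTN.main hE hA hB
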